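/- There exists a set R_A ⊆ [0,1] of irrational numbers whose complement in [0,1] has Lebesgue measure zero, with the following property. Let f and g be C³ orientation-preserving circle homeomorphisms, each having exactly one critical point (non-flat), denoted c_f and c_g respectively, with ρ(f)=ρ(g)∈R_A. Let 𝒜 be the set of points x∈S¹ for which there exists a quasisymmetric circle homeomorphism h with h∘f=g∘h and h(x)=c_g, and let ℬ=S¹∖𝒜. Then 𝒜 is dense in S¹, while ℬ contains a residual subset of S¹ (a countable intersection of dense open sets) and μ_f(ℬ)=1, where μ_f is the unique f-invariant Borel probability measure. -/

import Mathlib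

noncomputable section

open Set Filter MeasureTheory Topology

/-- The circle `ℝ/ℤ`. -/
abbrev S1 := AddCircle (1 : ℝ)

/-- `F` is an (orientation-preserving) lift of the circle map `f`. -/
def IsLift (f : S1 → S1) (F : ℝ → ℝ) : Prop :=
  StrictMono F ∧ Function.Surjective F ∧ (∀ x : ℝ, F (x + 1) = F x + 1) ∧
    ∀ x : ℝ, f (x : S1) = (F x : S1)

/-- `f` is an orientation-preserving circle homeomorphism. -/
def IsCircleHomeo (f : S1 → S1) : Prop := ∃ F : ℝ → ℝ, IsLift f F

/-- `f` has rotation number `ρ ∈ [0,1)`: some lift of `f` has translation number `ρ`. -/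
def HasRotNum (f : S1 → S1) (ρ : ℝ) : Prop :=
  ∃ F : ℝ → ℝ, IsLift f F ∧ Tendsto (fun n : ℕ => F^[n] 0 / (n : ℝ)) atTop (𝓝 ρ)

/-- The lift `F` has a non-flat (power-law) critical point at `c`:
on a neighbourhood `W` of `c`, `F y = F c + φ(y)|φ(y)|^(d-1)` for a `C³` diffeomorphism `φ`
with `φ c = 0`. -/
def NonFlatAt (F : ℝ → ℝ) (c : ℝ) : Prop :=
  ∃ d : ℝ, 1 < d ∧ ∃ W : Set ℝ, IsOpen W ∧ c ∈ W ∧ ∃ φ : ℝ → ℝ,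
    ContDiffOn ℝ 3 φ W ∧ InjOn φ W ∧ (∀ y ∈ W, deriv φ y ≠ 0) ∧ φ c = 0 ∧
    ∀ y ∈ W, F y = F c + φ y * |φ y| ^ (d - 1)

/-- `f` is a `C^k` unicritical circle map: an orientation-preserving `C^k` circle
homeomorphism whose only critical point is `c`, and it is non-flat. -/
def Unicritical (f : S1 → S1) (c : S1) (k : ℕ∞) : Prop :=
  ∃ (F : ℝ → ℝ) (x₀ : ℝ), IsLift f F ∧ ContDiff ℝ k F ∧ (x₀ : S1) = c ∧
    {x : ℝ | deriv F x = 0} = {x : ℝ | ∃ m : ℤ, x = x₀ + m} ∧ NonFlatAt F x₀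

/-- `f` is a `C^k` bi-critical circle map: an orientation-preserving `C^k` circle
homeomorphism with exactly two critical points `c₁ ≠ c₂`, both non-flat. -/
def Bicritical (f : S1 → S1) (c₁ c₂ : S1) (k : ℕ∞) : Prop :=
  c₁ ≠ c₂ ∧ ∃ (F : ℝ → ℝ) (x₁ x₂ : ℝ), IsLift f F ∧ ContDiff ℝ k F ∧
    (x₁ : S1) = c₁ ∧ (x₂ : S1) = c₂ ∧
    {x : ℝ | deriv F x = 0} =
      {x : ℝ | ∃ m : ℤ, x = x₁ + m} ∪ {x : ℝ | ∃ m : ℤ, x = x₂ + m} ∧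
    NonFlatAt F x₁ ∧ NonFlatAt F x₂

/-- `h` is a quasisymmetric (orientation-preserving) circle homeomorphism. -/
def QuasiSymm (h : S1 → S1) : Prop :=
  ∃ H : ℝ → ℝ, IsLift h H ∧ ∃ M : ℝ, 1 < M ∧ ∀ x t : ℝ, 0 < t →
    1 / M ≤ (H (x + t) - H x) / (H x - H (x - t)) ∧
      (H (x + t) - H x) / (H x - H (x - t)) ≤ M

/-- The length (in `[0,1)`) of the positively oriented arc from `x` to `y`. -/
def arcLen (x y : S1) : ℝ := (AddCircle.equivIco 1 0 (y - x) : ℝ)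

/-- The positively oriented open arc from `x` to `y` on the circle. -/
def posArc (x y : S1) : Set S1 := (fun t : ℝ => x + (t : S1)) '' Ioo 0 (arcLen x y)

/-- Distortion bound: `G'(x) G'(y) (y - x)² ≤ K (G y - G x)²`. -/
def DB (G : ℝ → ℝ) (x y K : ℝ) : Prop :=
  deriv G x * deriv G y * (y - x) ^ 2 ≤ K * (G y - G x) ^ 2

theorem DB.mono {G : ℝ → ℝ} {x y K L : ℝ} (h : DB G x y K) (hKL : K ≤ L) : DB G x y L :=
  le_trans h (mul_le_mul_of_nonneg_right hKL (sq_nonneg _))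

theorem DB.comp {G H : ℝ → ℝ} {x y K L : ℝ} (hH : DifferentiableAt ℝ H x)
    (hH' : DifferentiableAt ℝ H y) (hG : DifferentiableAt ℝ G (H x))
    (hG' : DifferentiableAt ℝ G (H y)) (h0 : 0 ≤ deriv G (H x)) (h1 : 0 ≤ deriv G (H y))
    (hK : 0 ≤ K) (h : DB H x y K) (h' : DB G (H x) (H y) L) : DB (G ∘ H) x y (L * K) := by
  unfold DB at *
  rw [deriv_comp x hG hH, deriv_comp y hG' hH']
  have h2 : 0 ≤ deriv G (H x) * deriv G (H y) := mul_nonneg h0 h1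
  calc _ = (deriv G (H x) * deriv G (H y)) * (deriv H x * deriv H y * (y - x) ^ 2) := by ring
    _ ≤ (deriv G (H x) * deriv G (H y)) * (K * (H y - H x) ^ 2) :=
          mul_le_mul_of_nonneg_left h h2
    _ = K * (deriv G (H x) * deriv G (H y) * (H y - H x) ^ 2) := by ring
    _ ≤ K * (L * (G (H y) - G (H x)) ^ 2) := mul_le_mul_of_nonneg_left h' hK
    _ = _ := by simp only [Function.comp]; ring

/-- Trapezoid-type estimate. -/
theorem trapezoid_le {G g g1 g2 : ℝ → ℝ} {u v M : ℝ}
    (hG : ∀ t ∈ Icc u v, HasDerivAt G (g t) t) (hg : ∀ t ∈ Icc u v, HasDerivAt g (g1 t) t)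
    (hg1 : ∀ t ∈ Icc u v, HasDerivAt g1 (g2 t) t) (hM : ∀ t ∈ Icc u v, |g2 t| ≤ M)
    {x y : ℝ} (hx : x ∈ Icc u v) (hy : y ∈ Icc u v) (hxy : x ≤ y) :
    (y - x) * (g x + g y) / 2 ≤ G y - G x + M * (y - x) ^ 3 / 2 := by
  have hM0 : 0 ≤ M := le_trans (abs_nonneg _) (hM x hx)
  have sub : ∀ t ∈ Icc x y, t ∈ Icc u v := fun t ht => ⟨hx.1.trans ht.1, ht.2.trans hy.2⟩
  have key : ∀ t ∈ Icc x y, |g t - g x - (t - x) * g1 t| ≤ M * (t - x) ^ 2 := by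
    intro t ht
    have lip : ∀ s ∈ Icc x t, ‖g1 s - g1 t‖ ≤ M * (t - x) := by
      intro s hs
      have := (convex_Icc x t).norm_image_sub_le_of_norm_hasDerivWithin_le (f := g1) (f' := g2)
        (C := M) (fun r hr => (hg1 r (sub r ⟨hr.1, hr.2.trans ht.2⟩)).hasDerivWithinAt)
        (fun r hr => hM r (sub r ⟨hr.1, hr.2.trans ht.2⟩)) (right_mem_Icc.2 ht.1) hs
      refine this.trans (mul_le_mul_of_nonneg_left ?_ hM0)
      rw [Real.norm_eq_abs, abs_le]; constructor <;> linarith [hs.1, hs.2]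
    have := (convex_Icc x t).norm_image_sub_le_of_norm_hasDerivWithin_le
        (f := fun s => g s - s * g1 t) (f' := fun s => g1 s - 1 * g1 t)
        (C := M * (t - x)) (fun r hr => ((hg r (sub r ⟨hr.1, hr.2.trans ht.2⟩)).sub
          ((hasDerivAt_id r).mul_const _)).hasDerivWithinAt)
        (fun r hr => by simpa using lip r hr) (left_mem_Icc.2 ht.1) (right_mem_Icc.2 ht.1)
    rw [Real.norm_eq_abs, Real.norm_eq_abs, abs_of_nonneg (by linarith [ht.1] : 0 ≤ t - x)] at this
    calc _ = |g t - t * g1 t - (g x - x * g1 t)| := by congr 1; ring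
      _ ≤ _ := this
      _ = _ := by ring
  have := (convex_Icc x y).norm_image_sub_le_of_norm_hasDerivWithin_le
      (f := fun t => G t - (t - x) * (g x + g t) / 2)
      (f' := fun t => g t - (1 * (g x + g t) + (t - x) * g1 t) / 2)
      (C := M * (y - x) ^ 2 / 2) (fun r hr => (((hG r (sub r hr)).sub
          ((((hasDerivAt_id r).sub_const x).mul ((hg r (sub r hr)).const_add (g x))).div_const
          2))).hasDerivWithinAt)
      (fun t ht => by
        have h1 := key t ht
        have : g t - (1 * (g x + g t) + (t - x) * g1 t) / 2 = (g t - g x - (t - x) * g1 t) / 2 := by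
          ring
        rw [this, Real.norm_eq_abs, abs_div, abs_two]
        have h2 : (t - x) ^ 2 ≤ (y - x) ^ 2 :=
          pow_le_pow_left₀ (by linarith [ht.1]) (by linarith [ht.2]) 2
        have := mul_le_mul_of_nonneg_left h2 hM0
        linarith) (left_mem_Icc.2 hxy) (right_mem_Icc.2 hxy)
  rw [Real.norm_eq_abs, Real.norm_eq_abs, abs_of_nonneg (by linarith : 0 ≤ y - x)] at this
  have h3 := neg_le_of_abs_le this
  simp only [sub_self, zero_mul, zero_div, sub_zero] at h3
  nlinarith [h3]

theorem DB_of_contDiffOn {G : ℝ → ℝ} {W : Set ℝ} (hW : IsOpen W) (hG : ContDiffOn ℝ 3 G W)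
    {u v : ℝ} (huv : u ≤ v) (hs : Icc u v ⊆ W) (hpos : ∀ t ∈ Icc u v, 0 < deriv G t) :
    ∃ C : ℝ, 0 ≤ C ∧ ∀ x ∈ Icc u v, ∀ y ∈ Icc u v, x ≤ y →
      DB G x y (Real.exp (C * (y - x) ^ 2)) := by
  have d1 : ContDiffOn ℝ 2 (deriv G) W := hG.deriv_of_isOpen hW (by norm_num)
  have d2 : ContDiffOn ℝ 1 (deriv (deriv G)) W := d1.deriv_of_isOpen hW (by norm_num)
  have d3 : ContDiffOn ℝ 0 (deriv (deriv (deriv G))) W := d2.deriv_of_isOpen hW (by norm_num)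
  have hd : ∀ {f : ℝ → ℝ} {n : WithTop ℕ∞}, ContDiffOn ℝ n f W → n ≠ 0 → ∀ t ∈ Icc u v,
      HasDerivAt f (deriv f t) t := by
    intro f n hf hn t ht
    exact ((hf.contDiffAt (hW.mem_nhds (hs ht))).differentiableAt hn).hasDerivAt
  have c1 : ContinuousOn (deriv G) (Icc u v) := d1.continuousOn.mono hs
  have c3 : ContinuousOn (deriv (deriv (deriv G))) (Icc u v) := d3.continuousOn.mono hs
  obtain ⟨t0, ht0, hmin⟩ := isCompact_Icc.exists_isMinOn (nonempty_Icc.2 huv) c1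
  obtain ⟨M, hM⟩ := isCompact_Icc.exists_bound_of_continuousOn c3
  set m := deriv G t0 with hm
  have hm0 : 0 < m := hpos t0 ht0
  have hmm : ∀ t ∈ Icc u v, m ≤ deriv G t := fun t ht => hmin ht
  have hM0 : 0 ≤ M := le_trans (norm_nonneg _) (hM u (left_mem_Icc.2 huv))
  refine ⟨M / m, div_nonneg hM0 hm0.le, fun x hx y hy hxy => ?_⟩
  have tr := trapezoid_le (hd hG (by norm_num)) (hd d1 (by norm_num)) (hd d2 (by norm_num))
    (fun t ht => hM t ht) hx hy hxy
  have hlow : m * (y - x) ≤ G y - G x := by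
    refine (convex_Icc u v).mul_sub_le_image_sub_of_le_deriv (hG.continuousOn.mono hs) ?_ ?_
      x hx y hy hxy
    · intro t ht
      exact (hd hG (by norm_num) t (interior_subset ht)).differentiableAt.differentiableWithinAt
    · intro t ht; exact hmm t (interior_subset ht)
  have hl0 : 0 ≤ y - x := by linarith
  set l := y - x
  set D := G y - G x
  have hD : 0 ≤ D := le_trans (mul_nonneg hm0.le hl0) hlow
  have h1 : l * (deriv G x + deriv G y) / 2 ≤ D * (1 + M / m * l ^ 2 / 2) := by
    have : M * l ^ 3 / 2 ≤ D * (M / m * l ^ 2 / 2) := by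
      have := mul_le_mul_of_nonneg_right hlow (by positivity : 0 ≤ M / m * l ^ 2 / 2)
      calc _ = m * l * (M / m * l ^ 2 / 2) := by field_simp
        _ ≤ _ := this
    linarith
  have h2 : 1 + M / m * l ^ 2 / 2 ≤ Real.exp (M / m * l ^ 2 / 2) := by
    have := Real.add_one_le_exp (M / m * l ^ 2 / 2); linarith
  have gx := hpos x hx
  have gy := hpos y hy
  unfold DB
  calc deriv G x * deriv G y * l ^ 2 ≤ (l * (deriv G x + deriv G y) / 2) ^ 2 := by
        nlinarith [mul_nonneg (sq_nonneg l) (sq_nonneg (deriv G x - deriv G y))]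
    _ ≤ (D * Real.exp (M / m * l ^ 2 / 2)) ^ 2 := by
        apply pow_le_pow_left₀ (by positivity)
        exact h1.trans (mul_le_mul_of_nonneg_left h2 hD)
    _ = _ := by
        rw [mul_pow, ← Real.exp_nat_mul]; push_cast; rw [mul_comm]; congr 2; ring

theorem mul_sinh_le_sinh_mul {d a : ℝ} (hd : 1 ≤ d) (ha : 0 ≤ a) :
    d * Real.sinh a ≤ Real.sinh (d * a) := by
  have hmono : MonotoneOn (fun a => Real.sinh (d * a) - d * Real.sinh a) (Ici 0) := by
    apply monotoneOn_of_deriv_nonneg (convex_Ici 0)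
    · fun_prop
    · fun_prop
    · intro t ht
      rw [interior_Ici, mem_Ioi] at ht
      have h1 : HasDerivAt (fun a => Real.sinh (d * a) - d * Real.sinh a)
          (Real.cosh (d * t) * (d * 1) - d * Real.cosh t) t :=
        ((Real.hasDerivAt_sinh (d * t)).comp t ((hasDerivAt_id t).const_mul d)).sub
          ((Real.hasDerivAt_sinh t).const_mul d)
      rw [h1.deriv]
      have : Real.cosh t ≤ Real.cosh (d * t) := by
        rw [Real.cosh_le_cosh, abs_of_pos ht, abs_of_pos (by positivity)]
        nlinarith
      nlinarith
  have := hmono (self_mem_Ici) (mem_Ici.2 ha) ha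
  simp at this; linarith

/-- The power law map. -/
def Pw (d s : ℝ) : ℝ := s * |s| ^ (d - 1)

theorem Pw_of_nonneg {d s : ℝ} (hd : 1 < d) (hs : 0 ≤ s) : Pw d s = s ^ d := by
  unfold Pw
  rcases hs.eq_or_lt with rfl | h
  · simp [Real.zero_rpow (by linarith : d ≠ 0)]
  · rw [abs_of_pos h, Real.rpow_sub_one h.ne']; field_simp

theorem Pw_neg (d s : ℝ) : Pw d (-s) = - Pw d s := by simp [Pw]

theorem hasDerivAt_Pw {d : ℝ} (hd : 1 < d) (s : ℝ) :
    HasDerivAt (Pw d) (d * |s| ^ (d - 1)) s := by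
  have hpos : ∀ s : ℝ, 0 < s → HasDerivAt (Pw d) (d * |s| ^ (d - 1)) s := by
    intro s h
    have := Real.hasDerivAt_rpow_const (x := s) (p := d) (Or.inl h.ne')
    rw [abs_of_pos h]
    refine this.congr_of_eventuallyEq ?_
    filter_upwards [lt_mem_nhds h] with t ht using Pw_of_nonneg hd ht.le
  rcases lt_trichotomy s 0 with h | rfl | h
  · have h1 := hpos (-s) (by linarith)
    have h2 := (h1.comp s (hasDerivAt_neg s)).neg
    rw [abs_neg] at h2
    have e : Pw d = -Pw d ∘ Neg.neg := by funext t; simp [Pw_neg]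
    rw [e]
    exact h2.congr_deriv (by ring)
  · rw [hasDerivAt_iff_tendsto_slope, abs_zero, Real.zero_rpow (by linarith), mul_zero]
    have h1 : Tendsto (fun t : ℝ => |t| ^ (d - 1)) (𝓝[≠] 0) (𝓝 0) := by
      have : Continuous (fun t : ℝ => |t| ^ (d - 1)) :=
        continuous_abs.rpow_const (fun _ => Or.inr (by linarith))
      have := this.tendsto 0
      rw [abs_zero, Real.zero_rpow (by linarith)] at this
      exact this.mono_left nhdsWithin_le_nhds
    refine h1.congr' ?_
    filter_upwards [self_mem_nhdsWithin] with t ht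
    have ht : t ≠ 0 := ht
    simp only [slope, Pw, vsub_eq_sub, sub_zero, smul_eq_mul, zero_mul]
    field_simp
  · exact hpos s h

theorem deriv_Pw {d : ℝ} (hd : 1 < d) (s : ℝ) : deriv (Pw d) s = d * |s| ^ (d - 1) :=
  (hasDerivAt_Pw hd s).deriv

theorem DB_Pw_pos {d s t : ℝ} (hd : 1 < d) (hs : 0 ≤ s) (hst : s ≤ t) : DB (Pw d) s t 1 := by
  unfold DB
  rw [deriv_Pw hd, deriv_Pw hd, Pw_of_nonneg hd hs, Pw_of_nonneg hd (hs.trans hst), one_mul]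
  rcases hs.eq_or_lt with rfl | hs0
  · rw [abs_zero, Real.zero_rpow (by linarith : d - 1 ≠ 0)]; simp; positivity
  have ht0 : 0 < t := hs0.trans_le hst
  rw [abs_of_pos hs0, abs_of_pos ht0]
  set p := Real.log s
  set q := Real.log t
  have hpq : p ≤ q := Real.log_le_log hs0 hst
  have es : s = Real.exp p := (Real.exp_log hs0).symm
  have et : t = Real.exp q := (Real.exp_log ht0).symm
  have hsh := mul_sinh_le_sinh_mul hd.le (a := (q - p) / 2) (by linarith)
  have dif : ∀ a b : ℝ, Real.exp b - Real.exp a =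
      2 * Real.exp ((a + b) / 2) * Real.sinh ((b - a) / 2) := by
    intro a b
    rw [Real.sinh_eq]
    have e1 : Real.exp b = Real.exp ((a + b) / 2) * Real.exp ((b - a) / 2) := by
      rw [← Real.exp_add]; congr 1; ring
    have e2 : Real.exp a = Real.exp ((a + b) / 2) * Real.exp (-((b - a) / 2)) := by
      rw [← Real.exp_add]; congr 1; ring
    rw [e1, e2]; ring
  rw [es, et, ← Real.exp_mul, ← Real.exp_mul, ← Real.exp_mul, ← Real.exp_mul, dif p q,
    dif (p * d) (q * d)]
  have hs0 : 0 ≤ Real.sinh ((q - p) / 2) := Real.sinh_nonneg_iff.2 (by linarith)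
  have e3 : (q * d - p * d) / 2 = d * ((q - p) / 2) := by ring
  rw [e3]
  have e4 : Real.exp (p * (d - 1)) * Real.exp (q * (d - 1)) * Real.exp ((p + q) / 2) ^ 2
      = Real.exp ((p * d + q * d) / 2) ^ 2 := by
    rw [← Real.exp_nat_mul, ← Real.exp_nat_mul, ← Real.exp_add, ← Real.exp_add]
    congr 1; push_cast; ring
  calc _ = 4 * (Real.exp (p * (d - 1)) * Real.exp (q * (d - 1)) * Real.exp ((p + q) / 2) ^ 2)
        * (d * Real.sinh ((q - p) / 2)) ^ 2 := by ring
    _ ≤ 4 * Real.exp ((p * d + q * d) / 2) ^ 2 * (Real.sinh (d * ((q - p) / 2))) ^ 2 := by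
        rw [e4]; gcongr
    _ = _ := by ring

theorem DB.refl {G : ℝ → ℝ} {s t K : ℝ} (h : DB G s t K) : DB G t s K := by
  unfold DB at *; nlinarith [h]

theorem DB_Pw_neg {d s t : ℝ} (hd : 1 < d) (ht : t ≤ 0) (hst : s ≤ t) : DB (Pw d) s t 1 := by
  have := DB_Pw_pos hd (neg_nonneg.2 ht) (neg_le_neg hst)
  unfold DB at *
  rw [deriv_Pw hd, deriv_Pw hd] at *
  rw [abs_neg, abs_neg, Pw_neg, Pw_neg] at this
  nlinarith [this]

theorem DB_Pw {d : ℝ} (hd : 1 < d) (s t : ℝ) : DB (Pw d) s t (4 * d ^ 2) := by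
  have hd4 : (1 : ℝ) ≤ 4 * d ^ 2 := by nlinarith
  have main : ∀ s t : ℝ, s ≤ t → DB (Pw d) s t (4 * d ^ 2) := by
    intro s t hst
    rcases le_or_gt 0 s with hs | hs
    · exact (DB_Pw_pos hd hs hst).mono hd4
    rcases le_or_gt t 0 with ht | ht
    · exact (DB_Pw_neg hd ht hst).mono hd4
    unfold DB
    rw [deriv_Pw hd, deriv_Pw hd]
    obtain ⟨r, rfl⟩ : ∃ r, s = -r := ⟨-s, by ring⟩
    rw [Pw_neg, abs_neg, Pw_of_nonneg hd ht.le, Pw_of_nonneg hd (by linarith : 0 ≤ r)]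
    have hr : 0 < r := by linarith
    rw [abs_of_pos hr, abs_of_pos ht]
    set M := max r t
    have hM : 0 < M := lt_max_of_lt_left hr
    have h1 : r ^ (d - 1) ≤ M ^ (d - 1) :=
      Real.rpow_le_rpow hr.le (le_max_left _ _) (by linarith)
    have h2 : t ^ (d - 1) ≤ M ^ (d - 1) :=
      Real.rpow_le_rpow ht.le (le_max_right _ _) (by linarith)
    have h3 : t + r ≤ 2 * M := by linarith [le_max_left r t, le_max_right r t]
    have h4 : M ^ d ≤ t ^ d + r ^ d := by
      rcases max_choice r t with h | h <;> simp only [M, h] <;>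
        linarith [Real.rpow_nonneg hr.le d, Real.rpow_nonneg ht.le d]
    have h5 : M ^ (d - 1) * M = M ^ d := by rw [Real.rpow_sub_one hM.ne']; field_simp
    have p1 := Real.rpow_nonneg hr.le (d - 1)
    have p2 := Real.rpow_nonneg ht.le (d - 1)
    calc d * r ^ (d - 1) * (d * t ^ (d - 1)) * (t - -r) ^ 2
        = d ^ 2 * (r ^ (d - 1) * t ^ (d - 1) * (t + r) ^ 2) := by ring
      _ ≤ d ^ 2 * (M ^ (d - 1) * M ^ (d - 1) * (2 * M) ^ 2) := by gcongr
      _ = 4 * d ^ 2 * (M ^ (d - 1) * M) ^ 2 := by ring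
      _ = 4 * d ^ 2 * (M ^ d) ^ 2 := by rw [h5]
      _ ≤ 4 * d ^ 2 * (t ^ d + r ^ d) ^ 2 := by
          have := Real.rpow_nonneg hM.le d
          gcongr
      _ = _ := by ring
  rcases le_total s t with h | h
  · exact main s t h
  · exact (main t s h).refl

/-- Lifts of `C³` unicritical circle maps with critical point `c` of criticality `d`. -/
structure UC (F : ℝ → ℝ) (c d : ℝ) : Prop where
  mono : StrictMono F
  per : ∀ x, F (x + 1) = F x + 1
  smooth : ContDiff ℝ 3 F
  crit : ∀ x, deriv F x = 0 ↔ ∃ m : ℤ, x = c + m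
  one_lt : 1 < d
  nonflat : ∃ W : Set ℝ, IsOpen W ∧ c ∈ W ∧ ∃ φ : ℝ → ℝ,
    ContDiffOn ℝ 3 φ W ∧ InjOn φ W ∧ (∀ y ∈ W, deriv φ y ≠ 0) ∧ φ c = 0 ∧
    ∀ y ∈ W, F y = F c + Pw d (φ y)

namespace UC
variable {F : ℝ → ℝ} {c d : ℝ}

theorem differentiable (h : UC F c d) : Differentiable ℝ F := h.smooth.differentiable (by norm_num)

theorem continuous (h : UC F c d) : Continuous F := h.smooth.continuous

theorem deriv_nonneg (h : UC F c d) (x : ℝ) : 0 ≤ deriv F x := h.mono.monotone.deriv_nonneg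

theorem per_int (h : UC F c d) (x : ℝ) (m : ℤ) : F (x + m) = F x + m := by
  have hn : ∀ (n : ℕ) (x : ℝ), F (x + n) = F x + n := by
    intro n
    induction n with
    | zero => simp
    | succ n ih => intro x; push_cast; rw [← add_assoc, h.per, ih]; ring
  rcases Int.eq_nat_or_neg m with ⟨n, rfl | rfl⟩
  · exact_mod_cast hn n x
  · have := hn n (x + ((-n : ℤ) : ℝ))
    push_cast at *
    rw [show x + -(n : ℝ) + n = x by ring] at this
    linarith

theorem deriv_per (h : UC F c d) (x : ℝ) (m : ℤ) : deriv F (x + m) = deriv F x := by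
  have : F = fun y => F (y + m) - m := by funext y; rw [h.per_int]; ring
  conv_rhs => rw [this]
  rw [deriv_sub_const, deriv_comp_add_const]

theorem DB_per (h : UC F c d) {x y K : ℝ} (m : ℤ) (hh : DB F (x + m) (y + m) K) :
    DB F x y K := by
  unfold DB at *
  rw [h.deriv_per, h.deriv_per, h.per_int, h.per_int] at hh
  convert hh using 2 <;> ring

/-- The reflection of `F`. -/
theorem reflect (h : UC F c d) : UC (fun x => -F (-x)) (-c) d := by
  have hder : ∀ (G : ℝ → ℝ) (x : ℝ), deriv (fun x => -G (-x)) x = deriv G (-x) := by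
    intro G x
    rw [deriv.fun_neg, deriv_comp_neg]; ring
  refine ⟨fun x y hxy => neg_lt_neg (h.mono (neg_lt_neg hxy)), fun x => ?_, ?_, fun x => ?_,
    h.one_lt, ?_⟩
  · have := h.per (-(x + 1))
    rw [show -(x + 1) + 1 = -x by ring] at this
    linarith
  · exact (h.smooth.comp contDiff_neg).neg
  · rw [hder, h.crit]
    constructor
    · rintro ⟨m, hm⟩; exact ⟨-m, by push_cast; linarith⟩
    · rintro ⟨m, hm⟩; exact ⟨-m, by push_cast; linarith⟩
  · obtain ⟨W, hW, hc, φ, h1, h2, h3, h4, h5⟩ := h.nonflat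
    refine ⟨Neg.neg ⁻¹' W, hW.preimage continuous_neg, by simpa using hc, fun y => -φ (-y),
      ?_, ?_, ?_, ?_, ?_⟩
    · exact (h1.comp contDiff_neg.contDiffOn (fun x hx => hx)).neg
    · intro x hx y hy hxy
      have := h2 hx hy (neg_injective hxy)
      exact neg_injective this
    · intro y hy; rw [hder]; exact h3 _ hy
    · simp [h4]
    · intro y hy
      rw [h5 _ hy, Pw_neg, neg_neg]; ring

/-- Local normal form near the critical point. -/
theorem normal_form (h : UC F c d) : ∃ δ : ℝ, 0 < δ ∧ δ < 1 / 4 ∧ ∃ φ : ℝ → ℝ, ∃ W : Set ℝ,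
    IsOpen W ∧ Icc (c - δ) (c + δ) ⊆ W ∧ ContDiffOn ℝ 3 φ W ∧
    (∀ y ∈ Icc (c - δ) (c + δ), 0 < deriv φ y) ∧ φ c = 0 ∧
    (∀ y ∈ W, F y = F c + Pw d (φ y)) := by
  obtain ⟨W, hW, hc, φ, h1, h2, h3, h4, h5⟩ := h.nonflat
  obtain ⟨ε, hε, hball⟩ := Metric.isOpen_iff.1 hW c hc
  refine ⟨min (ε / 2) (1 / 8), by positivity, lt_of_le_of_lt (min_le_right _ _) (by norm_num),
    φ, W, hW, ?_, h1, ?_, h4, h5⟩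
  · intro y hy
    apply hball
    rw [Metric.mem_ball, Real.dist_eq, abs_lt]
    have := min_le_left (ε / 2) (1 / 8 : ℝ)
    constructor <;> linarith [hy.1, hy.2]
  set δ := min (ε / 2) (1 / 8 : ℝ)
  have hsub : Icc (c - δ) (c + δ) ⊆ W := by
    intro y hy
    apply hball
    rw [Metric.mem_ball, Real.dist_eq, abs_lt]
    have := min_le_left (ε / 2) (1 / 8 : ℝ)
    constructor <;> linarith [hy.1, hy.2]
  have hdφ : ∀ y ∈ W, DifferentiableAt ℝ φ y := fun y hy =>
    (h1.contDiffAt (hW.mem_nhds hy)).differentiableAt (by norm_num)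
  have hne : ∀ y ∈ W, y ≠ c → 0 < deriv φ y := by
    intro y hy hyc
    have hφ : φ y ≠ 0 := fun h0 => hyc (h2 hy hc (h0.trans h4.symm))
    have hF : HasDerivAt F (d * |φ y| ^ (d - 1) * deriv φ y) y := by
      have := ((hasDerivAt_Pw h.one_lt (φ y)).comp y (hdφ y hy).hasDerivAt).const_add (F c)
      refine this.congr_of_eventuallyEq ?_
      filter_upwards [hW.mem_nhds hy] with z hz using h5 z hz
    have h6 := h.deriv_nonneg y
    rw [hF.deriv] at h6
    have h7 : 0 < d * |φ y| ^ (d - 1) :=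
      mul_pos (by linarith [h.one_lt]) (Real.rpow_pos_of_pos (abs_pos.2 hφ) _)
    have h8 := nonneg_of_mul_nonneg_right h6 h7
    exact lt_of_le_of_ne h8 (h3 y hy).symm
  intro y hy
  by_cases hyc : y = c
  · subst hyc
    by_contra hcon
    have hneg : deriv φ y < 0 := lt_of_le_of_ne (not_lt.1 hcon) (h3 y hc)
    have hcont : ContinuousAt (deriv φ) y :=
      ((h1.deriv_of_isOpen (m := 2) hW (by norm_num)).continuousOn).continuousAt (hW.mem_nhds hc)
    have ev : ∀ᶠ z in 𝓝[≠] y, deriv φ z < 0 ∧ z ∈ W ∧ z ≠ y := by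
      filter_upwards [nhdsWithin_le_nhds (hcont.eventually (gt_mem_nhds hneg)),
        nhdsWithin_le_nhds (hW.mem_nhds hc), self_mem_nhdsWithin] with z a b e using ⟨a, b, e⟩
    obtain ⟨z, a, b, e⟩ := ev.exists
    exact absurd (hne z b e) (not_lt.2 a.le)
  · exact hne y (hsub hy) hyc

theorem surjective (h : UC F c d) : Function.Surjective F := by
  refine h.continuous.surjective ?_ ?_
  · refine tendsto_atTop.2 fun b => ?_
    filter_upwards [eventually_ge_atTop (((⌈b - F 0⌉ : ℤ) : ℝ))] with x hx
    have h1 := h.per_int 0 ⌈b - F 0⌉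
    have h2 := h.mono.monotone hx
    have := Int.le_ceil (b - F 0)
    rw [zero_add] at h1
    linarith
  · refine tendsto_atBot.2 fun b => ?_
    filter_upwards [eventually_le_atBot (((⌊b - F 0⌋ : ℤ) : ℝ))] with x hx
    have h1 := h.per_int 0 ⌊b - F 0⌋
    have h2 := h.mono.monotone hx
    have := Int.floor_le (b - F 0)
    rw [zero_add] at h1
    linarith

theorem sub_le_one (h : UC F c d) {x y : ℝ} (hxy : y ≤ x + 1) : F y - F x ≤ 1 := by
  have := h.mono.monotone hxy
  rw [h.per] at this; linarith

theorem deriv_bound (h : UC F c d) : ∃ M, 0 < M ∧ ∀ x, deriv F x ≤ M := by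
  have hc : Continuous (deriv F) := h.smooth.continuous_deriv (by norm_num)
  obtain ⟨M, hM⟩ := isCompact_Icc.exists_bound_of_continuousOn (s := Icc (0 : ℝ) 1) hc.continuousOn
  refine ⟨max M 1, by positivity, fun x => ?_⟩
  have := hM (Int.fract x) ⟨Int.fract_nonneg x, (Int.fract_lt_one x).le⟩
  rw [← h.deriv_per _ ⌊x⌋, Int.fract_add_floor] at this
  exact (le_abs_self _).trans (this.trans (le_max_left _ _))

theorem lower_of_gap (h : UC F c d) {δ : ℝ} (hδ : 0 < δ) (hδ1 : δ < 1) :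
    ∃ m, 0 < m ∧ ∀ x y, δ ≤ y - x → m * (y - x) ≤ F y - F x := by
  have hc : Continuous (fun x => F (x + δ) - F x) := by
    have := h.continuous; fun_prop
  obtain ⟨t0, ht0, hmin⟩ := isCompact_Icc.exists_isMinOn (nonempty_Icc.2 zero_le_one)
    (hc.continuousOn (s := Icc (0 : ℝ) 1))
  set m := F (t0 + δ) - F t0
  have hm : 0 < m := sub_pos.2 (h.mono (by linarith))
  have hlow : ∀ x, m ≤ F (x + δ) - F x := by
    intro x
    have := hmin (a := Int.fract x) ⟨Int.fract_nonneg x, (Int.fract_lt_one x).le⟩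
    have e1 := h.per_int (Int.fract x + δ) ⌊x⌋
    have e2 := h.per_int (Int.fract x) ⌊x⌋
    rw [show Int.fract x + δ + ⌊x⌋ = x + δ by linarith [Int.fract_add_floor x]] at e1
    rw [Int.fract_add_floor x] at e2
    simp only [mem_ofPred_eq] at this
    linarith
  refine ⟨min (m / 2) (1 / 2), by positivity, fun x y hxy => ?_⟩
  have hl : 0 < y - x := by linarith
  rcases le_or_gt (y - x) 2 with h2 | h2
  · have h3 := h.mono.monotone (by linarith : x + δ ≤ y)
    have := mul_le_mul_of_nonneg_right (min_le_left (m / 2) (1 / 2)) hl.le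
    nlinarith [hlow x]
  · have h3 := h.mono.monotone (show x + (⌊y - x⌋ : ℤ) ≤ y by linarith [Int.floor_le (y - x)])
    rw [h.per_int] at h3
    have := mul_le_mul_of_nonneg_right (min_le_right (m / 2) (1 / 2)) hl.le
    have := Int.lt_floor_add_one (y - x)
    linarith

theorem DB_far (h : UC F c d) {δ : ℝ} (hδ : 0 < δ) (hδ1 : δ < 1) :
    ∃ C, 1 ≤ C ∧ ∀ x y, δ ≤ y - x → DB F x y C := by
  obtain ⟨m, hm, hlow⟩ := h.lower_of_gap hδ hδ1
  obtain ⟨M, hM, hup⟩ := h.deriv_bound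
  refine ⟨max (M ^ 2 / m ^ 2) 1, le_max_right _ _, fun x y hxy => ?_⟩
  apply DB.mono _ (le_max_left _ _)
  unfold DB
  have h1 := hlow x y hxy
  have h2 : 0 ≤ m * (y - x) := by have : 0 ≤ y - x := by linarith
                                  positivity
  calc _ ≤ M * M * (y - x) ^ 2 := by
        have := h.deriv_nonneg x; have := h.deriv_nonneg y
        gcongr <;> apply hup
    _ = M ^ 2 / m ^ 2 * (m * (y - x)) ^ 2 := by field_simp
    _ ≤ _ := by gcongr

theorem DB_near (h : UC F c d) : ∃ δ C, 0 < δ ∧ δ < 1 / 4 ∧ 0 ≤ C ∧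
    ∀ x ∈ Icc (c - δ) (c + δ), ∀ y ∈ Icc (c - δ) (c + δ), x ≤ y →
      DB F x y (4 * d ^ 2 * Real.exp (C * (y - x) ^ 2)) ∧
      (c ∉ Ioo x y → DB F x y (Real.exp (C * (y - x) ^ 2))) := by
  obtain ⟨δ, hδ, hδ4, φ, W, hW, hsub, hφ, hpos, hφc, hF⟩ := h.normal_form
  obtain ⟨C, hC, hDB⟩ := DB_of_contDiffOn hW hφ (by linarith) hsub hpos
  refine ⟨δ, C, hδ, hδ4, hC, fun x hx y hy hxy => ?_⟩
  have hdφ : ∀ y ∈ W, DifferentiableAt ℝ φ y := fun y hy =>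
    (hφ.contDiffAt (hW.mem_nhds hy)).differentiableAt (by norm_num)
  have hmono : MonotoneOn φ (Icc (c - δ) (c + δ)) :=
    monotoneOn_of_deriv_nonneg (convex_Icc _ _) (hφ.continuousOn.mono hsub)
      (fun t ht => (hdφ t (hsub (interior_subset ht))).differentiableWithinAt)
      (fun t ht => (hpos t (interior_subset ht)).le)
  have hd := h.one_lt
  have red : ∀ L, DB (Pw d) (φ x) (φ y) L → DB F x y (L * Real.exp (C * (y - x) ^ 2)) := by
    intro L hL
    have h1 := DB.comp (hdφ x (hsub hx)) (hdφ y (hsub hy))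
      (hasDerivAt_Pw hd _).differentiableAt (hasDerivAt_Pw hd _).differentiableAt
      (by rw [deriv_Pw hd]; positivity) (by rw [deriv_Pw hd]; positivity) (Real.exp_pos _).le
      (hDB x hx y hy hxy) hL
    have e : ∀ z ∈ W, deriv F z = deriv (Pw d ∘ φ) z := by
      intro z hz
      have : F =ᶠ[𝓝 z] fun w => F c + (Pw d ∘ φ) w := by
        filter_upwards [hW.mem_nhds hz] with w hw using hF w hw
      rw [this.deriv_eq, deriv_const_add]
    unfold DB at *
    rw [e x (hsub hx), e y (hsub hy), hF x (hsub hx), hF y (hsub hy)]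
    convert h1 using 2
    simp
  refine ⟨red _ (DB_Pw hd _ _), fun hcn => ?_⟩
  rw [← one_mul (Real.exp _)]
  apply red
  have hcm : c ∈ Icc (c - δ) (c + δ) := ⟨by linarith, by linarith⟩
  rcases le_or_gt c x with hcx | hcx
  · exact DB_Pw_pos hd (hφc ▸ hmono hcm hx hcx) (hmono hx hy hxy)
  · have : y ≤ c := not_lt.1 fun hh => hcn ⟨hcx, hh⟩
    exact DB_Pw_neg hd (hφc ▸ hmono hy hcm this) (hmono hx hy hxy)

/-- The basic distortion estimates. -/
theorem DB_basic (h : UC F c d) : ∃ C, 1 ≤ C ∧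
    (∀ x y, x ≤ y → DB F x y (Real.exp C)) ∧
    ∀ x y, x ≤ y → (∀ m : ℤ, c + m ∉ Ioo x y) → DB F x y (Real.exp (C * (y - x) ^ 2)) := by
  obtain ⟨δ, C1, hδ, hδ4, hC1, hnear⟩ := h.DB_near
  obtain ⟨C2, hC2, hfar⟩ := h.DB_far (δ := δ / 2) (by linarith) (by linarith)
  obtain ⟨C3, hC3, hmid⟩ := DB_of_contDiffOn (G := F) isOpen_univ h.smooth.contDiffOn
    (u := c + δ / 2) (v := c + 1 - δ / 2) (by linarith) (subset_univ _) (by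
      intro t ht
      refine lt_of_le_of_ne (h.deriv_nonneg t) (fun h0 => ?_)
      obtain ⟨m, hm⟩ := (h.crit t).1 h0.symm
      have h1 : (0 : ℝ) < m := by linarith [ht.1]
      have h2 : (m : ℝ) < 1 := by linarith [ht.2]
      have h3 : (0 : ℤ) < m := by exact_mod_cast h1
      have h4 : m < (1 : ℤ) := by exact_mod_cast h2
      omega)
  have hd := h.one_lt
  obtain ⟨C, hCdef⟩ : ∃ C, C = 1 + C1 + C3 + Real.log C2 / (δ / 2) ^ 2 + Real.log (4 * d ^ 2) +
    Real.log C2 := ⟨_, rfl⟩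
  have l2 : 0 ≤ Real.log C2 := Real.log_nonneg hC2
  have l3 : 0 ≤ Real.log C2 / (δ / 2) ^ 2 := by positivity
  have l4 : 0 ≤ Real.log (4 * d ^ 2) := Real.log_nonneg (by nlinarith)
  -- points are moved to the fundamental domain `[c - δ/2, c + 1 - δ/2)`
  have shift : ∀ x : ℝ, ∃ m : ℤ, c - δ / 2 ≤ x + m ∧ x + m < c - δ / 2 + 1 := by
    intro x
    refine ⟨-⌊x - (c - δ / 2)⌋, ?_⟩
    push_cast
    have := Int.floor_le (x - (c - δ / 2))
    have := Int.lt_floor_add_one (x - (c - δ / 2))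
    constructor <;> linarith
  have e2 : Real.exp (Real.log C2) = C2 := Real.exp_log (by linarith)
  have key : ∀ x y, x ≤ y → DB F x y (Real.exp C) ∧
      ((∀ m : ℤ, c + m ∉ Ioo x y) → DB F x y (Real.exp (C * (y - x) ^ 2))) := by
    intro x y hxy
    rcases le_or_gt (δ / 2) (y - x) with hgap | hgap
    · have h0 := hfar x y hgap
      refine ⟨h0.mono ?_, fun _ => h0.mono ?_⟩
      · rw [← e2, hCdef]; apply Real.exp_le_exp.2; linarith
      · rw [← e2]; apply Real.exp_le_exp.2
        have h1 : (δ / 2) ^ 2 ≤ (y - x) ^ 2 := by gcongr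
        calc Real.log C2 = Real.log C2 / (δ / 2) ^ 2 * (δ / 2) ^ 2 := by field_simp
          _ ≤ C * (y - x) ^ 2 :=
            mul_le_mul (by linarith) h1 (by positivity) (by linarith)
    · obtain ⟨m, hm1, hm2⟩ := shift x
      have hsq : (y - x) ^ 2 ≤ 1 := by nlinarith
      have hsq0 := sq_nonneg (y - x)
      have dsh : (y + m - (x + m)) = y - x := by ring
      rcases le_or_gt (x + m) (c + δ / 2) with hx | hx
      · have h0 := hnear (x + m) ⟨by linarith, by linarith⟩ (y + m) ⟨by linarith, by linarith⟩
          (by linarith)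
        rw [dsh] at h0
        refine ⟨h.DB_per m (h0.1.mono ?_), fun hc => h.DB_per m ((h0.2 ?_).mono ?_)⟩
        · rw [← Real.exp_log (show 0 < 4 * d ^ 2 by positivity), ← Real.exp_add]
          apply Real.exp_le_exp.2
          have : C1 * (y - x) ^ 2 ≤ C1 * 1 := by gcongr
          linarith
        · intro hcc
          apply hc (-m)
          push_cast
          exact ⟨by linarith [hcc.1], by linarith [hcc.2]⟩
        · apply Real.exp_le_exp.2; gcongr; linarith
      · rcases le_or_gt (y + m) (c + 1 - δ / 2) with hy | hy
        · have h0 := hmid (x + m) ⟨by linarith, by linarith⟩ (y + m) ⟨by linarith, by linarith⟩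
            (by linarith)
          rw [dsh] at h0
          refine ⟨h.DB_per m (h0.mono ?_), fun hc => h.DB_per m (h0.mono ?_)⟩
          · apply Real.exp_le_exp.2
            have : C3 * (y - x) ^ 2 ≤ C3 * 1 := by gcongr
            linarith
          · apply Real.exp_le_exp.2; gcongr; linarith
        · have h0 := hnear (x + (m - 1 : ℤ)) ⟨by push_cast; linarith, by push_cast; linarith⟩
            (y + (m - 1 : ℤ)) ⟨by push_cast; linarith, by push_cast; linarith⟩
            (by linarith)
          have dsh' : (y + (m - 1 : ℤ) - (x + (m - 1 : ℤ))) = y - x := by ring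
          rw [dsh'] at h0
          refine ⟨h.DB_per _ (h0.1.mono ?_), fun hc => h.DB_per _ ((h0.2 ?_).mono ?_)⟩
          · rw [← Real.exp_log (show 0 < 4 * d ^ 2 by positivity), ← Real.exp_add]
            apply Real.exp_le_exp.2
            have : C1 * (y - x) ^ 2 ≤ C1 * 1 := by gcongr
            linarith
          · intro hcc
            push_cast at hcc
            apply hc (-m + 1)
            push_cast
            exact ⟨by linarith [hcc.1], by linarith [hcc.2]⟩
          · apply Real.exp_le_exp.2; gcongr; linarith
  exact ⟨C, by linarith, fun x y hxy => (key x y hxy).1, fun x y hxy => (key x y hxy).2⟩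

/-- The distortion of `F` is controlled by an increasing function commuting with `x ↦ x + 1`
up to a constant. -/
theorem DB_soft (h : UC F c d) : ∃ (C : ℝ) (ξ : ℝ → ℝ), 0 ≤ C ∧ Monotone ξ ∧
    (∀ x, ξ (x + 1) = ξ x + C) ∧ ∀ x y, x ≤ y → DB F x y (Real.exp (ξ y - ξ x)) := by
  obtain ⟨C, hC, h1, h2⟩ := h.DB_basic
  refine ⟨2 * C, fun t => C * (t + ⌊t - c⌋), by linarith, ?_, ?_, ?_⟩
  · intro x y hxy
    have : (⌊x - c⌋ : ℝ) ≤ ⌊y - c⌋ := by exact_mod_cast Int.floor_le_floor (by linarith)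
    have hC0 : 0 ≤ C := by linarith
    dsimp only
    gcongr
  · intro x
    have : ⌊x + 1 - c⌋ = ⌊x - c⌋ + 1 := by rw [← Int.floor_add_one]; congr 1; ring
    simp only [this]; push_cast; ring
  · intro x y hxy
    by_cases hcr : ∀ m : ℤ, c + m ∉ Ioo x y
    · refine (h2 x y hxy hcr).mono (Real.exp_le_exp.2 ?_)
      have hle : y - x ≤ 1 := by
        by_contra hcon
        apply hcr (⌊x - c⌋ + 1)
        push_cast
        have := Int.floor_le (x - c)
        have := Int.lt_floor_add_one (x - c)
        constructor <;> linarith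
      have h3 : (⌊x - c⌋ : ℝ) ≤ ⌊y - c⌋ := by exact_mod_cast Int.floor_le_floor (by linarith)
      have : (y - x) ^ 2 ≤ (y + ⌊y - c⌋) - (x + ⌊x - c⌋) := by nlinarith
      have := mul_le_mul_of_nonneg_left this (by linarith : 0 ≤ C)
      linarith
    · push Not at hcr
      obtain ⟨m, hm⟩ := hcr
      refine (h1 x y hxy).mono (Real.exp_le_exp.2 ?_)
      have a1 : ⌊x - c⌋ < m := Int.floor_lt.2 (by linarith [hm.1])
      have a2 : m ≤ ⌊y - c⌋ := Int.le_floor.2 (by linarith [hm.2])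
      have a3 : ((⌊x - c⌋ : ℝ)) + 1 ≤ ⌊y - c⌋ := by exact_mod_cast (by omega : ⌊x - c⌋ + 1 ≤ ⌊y - c⌋)
      nlinarith

/-- Power-law estimates at the critical point. -/
theorem power_bounds (h : UC F c d) : ∃ C, 1 ≤ C ∧ ∀ t, 0 < t → t ≤ 1 →
    t ^ d ≤ C * (F (c + t) - F c) ∧ F (c + t) - F c ≤ C * t ^ d ∧
    t ^ d ≤ C * (F c - F (c - t)) ∧ F c - F (c - t) ≤ C * t ^ d := by
  obtain ⟨δ, hδ, hδ4, φ, W, hW, hsub, hφ, hpos, hφc, hF⟩ := h.normal_form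
  have hd := h.one_lt
  have hdφ : ∀ y ∈ W, DifferentiableAt ℝ φ y := fun y hy =>
    (hφ.contDiffAt (hW.mem_nhds hy)).differentiableAt (by norm_num)
  have c1 : ContinuousOn (deriv φ) (Icc (c - δ) (c + δ)) :=
    (hφ.deriv_of_isOpen (m := 2) hW (by norm_num)).continuousOn.mono hsub
  obtain ⟨t0, ht0, hmin⟩ := isCompact_Icc.exists_isMinOn
    (nonempty_Icc.2 (by linarith : c - δ ≤ c + δ)) c1
  obtain ⟨t1, ht1, hmax⟩ := isCompact_Icc.exists_isMaxOn
    (nonempty_Icc.2 (by linarith : c - δ ≤ c + δ)) c1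
  set m := deriv φ t0
  set M := deriv φ t1
  have hm : 0 < m := hpos t0 ht0
  have hM : 0 < M := hpos t1 ht1
  have hcm : c ∈ Icc (c - δ) (c + δ) := ⟨by linarith, by linarith⟩
  have dwa : DifferentiableOn ℝ φ (interior (Icc (c - δ) (c + δ))) := fun t ht =>
    (hdφ t (hsub (interior_subset ht))).differentiableWithinAt
  have low := fun x hx y hy hxy => (convex_Icc (c - δ) (c + δ)).mul_sub_le_image_sub_of_le_deriv
    (hφ.continuousOn.mono hsub) dwa (C := m) (fun t ht => hmin (interior_subset ht)) x hx y hy hxy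
  have up := fun x hx y hy hxy => (convex_Icc (c - δ) (c + δ)).image_sub_le_mul_sub_of_deriv_le
    (hφ.continuousOn.mono hsub) dwa (C := M) (fun t ht => hmax (interior_subset ht)) x hx y hy hxy
  have md : 0 < m ^ d := Real.rpow_pos_of_pos hm d
  have Md : 0 < M ^ d := Real.rpow_pos_of_pos hM d
  have dd : 0 < δ ^ d := Real.rpow_pos_of_pos hδ d
  have near : ∀ t, 0 < t → t ≤ δ →
      m ^ d * t ^ d ≤ F (c + t) - F c ∧ F (c + t) - F c ≤ M ^ d * t ^ d ∧
      m ^ d * t ^ d ≤ F c - F (c - t) ∧ F c - F (c - t) ≤ M ^ d * t ^ d := by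
    intro t ht htδ
    have m1 : c + t ∈ Icc (c - δ) (c + δ) := ⟨by linarith, by linarith⟩
    have m2 : c - t ∈ Icc (c - δ) (c + δ) := ⟨by linarith, by linarith⟩
    have a1 := low c hcm (c + t) m1 (by linarith)
    have a2 := up c hcm (c + t) m1 (by linarith)
    have a3 := low (c - t) m2 c hcm (by linarith)
    have a4 := up (c - t) m2 c hcm (by linarith)
    rw [hφc] at a1 a2 a3 a4
    simp only [add_sub_cancel_left, sub_zero, sub_sub_cancel, zero_sub] at a1 a2 a3 a4
    have p1 : 0 < m * t := by positivity
    have q1 : F (c + t) - F c = (φ (c + t)) ^ d := by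
      rw [hF _ (hsub m1), Pw_of_nonneg hd (by linarith)]; ring
    have q2 : F c - F (c - t) = (-φ (c - t)) ^ d := by
      rw [hF _ (hsub m2), ← Pw_of_nonneg hd (by linarith), Pw_neg]; ring
    rw [q1, q2, ← Real.mul_rpow hm.le ht.le, ← Real.mul_rpow hM.le ht.le]
    have hd0 : 0 ≤ d := by linarith
    exact ⟨Real.rpow_le_rpow p1.le a1 hd0, Real.rpow_le_rpow (by linarith) a2 hd0,
      Real.rpow_le_rpow p1.le a3 hd0, Real.rpow_le_rpow (by linarith) a4 hd0⟩
  refine ⟨1 + 1 / m ^ d + M ^ d + 1 / δ ^ d + 1 / (m ^ d * δ ^ d), ?_, fun t ht ht1 => ?_⟩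
  · have : 0 < 1 / m ^ d := by positivity
    have : 0 < 1 / δ ^ d := by positivity
    have : 0 < 1 / (m ^ d * δ ^ d) := by positivity
    linarith
  set K := 1 + 1 / m ^ d + M ^ d + 1 / δ ^ d + 1 / (m ^ d * δ ^ d) with hK
  have i1 : 0 < 1 / m ^ d := by positivity
  have i2 : 0 < 1 / δ ^ d := by positivity
  have i3 : 0 < 1 / (m ^ d * δ ^ d) := by positivity
  have td : 0 < t ^ d := Real.rpow_pos_of_pos ht d
  have td1 : t ^ d ≤ 1 := Real.rpow_le_one ht.le ht1 (by linarith)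
  have lowgen : ∀ u, m ^ d * t ^ d ≤ u → t ^ d ≤ K * u := by
    intro u hu
    calc t ^ d = 1 / m ^ d * (m ^ d * t ^ d) := by field_simp
      _ ≤ 1 / m ^ d * u := by gcongr
      _ ≤ K * u := by
        have : 0 ≤ u := le_trans (by positivity) hu
        gcongr; linarith
  have upgen : ∀ u, u ≤ M ^ d * t ^ d → u ≤ K * t ^ d := by
    intro u hu
    refine hu.trans ?_
    gcongr; linarith
  rcases le_or_gt t δ with htδ | htδ
  · obtain ⟨b1, b2, b3, b4⟩ := near t ht htδ
    exact ⟨lowgen _ b1, upgen _ b2, lowgen _ b3, upgen _ b4⟩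
  · obtain ⟨b1, b2, b3, b4⟩ := near δ hδ le_rfl
    have lowgen2 : ∀ u, m ^ d * δ ^ d ≤ u → t ^ d ≤ K * u := by
      intro u hu
      calc t ^ d ≤ 1 := td1
        _ = 1 / (m ^ d * δ ^ d) * (m ^ d * δ ^ d) := by field_simp
        _ ≤ 1 / (m ^ d * δ ^ d) * u := by gcongr
        _ ≤ K * u := by
          have : 0 ≤ u := le_trans (by positivity) hu
          gcongr; linarith
    have upgen2 : ∀ u, u ≤ 1 → u ≤ K * t ^ d := by
      intro u hu
      have : δ ^ d ≤ t ^ d := Real.rpow_le_rpow hδ.le htδ.le (by linarith)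
      calc u ≤ 1 := hu
        _ = 1 / δ ^ d * δ ^ d := by field_simp
        _ ≤ K * t ^ d := by gcongr; linarith
    have n1 : F (c + δ) ≤ F (c + t) := h.mono.monotone (by linarith)
    have n2 : F (c - t) ≤ F (c - δ) := h.mono.monotone (by linarith)
    exact ⟨lowgen2 _ (by linarith), upgen2 _ (h.sub_le_one (by linarith)),
      lowgen2 _ (by linarith), upgen2 _ (h.sub_le_one (by linarith))⟩

end UC

/-- The cross-ratio of four points. -/
def Cr (a b c d : ℝ) : ℝ := (c - b) * (d - a) / ((c - a) * (d - b))

section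
variable {a b c d : ℝ}

theorem Cr_pos (h1 : a < b) (h2 : b < c) (h3 : c < d) : 0 < Cr a b c d := by
  unfold Cr
  have : 0 < c - b := by linarith
  have : 0 < d - a := by linarith
  have : 0 < c - a := by linarith
  have : 0 < d - b := by linarith
  positivity

theorem one_sub_Cr (h1 : a < b) (h2 : b < c) (h3 : c < d) :
    1 - Cr a b c d = (b - a) * (d - c) / ((c - a) * (d - b)) := by
  unfold Cr
  have : 0 < c - a := by linarith
  have : 0 < d - b := by linarith
  field_simp
  ring

theorem neg_log_Cr (h1 : a < b) (h2 : b < c) (h3 : c < d) :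
    - Real.log (Cr a b c d) =
      Real.log (c - a) + Real.log (d - b) - Real.log (c - b) - Real.log (d - a) := by
  unfold Cr
  have n1 : c - a ≠ 0 := by intro h; linarith
  have n2 : d - b ≠ 0 := by intro h; linarith
  have n3 : c - b ≠ 0 := by intro h; linarith
  have n4 : d - a ≠ 0 := by intro h; linarith
  rw [Real.log_div (mul_ne_zero n3 n4) (mul_ne_zero n1 n2), Real.log_mul n3 n4, Real.log_mul n1 n2]
  ring

/-- Distortion of the cross-ratio from a pointwise bound. -/
theorem neg_log_Cr_le {G : ℝ → ℝ} (hG : Differentiable ℝ G) (hm : StrictMono G) {B κ : ℝ}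
    (h1 : a < b) (h2 : b < c) (h3 : c < d)
    (hD : ∀ x ∈ Icc a b, ∀ y ∈ Icc c d,
      deriv G x * deriv G y / (G y - G x) ^ 2 ≤ B / (y - x) ^ 2 + κ) :
    - Real.log (Cr (G a) (G b) (G c) (G d)) ≤
      B * (- Real.log (Cr a b c d)) + κ * ((b - a) * (d - c)) := by
  have step : ∀ x ∈ Icc a b, deriv G x / (G c - G x) - deriv G x / (G d - G x) ≤
      B / (c - x) - B / (d - x) + κ * (d - c) := by
    intro x hx
    have hder : ∀ y ∈ Icc c d, HasDerivAt
        (fun y => - (deriv G x * (G y - G x)⁻¹) + B * (y - x)⁻¹ - κ * y)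
        (- (deriv G x * (- deriv G y / (G y - G x) ^ 2)) + B * (- 1 / (y - x) ^ 2) - κ * 1) y := by
      intro y hy
      have n1 : G y - G x ≠ 0 := sub_ne_zero.2 (hm (by linarith [hx.2, hy.1])).ne'
      have n2 : y - x ≠ 0 := by intro h; linarith [hx.2, hy.1]
      exact ((((hG y).hasDerivAt.sub_const (G x)).inv n1).const_mul (deriv G x)).neg.add
        ((((hasDerivAt_id y).sub_const x).inv n2).const_mul B) |>.sub
        ((hasDerivAt_id y).const_mul κ)
    have hanti : AntitoneOn (fun y => - (deriv G x * (G y - G x)⁻¹) + B * (y - x)⁻¹ - κ * y)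
        (Icc c d) := by
      apply antitoneOn_of_deriv_nonpos (convex_Icc _ _)
      · exact fun y hy => (hder y hy).continuousAt.continuousWithinAt
      · exact fun y hy => (hder y (interior_subset hy)).differentiableAt.differentiableWithinAt
      · intro y hy
        rw [(hder y (interior_subset hy)).deriv]
        have := hD x hx y (interior_subset hy)
        calc _ = deriv G x * deriv G y / (G y - G x) ^ 2 - (B / (y - x) ^ 2 + κ) := by ring
          _ ≤ 0 := by linarith
    have := hanti (left_mem_Icc.2 h3.le) (right_mem_Icc.2 h3.le) h3.le
    simp only [← div_eq_mul_inv] at this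
    linarith
  have hder : ∀ x ∈ Icc a b, HasDerivAt
      (fun x => Real.log (G d - G x) - Real.log (G c - G x) -
        (B * (Real.log (d - x) - Real.log (c - x)) + κ * (d - c) * x))
      ((0 - deriv G x) / (G d - G x) - (0 - deriv G x) / (G c - G x) -
        (B * ((0 - 1) / (d - x) - (0 - 1) / (c - x)) + κ * (d - c) * 1)) x := by
    intro x hx
    have n1 : G d - G x ≠ 0 := sub_ne_zero.2 (hm (by linarith [hx.2])).ne'
    have n2 : G c - G x ≠ 0 := sub_ne_zero.2 (hm (by linarith [hx.2])).ne'
    have n3 : d - x ≠ 0 := by intro h; linarith [hx.2]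
    have n4 : c - x ≠ 0 := by intro h; linarith [hx.2]
    have hgx := (hG x).hasDerivAt
    exact ((((hasDerivAt_const x (G d)).sub hgx).log n1).sub
      (((hasDerivAt_const x (G c)).sub hgx).log n2)).sub
      ((((((hasDerivAt_const x d).sub (hasDerivAt_id x)).log n3).sub
      (((hasDerivAt_const x c).sub (hasDerivAt_id x)).log n4)).const_mul B).add
      ((hasDerivAt_id x).const_mul (κ * (d - c))))
  have hanti : AntitoneOn (fun x => Real.log (G d - G x) - Real.log (G c - G x) -
        (B * (Real.log (d - x) - Real.log (c - x)) + κ * (d - c) * x)) (Icc a b) := by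
    apply antitoneOn_of_deriv_nonpos (convex_Icc _ _)
    · exact fun y hy => (hder y hy).continuousAt.continuousWithinAt
    · exact fun y hy => (hder y (interior_subset hy)).differentiableAt.differentiableWithinAt
    · intro x hx
      rw [(hder x (interior_subset hx)).deriv]
      have := step x (interior_subset hx)
      calc _ = deriv G x / (G c - G x) - deriv G x / (G d - G x) -
            (B / (c - x) - B / (d - x) + κ * (d - c)) := by ring
        _ ≤ 0 := by linarith
  have := hanti (left_mem_Icc.2 h1.le) (right_mem_Icc.2 h1.le) h1.le
  rw [neg_log_Cr h1 h2 h3, neg_log_Cr (hm h1) (hm h2) (hm h3)]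
  simp only at this
  linarith

/-- The form in which distortion of cross-ratios is used for a rough bound. -/
theorem neg_log_Cr_le_of_DB {G : ℝ → ℝ} (hG : Differentiable ℝ G) (hm : StrictMono G) {B : ℝ}
    (h1 : a < b) (h2 : b < c) (h3 : c < d)
    (hD : ∀ x ∈ Icc a b, ∀ y ∈ Icc c d, DB G x y B) :
    - Real.log (Cr (G a) (G b) (G c) (G d)) ≤ B * (- Real.log (Cr a b c d)) := by
  have := neg_log_Cr_le hG hm (B := B) (κ := 0) h1 h2 h3 (by
    intro x hx y hy
    have hxy : x < y := by linarith [hx.2, hy.1]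
    have n1 : 0 < G y - G x := sub_pos.2 (hm hxy)
    have n2 : 0 < y - x := by linarith
    have := hD x hx y hy
    unfold DB at this
    rw [add_zero, div_le_div_iff₀ (by positivity) (by positivity)]
    exact this)
  linarith

theorem Cr_le_rpow_of_DB {G : ℝ → ℝ} (hG : Differentiable ℝ G) (hm : StrictMono G) {B : ℝ}
    (hB : 0 < B) (h1 : a < b) (h2 : b < c) (h3 : c < d)
    (hD : ∀ x ∈ Icc a b, ∀ y ∈ Icc c d, DB G x y B) :
    Cr a b c d ≤ (Cr (G a) (G b) (G c) (G d)) ^ (1 / B) := by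
  have h := neg_log_Cr_le_of_DB hG hm h1 h2 h3 hD
  have p1 := Cr_pos h1 h2 h3
  have p2 := Cr_pos (hm h1) (hm h2) (hm h3)
  rw [← Real.log_le_log_iff p1 (Real.rpow_pos_of_pos p2 _), Real.log_rpow p2, one_div_mul_eq_div,
    le_div_iff₀ hB]
  linarith

/-- Form of the distortion bound used when the middle interval is relatively large. -/
theorem one_sub_Cr_le_of_DB {G : ℝ → ℝ} (hG : Differentiable ℝ G) (hm : StrictMono G) {B : ℝ}
    (hB : 0 ≤ B) (h1 : a < b) (h2 : b < c) (h3 : c < d)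
    (hD : ∀ x ∈ Icc a b, ∀ y ∈ Icc c d, DB G x y B) :
    (G b - G a) * (G d - G c) / ((G c - G a) * (G d - G b)) ≤
      B * ((b - a) * (d - c) / ((c - b) * (d - a))) := by
  have h := neg_log_Cr_le_of_DB hG hm h1 h2 h3 hD
  have p1 := Cr_pos h1 h2 h3
  have p2 := Cr_pos (hm h1) (hm h2) (hm h3)
  rw [← one_sub_Cr (hm h1) (hm h2) (hm h3)]
  have e1 := Real.log_le_sub_one_of_pos p2
  have e2 := Real.log_le_sub_one_of_pos (inv_pos.2 p1)
  rw [Real.log_inv] at e2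
  have e3 : (Cr a b c d)⁻¹ - 1 = (b - a) * (d - c) / ((c - b) * (d - a)) := by
    unfold Cr
    have : 0 < c - b := by linarith
    have : 0 < d - a := by linarith
    have : 0 < c - a := by linarith
    have : 0 < d - b := by linarith
    field_simp
    ring
  rw [← e3]
  have := mul_le_mul_of_nonneg_left e2 hB
  linarith

/-- Unicritical lifts semiconjugate to the irrational translation by `ρ`. -/
structure CM (F : ℝ → ℝ) (c d ρ : ℝ) : Prop extends UC F c d where
  irr : Irrational ρ
  semi : ∃ Φ : ℝ → ℝ, Monotone Φ ∧ (∀ x, Φ (x + 1) = Φ x + 1) ∧ ∀ x, Φ (F x) = Φ x + ρ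

/-- The order isomorphism underlying a strictly increasing surjection. -/
def UC.eqv {F : ℝ → ℝ} {c d : ℝ} (h : UC F c d) : ℝ ≃o ℝ :=
  h.mono.orderIsoOfSurjective F h.surjective

/-- The action of `ℤ²` generated by `F` and the unit translation. -/
def UC.T {F : ℝ → ℝ} {c d : ℝ} (h : UC F c d) (k m : ℤ) (x : ℝ) : ℝ := (h.eqv ^ k) x + m

namespace UC
variable {F : ℝ → ℝ} {c d : ℝ} (h : UC F c d)
include h

theorem eqv_zpow_add_int (k m : ℤ) (x : ℝ) : (h.eqv ^ k) (x + m) = (h.eqv ^ k) x + m := by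
  have h1 : ∀ x : ℝ, h.eqv (x + m) = h.eqv x + m := fun x => h.per_int x m
  have h2 : ∀ x : ℝ, h.eqv⁻¹ (x + m) = h.eqv⁻¹ x + m := by
    intro x
    apply h.eqv.injective
    rw [h1]
    change h.eqv (h.eqv.symm _) = h.eqv (h.eqv.symm _) + m
    simp
  induction k using Int.induction_on generalizing x with
  | zero => simp
  | succ n ih => rw [zpow_add_one]; change (h.eqv ^ (n : ℤ)) (h.eqv (x + m)) = _; rw [h1, ih]; rfl
  | pred n ih =>
    rw [zpow_sub_one]; change (h.eqv ^ (-n : ℤ)) (h.eqv⁻¹ (x + m)) = _; rw [h2, ih]; rfl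

theorem T_comp (k m l n : ℤ) (x : ℝ) : h.T k m (h.T l n x) = h.T (k + l) (m + n) x := by
  unfold T
  rw [eqv_zpow_add_int, zpow_add]
  change (h.eqv ^ k) ((h.eqv ^ l) x) + n + m = (h.eqv ^ k) ((h.eqv ^ l) x) + _
  push_cast; ring

theorem T_zero (x : ℝ) : h.T 0 0 x = x := by simp [T]

theorem T_strictMono (k m : ℤ) : StrictMono (h.T k m) := fun x y hxy => by
  unfold T; have := (h.eqv ^ k).strictMono hxy; linarith

theorem T_continuous (k m : ℤ) : Continuous (h.T k m) := by
  unfold T; exact (h.eqv ^ k).continuous.add continuous_const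

theorem T_add_int (k m n : ℤ) (x : ℝ) : h.T k m (x + n) = h.T k m x + n := by
  unfold T; rw [eqv_zpow_add_int]; ring

theorem T_int_add (k m n : ℤ) (x : ℝ) : h.T k m x + n = h.T k (m + n) x := by
  unfold T; push_cast; ring

theorem T_nat (k : ℕ) (m : ℤ) (x : ℝ) : h.T k m x = F^[k] x + m := by
  unfold T
  congr 1
  induction k generalizing x with
  | zero => simp
  | succ n ih =>
    push_cast; rw [zpow_add_one, Function.iterate_succ_apply]; exact ih _

theorem iterate_T (k : ℕ) (l n : ℤ) (x : ℝ) : F^[k] (h.T l n x) = h.T (k + l) n x := by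
  have := h.T_nat k 0 (h.T l n x)
  rw [T_comp] at this
  simpa using this.symm

theorem iterate_strictMono (k : ℕ) : StrictMono F^[k] := h.mono.iterate k

theorem iterate_differentiable (k : ℕ) : Differentiable ℝ F^[k] := h.differentiable.iterate k

theorem iterate_add_int (k : ℕ) (x : ℝ) (m : ℤ) : F^[k] (x + m) = F^[k] x + m := by
  have := h.T_add_int k 0 m x
  rw [T_nat, T_nat] at this
  simpa using this

end UC

theorem add_int_of_add_one {ξ : ℝ → ℝ} {κ : ℝ} (hper : ∀ x, ξ (x + 1) = ξ x + κ) (x : ℝ) (m : ℤ) :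
    ξ (x + m) = ξ x + m * κ := by
  have hn : ∀ (n : ℕ) (x : ℝ), ξ (x + n) = ξ x + n * κ := by
    intro n
    induction n with
    | zero => simp
    | succ n ih => intro x; push_cast; rw [← add_assoc, hper, ih]; ring
  rcases Int.eq_nat_or_neg m with ⟨n, rfl | rfl⟩
  · exact_mod_cast hn n x
  · have := hn n (x + ((-n : ℤ) : ℝ))
    push_cast at *
    rw [show x + -(n : ℝ) + n = x by ring] at this
    linarith

namespace CM
variable {F : ℝ → ℝ} {c d ρ : ℝ} (h : CM F c d ρ)
include h

theorem apply_T {Φ : ℝ → ℝ} (h2 : ∀ x, Φ (x + 1) = Φ x + 1) (h3 : ∀ x, Φ (F x) = Φ x + ρ)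
    (k m : ℤ) (y : ℝ) : Φ (h.T k m y) = Φ y + (k * ρ + m) := by
  have hk : ∀ (k : ℕ) (y : ℝ), Φ (F^[k] y) = Φ y + k * ρ := by
    intro k
    induction k with
    | zero => simp
    | succ n ih => intro y; rw [Function.iterate_succ_apply, ih, h3]; push_cast; ring
  rcases Int.eq_nat_or_neg k with ⟨n, rfl | rfl⟩
  · rw [h.T_nat, add_int_of_add_one h2, hk]; push_cast; ring
  · have e : F^[n] (h.T (-n) m y) = y + m := by
      rw [h.iterate_T]; simp [UC.T]
    have := hk n (h.T (-n) m y)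
    rw [e, add_int_of_add_one h2] at this
    push_cast
    linarith

theorem reflect : CM (fun x => -F (-x)) (-c) d (-ρ) := by
  refine ⟨h.toUC.reflect, h.irr.neg, ?_⟩
  obtain ⟨Φ, h1, h2, h3⟩ := h.semi
  refine ⟨fun x => -Φ (-x), fun x y hxy => neg_le_neg (h1 (neg_le_neg hxy)), fun x => ?_,
    fun x => ?_⟩
  · have := h2 (-(x + 1))
    rw [show -(x + 1) + 1 = -x by ring] at this
    linarith
  · simp only [neg_neg, h3]; ring

theorem T_lt {k m l n : ℤ} (hkl : k * ρ + m < l * ρ + n) (x : ℝ) : h.T k m x < h.T l n x := by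
  obtain ⟨Φ, h1, h2, h3⟩ := h.semi
  by_contra hcon
  have := h1 (not_lt.1 hcon)
  rw [h.apply_T h2 h3, h.apply_T h2 h3] at this
  linarith

end CM

/-- Consecutive closest return times. -/
structure RState (ρ : ℝ) (qA : ℕ) (pA : ℤ) (qB : ℕ) (pB : ℤ) : Prop where
  one_le : 1 ≤ qA
  le : qA ≤ qB
  det : (qA : ℤ) * pB - qB * pA = 1
  pos : 0 < pB - qB * ρ
  lt : pB - qB * ρ < qA * ρ - pA

section
variable {F : ℝ → ℝ} {c d ρ : ℝ} {qA qB : ℕ} {pA pB : ℤ}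

theorem CM.B_lt (h : CM F c d ρ) (s : RState ρ qA pA qB pB) (x : ℝ) : h.T qB (-pB) x < x := by
  conv_rhs => rw [← h.T_zero x]
  apply h.T_lt
  push_cast; linarith [s.pos, s.lt]

theorem CM.sum_le (h : CM F c d ρ) (s : RState ρ qA pA qB pB) {ξ : ℝ → ℝ} {κ : ℝ}
    (hξ : Monotone ξ) (hper : ∀ x, ξ (x + 1) = ξ x + κ) (x : ℝ) :
    ∑ i ∈ Finset.range qB, (ξ (F^[i] (h.T qA (-pA) x)) - ξ (F^[i] x)) ≤ κ := by
  have hInt := add_int_of_add_one hper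
  set S : ℕ → ℝ → ℝ := fun n x => ∑ i ∈ Finset.range n, ξ (F^[i] x) with hS
  have S_int : ∀ (n : ℕ) (x : ℝ) (m : ℤ), S n (x + m) = S n x + n * (m * κ) := by
    intro n x m
    simp only [hS, h.iterate_add_int, hInt, Finset.sum_add_distrib, Finset.sum_const,
      Finset.card_range, nsmul_eq_mul]
  have S_add : ∀ (n k : ℕ) (x : ℝ), S (n + k) x = S n x + S k (F^[n] x) := by
    intro n k x
    simp only [hS, Finset.sum_range_add, ← Function.iterate_add_apply]
    congr 1
    apply Finset.sum_congr rfl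
    intro i _
    rw [add_comm]
  have e1 : S qB (h.T qA (-pA) x) = S (qA + qB) x - S qA x - qB * (pA * κ) := by
    rw [h.T_nat, S_int, S_add]; push_cast; ring
  have e2 : S qA (h.T qB (-pB) x) = S (qA + qB) x - S qB x - qA * (pB * κ) := by
    rw [h.T_nat, S_int, add_comm qA qB, S_add]; push_cast; ring
  have e3 : S qA (h.T qB (-pB) x) ≤ S qA x := by
    apply Finset.sum_le_sum
    intro i _
    exact hξ ((h.iterate_strictMono i).monotone (h.B_lt s x).le)
  rw [Finset.sum_sub_distrib]
  change S qB (h.T qA (-pA) x) - S qB x ≤ κ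
  have hdet : ((qA : ℝ) * pB - qB * pA) * κ = κ := by
    have : ((qA : ℝ) * pB - qB * pA) = 1 := by exact_mod_cast s.det
    rw [this, one_mul]
  linarith

theorem UC.DB_iterate (h : UC F c d) {ξ : ℝ → ℝ}
    (hξ : ∀ x y, x ≤ y → DB F x y (Real.exp (ξ y - ξ x))) (k : ℕ) {u v : ℝ} (huv : u ≤ v) :
    DB F^[k] u v (Real.exp (∑ i ∈ Finset.range k, (ξ (F^[i] v) - ξ (F^[i] u)))) := by
  induction k with
  | zero => simp [DB]
  | succ n ih =>
    rw [Function.iterate_succ', Finset.sum_range_succ, Real.exp_add, mul_comm]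
    exact DB.comp (h.iterate_differentiable n u) (h.iterate_differentiable n v)
      (h.differentiable _) (h.differentiable _) (h.deriv_nonneg _) (h.deriv_nonneg _)
      (Real.exp_pos _).le ih (hξ _ _ ((h.iterate_strictMono n).monotone huv))

/-- Bounded distortion (in the `DB` sense) of high iterates on dynamically small intervals. -/
theorem CM.DB_long (h : CM F c d ρ) : ∃ C : ℝ, 0 ≤ C ∧ ∀ {qA qB : ℕ} {pA pB : ℤ},
    RState ρ qA pA qB pB → ∀ (N M k : ℕ), k ≤ M * qB → ∀ (x u v : ℝ), x ≤ u → u ≤ v →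
    v ≤ h.T (N * qA) (-(N * pA)) x → DB F^[k] u v (Real.exp (C * N * M)) := by
  obtain ⟨C, ξ, hC, hmono, hper, hDB⟩ := h.DB_soft
  refine ⟨C, hC, fun {qA qB pA pB} s N M k hk x u v hxu huv hvN => ?_⟩
  refine (h.DB_iterate hDB k huv).mono (Real.exp_le_exp.2 ?_)
  have b1 : ∀ (M : ℕ) (x : ℝ), ∑ i ∈ Finset.range (M * qB),
      (ξ (F^[i] (h.T qA (-pA) x)) - ξ (F^[i] x)) ≤ C * M := by
    intro M
    induction M with
    | zero => simp
    | succ M ih =>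
      intro x
      rw [Nat.succ_mul, Finset.sum_range_add]
      have e : ∀ i, ξ (F^[M * qB + i] (h.T qA (-pA) x)) - ξ (F^[M * qB + i] x) =
          ξ (F^[i] (h.T qA (-pA) (F^[M * qB] x))) - ξ (F^[i] (F^[M * qB] x)) := by
        intro i
        rw [add_comm (M * qB) i, Function.iterate_add_apply, Function.iterate_add_apply]
        congr 3
        rw [h.T_nat, h.T_nat, h.iterate_add_int, ← Function.iterate_add_apply,
          ← Function.iterate_add_apply, add_comm (M * qB) qA]
      simp only [e]
      have := h.sum_le s hmono hper (F^[M * qB] x)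
      have := ih x
      push_cast
      linarith
  have b2 : ∀ (N : ℕ) (x : ℝ), ∑ i ∈ Finset.range (M * qB),
      (ξ (F^[i] (h.T (N * qA) (-(N * pA)) x)) - ξ (F^[i] x)) ≤ C * N * M := by
    intro N
    induction N with
    | zero => intro x; simp [h.T_zero]
    | succ N ih =>
      intro x
      have e : h.T ((N + 1 : ℕ) * qA) (-((N + 1 : ℕ) * pA)) x =
          h.T qA (-pA) (h.T (N * qA) (-(N * pA)) x) := by
        rw [h.T_comp]; congr 1 <;> push_cast <;> ring
      rw [e]
      have h1 := b1 M (h.T (N * qA) (-(N * pA)) x)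
      have h2 := ih x
      rw [Finset.sum_sub_distrib] at *
      push_cast
      linarith
  calc _ ≤ ∑ i ∈ Finset.range k, (ξ (F^[i] (h.T (N * qA) (-(N * pA)) x)) - ξ (F^[i] x)) := by
        apply Finset.sum_le_sum
        intro i _
        have := hmono ((h.iterate_strictMono i).monotone hvN)
        have := hmono ((h.iterate_strictMono i).monotone hxu)
        linarith
    _ ≤ ∑ i ∈ Finset.range (M * qB), (ξ (F^[i] (h.T (N * qA) (-(N * pA)) x)) - ξ (F^[i] x)) := by
        apply Finset.sum_le_sum_of_subset_of_nonneg
        · intro i hi; rw [Finset.mem_range] at *; omega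
        · intro i _ _
          have := hmono ((h.iterate_strictMono i).monotone (hxu.trans (huv.trans hvN)))
          linarith
    _ ≤ _ := b2 N x

/-- Every point lies in an interval of the dynamical partition. -/
theorem CM.covering (h : CM F c d ρ) (s : RState ρ qA pA qB pB) (z x : ℝ) (i₀ : ℤ) :
    ∃ i m : ℤ, i₀ ≤ i ∧ i < i₀ + qA + qB ∧ h.T i m z ≤ x ∧
      (i < i₀ + qB → x < h.T (i + qA) (m - pA) z) ∧
      (i₀ + qB ≤ i → x < h.T (i - qB) (m + pB) z) := by
  have hq : 1 ≤ qB := s.one_le.trans s.le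
  set w : ℤ → ℤ := fun i => ⌊x - h.T i 0 z⌋ with hw
  have w_le : ∀ i, h.T i (w i) z ≤ x := by
    intro i
    have := Int.floor_le (x - h.T i 0 z)
    have e := h.T_int_add i 0 (w i) z
    rw [zero_add] at e
    rw [← e]; simp only [hw]; linarith
  have w_max : ∀ i m, h.T i m z ≤ x → h.T i m z ≤ h.T i (w i) z := by
    intro i m hm
    have e := h.T_int_add i 0 m z
    have e' := h.T_int_add i 0 (w i) z
    rw [zero_add] at e e'
    have : m ≤ w i := Int.le_floor.2 (by rw [← e] at hm; linarith)
    have : (m : ℝ) ≤ w i := by exact_mod_cast this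
    rw [← e, ← e']; linarith
  obtain ⟨i, hi, hmax⟩ := Finset.exists_max_image (Finset.Ico i₀ (i₀ + qA + qB))
    (fun i => h.T i (w i) z) ⟨i₀, by rw [Finset.mem_Ico]; omega⟩
  rw [Finset.mem_Ico] at hi
  have key : ∀ j m, i₀ ≤ j → j < i₀ + qA + qB → h.T i (w i) z < h.T j m z → x < h.T j m z := by
    intro j m h1 h2 h3
    by_contra hcon
    have := w_max j m (not_lt.1 hcon)
    have := hmax j (by rw [Finset.mem_Ico]; omega)
    linarith
  refine ⟨i, w i, hi.1, hi.2, w_le i, fun hlt => ?_, fun hle => ?_⟩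
  · apply key _ _ (by omega) (by omega)
    apply h.T_lt
    push_cast; linarith [s.pos, s.lt]
  · apply key _ _ (by omega) (by omega)
    apply h.T_lt
    push_cast; linarith [s.pos, s.lt]

theorem Cr_add_right (a b c d m : ℝ) : Cr (a + m) (b + m) (c + m) (d + m) = Cr a b c d := by
  simp [Cr]

theorem gap_le_of_Cr_le_rpow {p₀ p₁ p₂ p₃ p₄ s C B : ℝ} (h0 : p₀ < p₁) (h1 : p₁ < p₂) (h2 : p₂ < p₃)
    (h3 : p₃ < p₄) (hB : 0 < B) (hs : 0 < s) (hC : 1 ≤ C)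
    (hCr : Cr p₀ p₁ p₂ p₃ ≤ (Cr p₁ p₂ p₃ p₄) ^ (1 / B)) (g1 : p₄ - p₁ ≤ 4 * C * s)
    (g2 : s ≤ p₃ - p₁) (g3 : s ≤ C * (p₄ - p₂)) :
    s ≤ 4 * C ^ 2 * 2 ^ B * (p₃ - p₂) := by
  have hB2 : (1 : ℝ) ≤ 2 ^ B := Real.one_le_rpow (by norm_num) hB.le
  have hK : 4 ≤ 4 * C ^ 2 * 2 ^ B := by nlinarith [one_le_pow₀ hC (n := 2)]
  by_cases hδ : p₃ - p₂ ≤ s / 2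
  swap
  · have : 0 < p₃ - p₂ := by linarith
    nlinarith
  have hhalf : 1 / 2 ≤ Cr p₀ p₁ p₂ p₃ := by
    unfold Cr
    rw [div_le_div_iff₀ (by norm_num) (mul_pos (by linarith) (by linarith))]
    have : (p₂ - p₀) * (p₃ - p₁) ≤ (p₃ - p₀) * (2 * (p₂ - p₁)) :=
      mul_le_mul (by linarith) (by linarith) (by linarith) (by linarith)
    linarith
  have hp := Cr_pos h1 h2 h3
  have h4 : (1 / 2 : ℝ) ^ B ≤ Cr p₁ p₂ p₃ p₄ := by
    have := Real.rpow_le_rpow (by norm_num) (hhalf.trans hCr) hB.le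
    rwa [← Real.rpow_mul hp.le, one_div_mul_cancel hB.ne', Real.rpow_one] at this
  have h5 : Cr p₁ p₂ p₃ p₄ * s ≤ 4 * C ^ 2 * (p₃ - p₂) := by
    unfold Cr
    rw [div_mul_eq_mul_div, div_le_iff₀ (mul_pos (by linarith) (by linarith))]
    have e1 : (p₄ - p₁) * s ≤ 4 * C * s * (C * (p₄ - p₂)) :=
      mul_le_mul g1 g3 hs.le (by positivity)
    have e2 : 4 * C * s * (C * (p₄ - p₂)) ≤ 4 * C * (p₃ - p₁) * (C * (p₄ - p₂)) := by
      have : 0 ≤ C * (p₄ - p₂) := by nlinarith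
      gcongr
    have := mul_le_mul_of_nonneg_left (e1.trans e2) (by linarith : 0 ≤ p₃ - p₂)
    linarith
  have h6 : (1 / 2 : ℝ) ^ B * 2 ^ B = 1 := by
    rw [← Real.mul_rpow (by norm_num) (by norm_num)]; norm_num
  calc s = (1 / 2 : ℝ) ^ B * s * 2 ^ B := by rw [mul_right_comm, h6, one_mul]
    _ ≤ (4 * C ^ 2 * (p₃ - p₂)) * 2 ^ B := by
      exact mul_le_mul_of_nonneg_right ((mul_le_mul_of_nonneg_right h4 hs.le).trans h5)
        (by positivity)
    _ = _ := by ring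

theorem gaps_comparable {u v w θ : ℝ} (hu : 0 < u) (hv : 0 < v) (hw : 0 < w) (hθ : θ < 1)
    (huvw : (1 - θ) * ((u + v) * (v + w)) ≤ u * w) :
    v ≤ 1 / (1 - θ) * w ∧ v ≤ 1 / (1 - θ) * u := by
  have hθ' : 0 < 1 - θ := by linarith
  have hvv := mul_pos hv hv
  have huv := mul_pos hu hv
  have hvw := mul_pos hv hw
  have huw := mul_pos hu hw
  constructor
  · rw [one_div_mul_eq_div, le_div_iff₀ hθ']
    have : (1 - θ) * (u * v) ≤ (1 - θ) * ((u + v) * (v + w)) := by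
      apply mul_le_mul_of_nonneg_left _ hθ'.le; nlinarith
    exact le_of_mul_le_mul_left (by linarith : u * (v * (1 - θ)) ≤ u * w) hu
  · rw [one_div_mul_eq_div, le_div_iff₀ hθ']
    have : (1 - θ) * (v * w) ≤ (1 - θ) * ((u + v) * (v + w)) := by
      apply mul_le_mul_of_nonneg_left _ hθ'.le; nlinarith
    exact le_of_mul_le_mul_right (by linarith : (v * (1 - θ)) * w ≤ u * w) hw

section
variable {F : ℝ → ℝ} {c d ρ : ℝ} {qA qB : ℕ} {pA pB : ℤ}

theorem CM.exists_argmin (h : CM F c d ρ) (k m : ℤ) : ∃ z, ∀ x, h.T k m z - z ≤ h.T k m x - x := by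
  obtain ⟨z, -, hz⟩ := (isCompact_Icc (a := (0 : ℝ)) (b := 1)).exists_isMinOn (nonempty_Icc.2 zero_le_one)
    ((h.T_continuous k m).sub continuous_id).continuousOn
  refine ⟨z, fun x => ?_⟩
  have := hz (⟨Int.fract_nonneg x, (Int.fract_lt_one x).le⟩ : Int.fract x ∈ Icc (0 : ℝ) 1)
  simp only [mem_ofPred_eq, id, Pi.sub_apply] at this
  have e := h.T_add_int k m ⌊x⌋ (Int.fract x)
  rw [Int.fract_add_floor] at e
  have e2 := Int.fract_add_floor x
  linarith

set_option maxHeartbeats 1000000 in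
/-- Consecutive images under a closest return are comparable. -/
theorem CM.real_bounds (h : CM F c d ρ) : ∃ C : ℝ, 1 ≤ C ∧ ∀ {qA qB : ℕ} {pA pB : ℤ},
    RState ρ qA pA qB pB → ∀ x,
      h.T (2 * qA) (-(2 * pA)) x - h.T qA (-pA) x ≤ C * (h.T qA (-pA) x - x) ∧
      h.T qA (-pA) x - x ≤ C * (h.T (2 * qA) (-(2 * pA)) x - h.T qA (-pA) x) := by
  obtain ⟨C₀, hC₀, hDB⟩ := h.DB_long
  set B := Real.exp (C₀ * 3 * 12) with hBdef
  have hB : 0 < B := Real.exp_pos _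
  set θ : ℝ := (3 / 4 : ℝ) ^ (1 / B) with hθ
  have hθ1 : θ < 1 := Real.rpow_lt_one (by norm_num) (by norm_num) (by positivity)
  have hθ0 : 0 < θ := Real.rpow_pos_of_pos (by norm_num) _
  set C₁ := 1 / (1 - θ) with hC₁
  have hC₁1 : 1 ≤ C₁ := by rw [hC₁, le_div_iff₀ (by linarith)]; linarith
  set C := C₁ ^ 2 with hC
  have hC1 : 1 ≤ C := one_le_pow₀ hC₁1
  set K := 4 * C ^ 2 * 2 ^ B with hK
  have hB2 : (1 : ℝ) ≤ 2 ^ B := Real.one_le_rpow (by norm_num) hB.le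
  have hK4 : 4 * C ≤ K := by
    have : 4 * C ^ 2 * 1 ≤ K := by rw [hK]; gcongr
    nlinarith
  refine ⟨K * K * C₁, by nlinarith [mul_pos (show 0 < K by linarith) (show 0 < K by linarith)],
    fun {qA qB pA pB} s x => ?_⟩
  have hqq : qA ≤ qB := s.le
  obtain ⟨z, hz⟩ := h.exists_argmin qA (-pA)
  -- orbit of a point under the return map
  set a : ℤ → ℤ → ℤ → ℝ := fun i m n => h.T (i + n * qA) (m - n * pA) z with ha
  have a_lt : ∀ i m n, a i m n < a i m (n + 1) := by
    intro i m n
    apply h.T_lt; push_cast; nlinarith [s.pos, s.lt]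
  have a_min : ∀ i m n, a 0 0 1 - a 0 0 0 ≤ a i m (n + 1) - a i m n := by
    intro i m n
    have := hz (a i m n)
    simp only [ha, h.T_comp] at this ⊢
    convert this using 2
    · congr 1 <;> ring
    · simp [h.T_zero]
    · congr 1 <;> ring
  have zCr : Cr (a 0 0 (-1)) (a 0 0 0) (a 0 0 1) (a 0 0 2) ≤ 3 / 4 := by
    have e1 := a_min 0 0 (-1)
    have e2 := a_min 0 0 1
    have e0 := a_lt 0 0 0
    norm_num at e1 e2 e0
    unfold Cr
    rw [div_le_div_iff₀ (mul_pos (by linarith) (by linarith)) (by norm_num)]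
    nlinarith [mul_nonneg (sub_nonneg.2 e1) (sub_nonneg.2 e2)]
  have good : ∀ i m n : ℤ, -(12 * qB : ℤ) ≤ i + n * qA → i + n * qA ≤ 0 →
      a i m (n + 1) - a i m n ≤ C₁ * (a i m (n + 2) - a i m (n + 1)) ∧
      a i m (n + 1) - a i m n ≤ C₁ * (a i m n - a i m (n - 1)) := by
    intro i m n h1 h2
    obtain ⟨k, hk⟩ := Int.eq_ofNat_of_zero_le (a := -(i + n * qA)) (by omega)
    have hG : ∀ j : ℤ, F^[k] (a i m (n + j)) = a 0 0 j + (m - n * pA : ℤ) := by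
      intro j
      simp only [ha]
      rw [h.iterate_T, h.T_int_add, ← hk]
      congr 1 <;> ring
    have l0 := a_lt i m (n - 1)
    have l1 := a_lt i m n
    have l2 := a_lt i m (n + 1)
    rw [sub_add_cancel] at l0
    rw [add_assoc, one_add_one_eq_two] at l2
    have hcr := Cr_le_rpow_of_DB (h.iterate_differentiable k) (h.iterate_strictMono k) hB l0 l1 l2 (by
      intro x hx y hy
      have := hDB s 3 12 k (by omega) (a i m (n - 1)) x y hx.1 (by linarith [hx.2, hy.1]) (by
        refine hy.2.trans (le_of_eq ?_)
        simp only [ha, h.T_comp]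
        congr 1 <;> push_cast <;> ring)
      simpa [hBdef] using this)
    have e0 := hG 0
    have e1 := hG 1
    have e2 := hG 2
    have em := hG (-1)
    rw [add_zero] at e0
    rw [← sub_eq_add_neg] at em
    rw [em, e0, e1, e2, Cr_add_right] at hcr
    have hle : Cr (a i m (n - 1)) (a i m n) (a i m (n + 1)) (a i m (n + 2)) ≤ θ :=
      hcr.trans (Real.rpow_le_rpow (Cr_pos (by simpa using a_lt 0 0 (-1)) (by simpa using a_lt 0 0 0)
        (by simpa using a_lt 0 0 1)).le zCr (by positivity))
    have hone := one_sub_Cr l0 l1 l2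
    set u := a i m n - a i m (n - 1) with hu
    set v := a i m (n + 1) - a i m n with hv
    set w := a i m (n + 2) - a i m (n + 1) with hw
    have huvw : (1 - θ) * ((u + v) * (v + w)) ≤ u * w := by
      have h1θ : 1 - θ ≤ u * w / ((u + v) * (v + w)) := by
        have : a i m (n + 1) - a i m (n - 1) = u + v := by ring
        rw [this, show a i m (n + 2) - a i m n = v + w by ring] at hone
        linarith
      rwa [le_div_iff₀ (mul_pos (by linarith) (by linarith))] at h1θ
    exact gaps_comparable (by linarith) (by linarith) (by linarith) hθ1 huvw
  obtain ⟨i, m, hi1, hi2, hx1, hx2, hx3⟩ := h.covering s z x (-(5 * qA + qB : ℤ))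
  have hx4 : x < a i m 1 := by
    by_cases hlt : i < -(5 * qA + qB : ℤ) + qB
    · simpa [ha] using hx2 hlt
    · refine (hx3 (by omega)).trans ?_
      simp only [ha]
      apply h.T_lt; push_cast; linarith [s.pos, s.lt]
  set y : ℤ → ℝ := fun n => h.T (n * qA) (-(n * pA)) x with hy
  have y_lb : ∀ n, a i m n ≤ y n := by
    intro n
    have := (h.T_strictMono (n * qA) (-(n * pA))).monotone hx1
    rw [h.T_comp] at this
    refine le_trans (le_of_eq ?_) this
    simp only [ha]
    congr 1 <;> ring
  have y_ub : ∀ n, y n ≤ a i m (n + 1) := by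
    intro n
    have := (h.T_strictMono (n * qA) (-(n * pA))).monotone hx4.le
    simp only [ha] at this
    rw [h.T_comp] at this
    refine this.trans (le_of_eq ?_)
    simp only [ha]
    congr 1 <;> ring
  have y_lt : ∀ n, y n < y (n + 1) := by
    intro n
    apply h.T_lt; push_cast; nlinarith [s.pos, s.lt]
  have bounds : ∀ n : ℤ, 0 ≤ n → n ≤ 1 →
      y (n + 1) - y n ≤ K * (a i m (n + 1) - a i m n) ∧
      a i m (n + 1) - a i m n ≤ K * (y (n + 1) - y n) := by
    intro n hn0 hn1
    have r : ∀ n : ℤ, -2 ≤ n → n ≤ 4 → -(12 * qB : ℤ) ≤ i + n * qA ∧ i + n * qA ≤ 0 := by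
      intro n h1 h2
      constructor <;> nlinarith
    have gm := good i m (n - 1) (r _ (by omega) (by omega)).1 (r _ (by omega) (by omega)).2
    have g0 := good i m n (r _ (by omega) (by omega)).1 (r _ (by omega) (by omega)).2
    have g1 := good i m (n + 1) (r _ (by omega) (by omega)).1 (r _ (by omega) (by omega)).2
    have g2 := good i m (n + 2) (r _ (by omega) (by omega)).1 (r _ (by omega) (by omega)).2
    have l0 := a_lt i m n
    rw [show n - 1 + 1 = n by ring, show n - 1 + 2 = n + 1 by ring] at gm
    rw [show n + 1 + 1 = n + 2 by ring, show n + 1 + 2 = n + 3 by ring,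
      show n + 1 - 1 = n by ring] at g1
    rw [show n + 2 + 1 = n + 3 by ring, show n + 2 - 1 = n + 1 by ring] at g2
    set S := a i m (n + 1) - a i m n with hS
    have hS0 : 0 < S := by linarith
    have hC₁C : C₁ ≤ C := by rw [hC]; nlinarith
    have t1 : a i m (n + 2) - a i m (n + 1) ≤ C * S :=
      g1.2.trans (by gcongr)
    have t2 : a i m (n + 3) - a i m (n + 2) ≤ C * S := by
      refine g2.2.trans ?_
      rw [hC, sq, mul_assoc]
      gcongr
      exact g1.2
    have tm : a i m n - a i m (n - 1) ≤ C * S :=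
      gm.1.trans (by gcongr)
    have t3 : S ≤ C * (a i m (n + 2) - a i m (n + 1)) :=
      g0.1.trans (by have := a_lt i m (n + 1); rw [add_assoc, one_add_one_eq_two] at this; gcongr)
    have S_C : S ≤ C * S := by nlinarith
    constructor
    · have := y_lb n
      have := y_ub (n + 1)
      rw [add_assoc, one_add_one_eq_two] at this
      have : 4 * C * S ≤ K * S := by gcongr
      nlinarith
    · have yl := y_lt
      have lm2 := y_lt (n - 2)
      have lm1 := y_lt (n - 1)
      have l0 := y_lt n
      have l1 := y_lt (n + 1)
      rw [show n - 2 + 1 = n - 1 by ring] at lm2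
      rw [show n - 1 + 1 = n by ring] at lm1
      rw [show n + 1 + 1 = n + 2 by ring] at l1
      have hG : ∀ j : ℤ, F^[qA] (y j) = y (j + 1) + (pA : ℤ) := by
        intro j
        simp only [hy]
        rw [h.iterate_T, h.T_int_add]
        congr 1 <;> ring
      have hcr := Cr_le_rpow_of_DB (h.iterate_differentiable qA) (h.iterate_strictMono qA) hB
        lm2 lm1 l0 (by
        intro u hu v hv
        have := hDB s 3 1 qA (by omega) (y (n - 2)) u v hu.1 (by linarith [hu.2, hv.1]) (by
          refine hv.2.trans (le_of_eq ?_)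
          simp only [hy, h.T_comp]
          congr 1 <;> push_cast <;> ring)
        refine this.mono ?_
        rw [hBdef]
        apply Real.exp_le_exp.2
        push_cast
        nlinarith)
      rw [hG, hG, hG, hG, Cr_add_right] at hcr
      rw [show n - 2 + 1 = n - 1 by ring, show n - 1 + 1 = n by ring,
        show n + 1 + 1 = n + 2 by ring] at hcr
      have b1 := y_ub (n + 2)
      have b2 := y_lb (n - 1)
      have b3 := y_ub (n - 1)
      have b4 := y_lb (n + 1)
      have b5 := y_lb (n + 2)
      have b6 := y_ub n
      rw [show n + 2 + 1 = n + 3 by ring] at b1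
      rw [show n - 1 + 1 = n by ring] at b3
      refine gap_le_of_Cr_le_rpow lm2 lm1 l0 l1 hB hS0 hC1 hcr ?_ ?_ ?_
      · linarith
      · linarith
      · refine t3.trans ?_
        gcongr
  have b0 := bounds 0 le_rfl (by norm_num)
  have b1 := bounds 1 (by norm_num) le_rfl
  have g0 := good i m 0 (by nlinarith) (by nlinarith)
  have g1 := good i m 1 (by nlinarith) (by nlinarith)
  simp only [zero_add, one_add_one_eq_two, sub_self] at b0 b1 g0 g1
  have y0 : y 0 = x := by simp [hy, h.T_zero]
  have y1 : y 1 = h.T qA (-pA) x := by simp [hy]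
  rw [y0, y1] at b0
  rw [y1] at b1
  have hK0 : 0 < K := by linarith
  have hy2 : y 2 = h.T (2 * qA) (-(2 * pA)) x := rfl
  constructor
  · calc _ ≤ K * (a i m 2 - a i m 1) := b1.1
      _ ≤ K * (C₁ * (a i m 1 - a i m 0)) := by gcongr; exact g1.2
      _ ≤ K * (C₁ * (K * (h.T qA (-pA) x - x))) := by gcongr; exact b0.2
      _ = _ := by ring
  · calc _ ≤ K * (a i m 1 - a i m 0) := b0.1
      _ ≤ K * (C₁ * (a i m 2 - a i m 1)) := by gcongr; exact g0.1
      _ ≤ K * (C₁ * (K * (h.T (2 * qA) (-(2 * pA)) x - h.T qA (-pA) x))) := by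
        gcongr; exact b1.2
      _ = _ := by ring

theorem Irrational.mul_add_int_ne {ρ : ℝ} (h : Irrational ρ) {k m : ℤ} (hk : k ≠ 0) :
    (k : ℝ) * ρ + m ≠ 0 := by
  intro h0
  apply h.ne_rat (((-m : ℤ) : ℚ) / (k : ℚ))
  have : (k : ℝ) ≠ 0 := by exact_mod_cast hk
  push_cast
  rw [eq_div_iff this]
  linarith

theorem Irrational.dense_range {ρ : ℝ} (h : Irrational ρ) (x : ℝ) :
    Dense {y : ℝ | ∃ k m : ℤ, y = x + (k * ρ + m)} := by
  have h1 : Dense (AddSubgroup.closure {ρ, 1} : Set ℝ) :=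
    dense_addSubgroupClosure_pair_iff.2 (by simpa using h)
  have h2 := (Homeomorph.addLeft x).surjective.denseRange.dense_image
    (Homeomorph.addLeft x).continuous h1
  refine h2.mono ?_
  rintro _ ⟨y, hy, rfl⟩
  obtain ⟨k, m, rfl⟩ := AddSubgroup.mem_closure_pair.1 hy
  exact ⟨k, m, by simp⟩

namespace RState
variable {ρ : ℝ} {qA qB : ℕ} {pA pB : ℤ}

/-- The next pair of closest returns, seen after reflection. -/
theorem next (s : RState ρ qA pA qB pB) (hρ : Irrational ρ) : ∃ a : ℕ, 1 ≤ a ∧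
    RState (-ρ) qB (-pB) (qA + a * qB) (-(pA + a * pB)) := by
  have hβ := s.pos
  set β := pB - qB * ρ with hb
  set α := qA * ρ - pA with hα
  have hpos : 0 ≤ α / β := div_nonneg (by linarith [s.lt]) hβ.le
  set a := ⌊α / β⌋₊ with ha
  have h1 : (a : ℝ) ≤ α / β := Nat.floor_le hpos
  have h2 : α / β < a + 1 := Nat.lt_floor_add_one _
  rw [le_div_iff₀ hβ] at h1
  rw [div_lt_iff₀ hβ] at h2
  have h3 : 1 ≤ a := by
    apply Nat.le_floor
    rw [Nat.cast_one, le_div_iff₀ hβ, one_mul]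
    exact s.lt.le
  have hq : 1 ≤ qB := s.one_le.trans s.le
  refine ⟨a, h3, hq, ?_, ?_, ?_, ?_⟩
  · nlinarith
  · push_cast; linarith [s.det]
  · have : ((qA + a * qB : ℕ) : ℤ) * ρ + (-(pA + a * pB) : ℤ) ≠ 0 :=
      hρ.mul_add_int_ne (by positivity)
    push_cast at this ⊢
    apply lt_of_le_of_ne
    · rw [hα, hb] at h1; linarith
    · intro h; apply this; linarith
  · push_cast
    rw [hα, hb] at h2; linarith

theorem base (hρ : Irrational ρ) : RState ρ 1 ⌊ρ⌋ 1 (⌊ρ⌋ + 1) ∨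
    RState (-ρ) 1 (-(⌊ρ⌋ + 1)) 1 (-⌊ρ⌋) := by
  have h1 := Int.lt_floor_add_one ρ
  have h2 : (⌊ρ⌋ : ℝ) < ρ := lt_of_le_of_ne (Int.floor_le ρ) (hρ.ne_int _).symm
  rcases lt_trichotomy (⌊ρ⌋ + 1 - ρ) (ρ - ⌊ρ⌋) with h | h | h
  · left; exact ⟨le_rfl, le_rfl, by push_cast; ring, by push_cast; linarith, by push_cast; linarith⟩
  · exact absurd (show ((2 : ℤ) : ℝ) * ρ + (-(2 * ⌊ρ⌋ + 1) : ℤ) = 0 by push_cast; linarith)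
      (hρ.mul_add_int_ne two_ne_zero)
  · right; exact ⟨le_rfl, le_rfl, by push_cast; ring, by push_cast; linarith, by push_cast; linarith⟩

theorem next_next (s : RState ρ qA pA qB pB) (hρ : Irrational ρ) : ∃ qA' pA' qB' pB',
    RState ρ qA' pA' qB' pB' ∧ 2 * (qA' * ρ - pA') ≤ qA * ρ - pA ∧ qA < qA' := by
  obtain ⟨a, ha, s'⟩ := s.next hρ
  obtain ⟨b, hb, s''⟩ := s'.next hρ.neg
  rw [neg_neg, neg_neg] at s''
  refine ⟨_, _, _, _, s'', ?_, ?_⟩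
  · have h1 := s'.lt
    have hβ := s.pos
    have : (1 : ℝ) ≤ a := by exact_mod_cast ha
    push_cast at *
    nlinarith
  · have := s.one_le.trans s.le; nlinarith

theorem exists_small (hρ : Irrational ρ) {ε : ℝ} (hε : 0 < ε) : ∃ qA pA qB pB,
    RState ρ qA pA qB pB ∧ qA * ρ - pA < ε := by
  have h0 : ∃ qA pA qB pB, RState ρ qA pA qB pB := by
    rcases base hρ with h | h
    · exact ⟨_, _, _, _, h⟩
    · obtain ⟨a, -, h'⟩ := h.next hρ.neg
      rw [neg_neg] at h'
      exact ⟨_, _, _, _, h'⟩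
  obtain ⟨qA, pA, qB, pB, s⟩ := h0
  have : ∀ n : ℕ, ∃ qA' pA' qB' pB', RState ρ qA' pA' qB' pB' ∧
      2 ^ n * (qA' * ρ - pA') ≤ qA * ρ - pA := by
    intro n
    induction n with
    | zero => exact ⟨_, _, _, _, s, by simp⟩
    | succ n ih =>
      obtain ⟨_, _, _, _, s', h'⟩ := ih
      obtain ⟨_, _, _, _, s'', h'', -⟩ := s'.next_next hρ
      refine ⟨_, _, _, _, s'', le_trans ?_ h'⟩
      rw [pow_succ, mul_assoc]
      gcongr
  have hα : 0 < qA * ρ - pA := s.pos.trans s.lt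
  obtain ⟨n, hn⟩ := pow_unbounded_of_one_lt ((qA * ρ - pA) / ε) (one_lt_two)
  obtain ⟨_, _, _, _, s', h'⟩ := this n
  refine ⟨_, _, _, _, s', ?_⟩
  rw [div_lt_iff₀ hε] at hn
  exact lt_of_mul_lt_mul_left (h'.trans_lt hn) (by positivity)

end RState

/-- `X` conjugates the translation by `ρ` to `F`, sending `0` to the critical point. -/
structure Coord (F : ℝ → ℝ) (c d ρ : ℝ) (X : ℝ → ℝ) : Prop extends CM F c d ρ where
  mono' : StrictMono X
  cont' : Continuous X
  per' : ∀ t, X (t + 1) = X t + 1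
  conj : ∀ t, F (X t) = X (t + ρ)
  zero : X 0 = c

theorem CM.exists_coord {F : ℝ → ℝ} {c d ρ : ℝ} (h : CM F c d ρ) : ∃ X, Coord F c d ρ X := by
  obtain ⟨Φ, h1, h2, h3⟩ := h.semi
  have hcont : Continuous Φ := by
    apply h1.continuous_of_denseRange
    refine (h.irr.dense_range (Φ 0)).mono ?_
    rintro _ ⟨k, m, rfl⟩
    exact ⟨_, h.apply_T h2 h3 k m 0⟩
  have hsurj : Function.Surjective Φ := by
    intro y
    have e1 := add_int_of_add_one h2 0 ⌊y - Φ 0⌋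
    have e2 := add_int_of_add_one h2 0 (⌊y - Φ 0⌋ + 1)
    have f1 := Int.floor_le (y - Φ 0)
    have f2 := Int.lt_floor_add_one (y - Φ 0)
    push_cast at e2
    have hle : (0 : ℝ) + ⌊y - Φ 0⌋ ≤ 0 + (⌊y - Φ 0⌋ + 1) := by linarith
    obtain ⟨x, -, hx⟩ := intermediate_value_Icc hle hcont.continuousOn
      (⟨by linarith, by linarith⟩ : y ∈ Icc _ _)
    exact ⟨x, hx⟩
  obtain ⟨C, hC, hrb⟩ := h.real_bounds
  have hinj : StrictMono Φ := by
    refine h1.strictMono_of_injective ?_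
    have key : ∀ u v, u < v → Φ u = Φ v → Φ (v + (v - u) / C) = Φ v := by
      intro u v huv he
      have hs : 0 < (v - u) / C := div_pos (by linarith) (by linarith)
      refine le_antisymm (le_of_forall_pos_le_add fun ε hε => ?_) (h1 (by linarith))
      obtain ⟨qA, pA, qB, pB, s, hα⟩ := RState.exists_small h.irr (half_pos hε)
      have hA : v < h.T qA (-pA) u := by
        by_contra hcon
        have := h1 (not_lt.1 hcon)
        rw [h.apply_T h2 h3] at this
        push_cast at this
        linarith [s.pos, s.lt]
      have hr := (hrb s u).2
      have : v + (v - u) / C ≤ h.T (2 * qA) (-(2 * pA)) u := by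
        have : (v - u) / C ≤ h.T (2 * qA) (-(2 * pA)) u - h.T qA (-pA) u := by
          rw [div_le_iff₀ (by linarith), mul_comm]
          linarith
        linarith
      refine (h1 this).trans ?_
      rw [h.apply_T h2 h3]
      push_cast
      linarith
    have : ∀ u v, u < v → Φ u ≠ Φ v := by
      intro u v huv he
      have hcl : IsClosed {x | Φ x = Φ u} := isClosed_eq hcont continuous_const
      have hbdd : BddAbove {x | Φ x = Φ u} := by
        refine ⟨u + 1, fun x hx => ?_⟩
        by_contra hcon
        have := h1 (not_le.1 hcon).le
        rw [h2, hx] at this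
        linarith
      have hmem := hcl.csSup_mem ⟨u, rfl⟩ hbdd
      set w := sSup {x | Φ x = Φ u}
      have huw : u < w := huv.trans_le (le_csSup hbdd he.symm)
      have hk := key u w huw (Eq.symm hmem)
      have := le_csSup hbdd (hk.trans hmem : Φ (w + (w - u) / C) = Φ u)
      have hs : 0 < (w - u) / C := div_pos (by linarith) (by linarith)
      linarith
    intro u v he
    by_contra hne
    rcases lt_or_gt_of_ne hne with hlt | hlt
    · exact this _ _ hlt he
    · exact this _ _ hlt he.symm
  set Ψ := hinj.orderIsoOfSurjective Φ hsurj with hΨ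
  have hΨa : ∀ x, Ψ x = Φ x := fun x => rfl
  have hsy : ∀ t, Φ (Ψ.symm t) = t := fun t => Ψ.apply_symm_apply t
  refine ⟨fun t => Ψ.symm (t + Φ c), h, ?_, ?_, ?_, ?_, ?_⟩
  · intro s t hst; exact Ψ.symm.strictMono (by simpa using hst)
  · exact Ψ.symm.continuous.comp (by fun_prop)
  · intro t
    apply hinj.injective
    rw [h2, hsy, hsy]; ring
  · intro t
    apply hinj.injective
    rw [h3, hsy, hsy]; ring
  · apply hinj.injective
    rw [hsy]; ring

namespace Coord
variable {F : ℝ → ℝ} {c d ρ : ℝ} {X : ℝ → ℝ} (h : Coord F c d ρ X)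
include h

theorem reflect : Coord (fun x => -F (-x)) (-c) d (-ρ) (fun t => -X (-t)) := by
  refine ⟨h.toCM.reflect, fun s t hst => neg_lt_neg (h.mono' (neg_lt_neg hst)),
    (h.cont'.comp continuous_neg).neg, fun t => ?_, fun t => ?_, by simp [h.zero]⟩
  · have := h.per' (-(t + 1))
    rw [show -(t + 1) + 1 = -t by ring] at this
    linarith
  · simp only [neg_neg]; rw [h.conj]; congr 2; ring

theorem add_int (t : ℝ) (m : ℤ) : X (t + m) = X t + m := by
  simpa using add_int_of_add_one h.per' t m

theorem iterate (k : ℕ) (t : ℝ) : F^[k] (X t) = X (t + k * ρ) := by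
  induction k generalizing t with
  | zero => simp
  | succ n ih => rw [Function.iterate_succ_apply, h.conj, ih]; congr 1; push_cast; ring

theorem T_eq (k m : ℤ) (t : ℝ) : h.T k m (X t) = X (t + (k * ρ + m)) := by
  rcases Int.eq_nat_or_neg k with ⟨n, rfl | rfl⟩
  · rw [h.T_nat, h.iterate, ← h.add_int]; congr 1; push_cast; ring
  · apply (h.iterate_strictMono n).injective
    rw [h.iterate_T, h.iterate]
    simp only [add_neg_cancel]
    have := h.T_nat 0 m (X t)
    simp only [Nat.cast_zero, Function.iterate_zero, id] at this
    rw [this, ← h.add_int]; congr 1; push_cast; ring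

theorem surjective' : Function.Surjective X := by
  intro y
  have e1 := h.add_int 0 ⌊y - X 0⌋
  have e2 := h.add_int 0 (⌊y - X 0⌋ + 1)
  have f1 := Int.floor_le (y - X 0)
  have f2 := Int.lt_floor_add_one (y - X 0)
  push_cast at e2
  have hle : (0 : ℝ) + ⌊y - X 0⌋ ≤ 0 + (⌊y - X 0⌋ + 1) := by linarith
  obtain ⟨x, -, hx⟩ := intermediate_value_Icc hle h.cont'.continuousOn
    (⟨by linarith, by linarith⟩ : y ∈ Icc _ _)
  exact ⟨x, hx⟩

/-- Real bounds for translates by the longer closest return. -/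
theorem rb_long : ∃ C : ℝ, 1 ≤ C ∧ ∀ {qA qB : ℕ} {pA pB : ℤ},
    RState ρ qA pA qB pB → ∀ t,
      X (t + 2 * (qA * ρ - pA)) - X (t + (qA * ρ - pA)) ≤ C * (X (t + (qA * ρ - pA)) - X t) ∧
      X (t + (qA * ρ - pA)) - X t ≤ C * (X (t + 2 * (qA * ρ - pA)) - X (t + (qA * ρ - pA))) := by
  obtain ⟨C, hC, hrb⟩ := h.real_bounds
  refine ⟨C, hC, fun {qA qB pA pB} s t => ?_⟩
  have := hrb s (X t)
  rw [h.T_eq, h.T_eq] at this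
  have e1 : t + (((2 * qA : ℤ) : ℝ) * ρ + ((-(2 * pA) : ℤ) : ℝ)) = t + 2 * (qA * ρ - pA) := by
    push_cast; ring
  have e2 : t + (((qA : ℤ) : ℝ) * ρ + ((-pA : ℤ) : ℝ)) = t + (qA * ρ - pA) := by
    push_cast; ring
  rwa [e1, e2] at this

/-- Real bounds for translates by the shorter closest return. -/
theorem rb_short : ∃ C : ℝ, 1 ≤ C ∧ ∀ {qA qB : ℕ} {pA pB : ℤ},
    RState ρ qA pA qB pB → ∀ t,
      X (t + 2 * (pB - qB * ρ)) - X (t + (pB - qB * ρ)) ≤ C * (X (t + (pB - qB * ρ)) - X t) ∧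
      X (t + (pB - qB * ρ)) - X t ≤ C * (X (t + 2 * (pB - qB * ρ)) - X (t + (pB - qB * ρ))) := by
  obtain ⟨C, hC, hrb⟩ := h.reflect.rb_long
  refine ⟨C, hC, fun {qA qB pA pB} s t => ?_⟩
  obtain ⟨a, -, s'⟩ := s.next h.irr
  have := hrb s' (-t - 2 * (pB - qB * ρ))
  push_cast at this
  rw [show -(-t - 2 * (pB - qB * ρ) + 2 * (qB * -ρ - -(pB : ℝ))) = t by ring,
    show -(-t - 2 * (pB - qB * ρ) + (qB * -ρ - -(pB : ℝ))) = t + (pB - qB * ρ) by ring,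
    show -(-t - 2 * (pB - qB * ρ)) = t + 2 * (pB - qB * ρ) by ring] at this
  constructor <;> linarith [this.1, this.2]

end Coord

namespace RState
variable {ρ : ℝ} {qA qB : ℕ} {pA pB : ℤ}

theorem det_real (s : RState ρ qA pA qB pB) :
    qA * (pB - qB * ρ) + qB * (qA * ρ - pA) = 1 := by
  have : ((qA : ℝ) * pB - qB * pA) = 1 := by exact_mod_cast s.det
  linarith

theorem alpha_le_one (s : RState ρ qA pA qB pB) : qA * ρ - pA ≤ 1 := by
  have h1 := s.det_real
  have h2 := s.pos
  have h3 := s.lt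
  have h4 : (1 : ℝ) ≤ qB := by exact_mod_cast s.one_le.trans s.le
  have h5 : (0 : ℝ) ≤ qA := by positivity
  nlinarith

theorem not_mem_long (s : RState ρ qA pA qB pB) {k m : ℤ} (h1 : -(qB : ℤ) < k) (h2 : k < qA + qB)
    (h3 : 0 < k * ρ - m) : qA * ρ - pA ≤ k * ρ - m := by
  by_contra hcon
  push Not at hcon
  set x : ℤ := k * pB - m * qB with hx
  set y : ℤ := m * qA - k * pA with hy
  have hd := s.det
  have ek : k = x * qA + y * qB := by
    have : k * ((qA : ℤ) * pB - qB * pA) = x * qA + y * qB := by rw [hx, hy]; ring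
    rw [← this, hd, mul_one]
  have em : m = x * pA + y * pB := by
    have : m * ((qA : ℤ) * pB - qB * pA) = x * pA + y * pB := by rw [hx, hy]; ring
    rw [← this, hd, mul_one]
  have e : k * ρ - m = x * (qA * ρ - pA) - y * (pB - qB * ρ) := by
    rw [ek, em]; push_cast; ring
  rw [e] at h3 hcon
  have hβ := s.pos
  have hα := s.pos.trans s.lt
  rcases le_or_gt x 0 with hx0 | hx0
  · have hx0' : (x : ℝ) ≤ 0 := by exact_mod_cast hx0
    have : (y : ℝ) < 0 := by nlinarith
    have hy0 : y ≤ -1 := by have : y < 0 := by exact_mod_cast this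
                            omega
    have : (0 : ℤ) ≤ qA := by positivity
    have : (0 : ℤ) ≤ qB := by positivity
    nlinarith
  · have hx0' : (1 : ℝ) ≤ x := by exact_mod_cast hx0
    have : (0 : ℝ) < y := by nlinarith
    have hy0 : 1 ≤ y := by have : 0 < y := by exact_mod_cast this
                           omega
    have : (0 : ℤ) ≤ qA := by positivity
    have : (0 : ℤ) ≤ qB := by positivity
    nlinarith

theorem not_mem_short (s : RState ρ qA pA qB pB) {k m : ℤ} (h1 : -(qA : ℤ) < k) (h2 : k < qA + qB)
    (h3 : k * ρ - m < 0) : k * ρ - m ≤ -(pB - qB * ρ) := by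
  by_contra hcon
  push Not at hcon
  set x : ℤ := k * pB - m * qB with hx
  set y : ℤ := m * qA - k * pA with hy
  have hd := s.det
  have ek : k = x * qA + y * qB := by
    have : k * ((qA : ℤ) * pB - qB * pA) = x * qA + y * qB := by rw [hx, hy]; ring
    rw [← this, hd, mul_one]
  have em : m = x * pA + y * pB := by
    have : m * ((qA : ℤ) * pB - qB * pA) = x * pA + y * pB := by rw [hx, hy]; ring
    rw [← this, hd, mul_one]
  have e : k * ρ - m = x * (qA * ρ - pA) - y * (pB - qB * ρ) := by
    rw [ek, em]; push_cast; ring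
  rw [e] at h3 hcon
  have hβ := s.pos
  have hα := s.pos.trans s.lt
  rcases le_or_gt y 0 with hx0 | hx0
  · have hx0' : (y : ℝ) ≤ 0 := by exact_mod_cast hx0
    have : (x : ℝ) < 0 := by nlinarith
    have hy0 : x ≤ -1 := by have : x < 0 := by exact_mod_cast this
                            omega
    have : (0 : ℤ) ≤ qA := by positivity
    have : (0 : ℤ) ≤ qB := by positivity
    nlinarith
  · have hx0' : (1 : ℝ) ≤ y := by exact_mod_cast hx0
    have : (0 : ℝ) < x := by nlinarith
    have hy0 : 1 ≤ x := by have : 0 < x := by exact_mod_cast this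
                           omega
    have : (0 : ℤ) ≤ qA := by positivity
    have : (0 : ℤ) ≤ qB := by positivity
    nlinarith

end RState

namespace Coord
variable {F : ℝ → ℝ} {c d ρ : ℝ} {X : ℝ → ℝ} (h : Coord F c d ρ X)
include h

theorem rb_long' : ∃ C : ℝ, 1 ≤ C ∧ ∀ {qA qB : ℕ} {pA pB : ℤ},
    RState ρ qA pA qB pB → ∀ t,
      X (t + (qA * ρ - pA)) - X t ≤ C * (X t - X (t - (qA * ρ - pA))) ∧
      X t - X (t - (qA * ρ - pA)) ≤ C * (X (t + (qA * ρ - pA)) - X t) := by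
  obtain ⟨C, hC, hrb⟩ := h.rb_long
  refine ⟨C, hC, fun {qA qB pA pB} s t => ?_⟩
  have := hrb s (t - (qA * ρ - pA))
  rwa [sub_add_cancel, show t - (qA * ρ - pA) + 2 * (qA * ρ - pA) = t + (qA * ρ - pA) by ring] at this

theorem rb_short' : ∃ C : ℝ, 1 ≤ C ∧ ∀ {qA qB : ℕ} {pA pB : ℤ},
    RState ρ qA pA qB pB → ∀ t,
      X (t + (pB - qB * ρ)) - X t ≤ C * (X t - X (t - (pB - qB * ρ))) ∧
      X t - X (t - (pB - qB * ρ)) ≤ C * (X (t + (pB - qB * ρ)) - X t) := by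
  obtain ⟨C, hC, hrb⟩ := h.rb_short
  refine ⟨C, hC, fun {qA qB pA pB} s t => ?_⟩
  have := hrb s (t - (pB - qB * ρ))
  rwa [sub_add_cancel, show t - (pB - qB * ρ) + 2 * (pB - qB * ρ) = t + (pB - qB * ρ) by ring] at this

/-- `DB_long` in the linearizing coordinate. -/
theorem DB_label : ∃ C : ℝ, 0 ≤ C ∧ ∀ {qA qB : ℕ} {pA pB : ℤ},
    RState ρ qA pA qB pB → ∀ (N M k : ℕ), k ≤ M * qB → ∀ (t u v : ℝ), X t ≤ u → u ≤ v →
    v ≤ X (t + N * (qA * ρ - pA)) → DB F^[k] u v (Real.exp (C * N * M)) := by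
  obtain ⟨C, hC, hDB⟩ := h.DB_long
  refine ⟨C, hC, fun {qA qB pA pB} s N M k hk t u v h1 h2 h3 => hDB s N M k hk (X t) u v h1 h2 ?_⟩
  rw [h.T_eq]
  refine h3.trans (le_of_eq ?_)
  congr 1; push_cast; ring

set_option maxHeartbeats 1000000 in
theorem rb_crit_zero : ∃ C : ℝ, 1 ≤ C ∧ ∀ {qA qB : ℕ} {pA pB : ℤ},
    RState ρ qA pA qB pB → X (qA * ρ - pA) - X 0 ≤ C * (X 0 - X (-(pB - qB * ρ))) := by
  obtain ⟨C₁, hC₁, hrb⟩ := h.rb_long'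
  obtain ⟨C₂, hC₂, hDB⟩ := h.DB_label
  obtain ⟨C₃, hC₃, hpow⟩ := h.power_bounds
  have hd := h.one_lt
  set B := Real.exp (C₂ * 3 * 1) with hB
  have hBp : 0 < B := Real.exp_pos _
  have hB1 : 1 ≤ B := Real.one_le_exp (by positivity)
  set K := 3 * ((1 + C₁) * (B * (C₃ * C₃ * 2 ^ d))) with hK
  have h2d : (1 : ℝ) ≤ 2 ^ d := Real.one_le_rpow (by norm_num) (by linarith)
  have hK1 : 1 ≤ K := by
    have : 1 ≤ C₃ * C₃ * 2 ^ d := one_le_mul_of_one_le_of_one_le (one_le_mul_of_one_le_of_one_le hC₃ hC₃) h2d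
    have : 1 ≤ B * (C₃ * C₃ * 2 ^ d) := one_le_mul_of_one_le_of_one_le hB1 this
    nlinarith
  have hK' : 1 ≤ K ^ (1 / (d - 1)) := Real.one_le_rpow hK1 (by have : 0 < d - 1 := by linarith
                                                               positivity)
  refine ⟨2 * C₁ + K ^ (1 / (d - 1)), by linarith, fun {qA qB pA pB} s => ?_⟩
  have hα1 := s.alpha_le_one
  have hβ := s.pos
  have hβα := s.lt
  set α := qA * ρ - pA with hα
  set β := pB - qB * ρ with hβd
  set η := X 0 - X (-β) with hη
  set e := X α - X 0 with he
  have hη0 : 0 < η := sub_pos.2 (h.mono' (by linarith))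
  have he0 : 0 < e := sub_pos.2 (h.mono' (by linarith))
  by_cases hsmall : 2 * C₁ * η < e
  swap
  · have : 0 ≤ K ^ (1 / (d - 1)) * η := by positivity
    linarith
  have hηe : 2 * η ≤ e := by nlinarith
  have he1 : e ≤ 1 := by
    have h1 := h.mono'.monotone hα1
    have h2 := h.per' 0
    rw [zero_add] at h2
    linarith
  have hq : 1 ≤ qB := s.one_le.trans s.le
  have hX0 : X 0 = c := h.zero
  have r0 := hrb s 0
  rw [zero_add, zero_sub] at r0
  have hlow : X (-α) < c - 2 * η := by
    have : 2 * η < c - X (-α) := by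
      have := r0.1
      rw [hX0] at this
      by_contra hcon
      push Not at hcon
      have : C₁ * (c - X (-α)) ≤ C₁ * (2 * η) := by gcongr
      rw [← hX0] at this hcon
      linarith
    linarith
  have hF0 : F c = X ρ := by rw [← hX0, h.conj, zero_add]
  have l1 : F (c - 2 * η) < F c := h.mono (by linarith)
  have l2 : F c < X (ρ + α) := by rw [hF0]; exact h.mono' (by linarith)
  have l3 : X (ρ + α) < X (ρ + 2 * α) := h.mono' (by linarith)
  have hcr := one_sub_Cr_le_of_DB (h.iterate_differentiable (qB - 1)) (h.iterate_strictMono (qB - 1))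
    hBp.le l1 l2 l3 (by
    intro x hx y hy
    have := hDB s 3 1 (qB - 1) (by omega) (ρ - α) x y (by
      refine le_trans (le_of_eq ?_) ((h.mono hlow).le.trans hx.1)
      rw [h.conj]; congr 1; ring) (by linarith [hx.2, hy.1]) (by
      refine hy.2.trans (le_of_eq ?_)
      congr 1; push_cast; ring)
    simpa [hB] using this)
  have hGc : F^[qB - 1] (F c) = X (-β) + pB := by
    rw [hF0, h.iterate, ← h.add_int]
    congr 1
    rw [Nat.cast_sub hq, hβd]; push_cast; ring
  have hGA : F^[qB - 1] (X (ρ + α)) = X (α - β) + pB := by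
    rw [h.iterate, ← h.add_int]
    congr 1
    rw [Nat.cast_sub hq, hβd]; push_cast; ring
  have hGA2 : F^[qB - 1] (X (ρ + 2 * α)) = X (2 * α - β) + pB := by
    rw [h.iterate, ← h.add_int]
    congr 1
    rw [Nat.cast_sub hq, hβd]; push_cast; ring
  rw [hGc, hGA, hGA2] at hcr
  obtain ⟨ξ, hξ⟩ : ∃ ξ, ξ = F^[qB - 1] (F (c - 2 * η)) - pB := ⟨_, rfl⟩
  rw [show F^[qB - 1] (F (c - 2 * η)) = ξ + pB by rw [hξ]; ring] at hcr
  simp only [add_sub_add_right_eq_sub] at hcr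
  set ζ := X (-β) - ξ with hζ
  have hζη : η < ζ := by
    have := h.B_lt s (c - 2 * η)
    rw [h.T_nat] at this
    have e1 : F^[qB] (c - 2 * η) = F^[qB - 1] (F (c - 2 * η)) := by
      rw [← Function.iterate_succ_apply]; congr 1; omega
    rw [e1] at this
    push_cast at this
    rw [hζ, hξ]
    linarith
  have r1 := hrb s (α - β)
  rw [show α - β + α = 2 * α - β by ring, show α - β - α = -β by ring] at r1
  have m1 : X (-β) < X (α - β) := h.mono' (by linarith)
  have m2 : X (α - β) < X (2 * α - β) := h.mono' (by linarith)
  have m3 : X (α - β) < X α := h.mono' (by linarith)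
  have hcr1 : ζ ≤ (1 + C₁) * ((X (α - β) - ξ) * (B * ((F c - F (c - 2 * η)) / (X (ρ + α) - F c)))) := by
    have e1 : (F c - F (c - 2 * η)) * (X (ρ + 2 * α) - X (ρ + α)) /
        ((X (ρ + α) - F c) * (X (ρ + 2 * α) - F (c - 2 * η))) ≤
        (F c - F (c - 2 * η)) / (X (ρ + α) - F c) := by
      rw [mul_div_mul_comm]
      have : (X (ρ + 2 * α) - X (ρ + α)) / (X (ρ + 2 * α) - F (c - 2 * η)) ≤ 1 :=
        (div_le_one (by linarith)).2 (by linarith)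
      exact mul_le_of_le_one_right (div_nonneg (by linarith) (by linarith)) this
    have e2 := hcr.trans (mul_le_mul_of_nonneg_left e1 hBp.le)
    rw [div_le_iff₀ (mul_pos (by linarith) (by linarith))] at e2
    set Q := B * ((F c - F (c - 2 * η)) / (X (ρ + α) - F c)) with hQ
    have hQ0 : 0 ≤ Q := mul_nonneg hBp.le (div_nonneg (by linarith) (by linarith))
    have e3 : X (2 * α - β) - X (-β) ≤ (1 + C₁) * (X (2 * α - β) - X (α - β)) := by linarith [r1.2]
    have m0 : 0 ≤ X (α - β) - ξ := by linarith
    have e4 : ζ * (X (2 * α - β) - X (α - β)) ≤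
        ((1 + C₁) * ((X (α - β) - ξ) * Q)) * (X (2 * α - β) - X (α - β)) := by
      refine e2.trans ?_
      have := mul_le_mul_of_nonneg_left e3 (mul_nonneg hQ0 m0)
      linarith
    exact le_of_mul_le_mul_right e4 (by linarith)
  have hp1 := (hpow (2 * η) (by linarith) (by linarith)).2.2.2
  have hp2 := (hpow e he0 he1).1
  have hce : c + e = X α := by rw [he, hX0]; ring
  rw [hce, h.conj, add_comm α ρ] at hp2
  have hed : 0 < e ^ d := Real.rpow_pos_of_pos he0 d
  have hratio : (F c - F (c - 2 * η)) / (X (ρ + α) - F c) ≤ C₃ * C₃ * 2 ^ d * (η / e) ^ d := by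
    rw [div_le_iff₀ (by linarith), Real.div_rpow hη0.le he0.le]
    refine hp1.trans ?_
    rw [Real.mul_rpow (by norm_num) hη0.le]
    have : C₃ * C₃ * 2 ^ d * (η ^ d / e ^ d) * (X (ρ + α) - F c) =
        C₃ * (2 ^ d * η ^ d) * ((C₃ * (X (ρ + α) - F c)) / e ^ d) := by ring
    rw [this]
    have h1 : 1 ≤ (C₃ * (X (ρ + α) - F c)) / e ^ d := (one_le_div hed).2 hp2
    have h2 : 0 ≤ C₃ * (2 ^ d * η ^ d) := by
      have := Real.rpow_pos_of_pos hη0 d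
      positivity
    exact le_mul_of_one_le_right h2 h1
  have hfin : η / e ≤ K * (η / e) ^ d := by
    have e1 : ζ / (X (α - β) - ξ) ≤ (1 + C₁) * (B * (C₃ * C₃ * 2 ^ d * (η / e) ^ d)) := by
      rw [div_le_iff₀ (by linarith)]
      refine hcr1.trans ?_
      have : B * ((F c - F (c - 2 * η)) / (X (ρ + α) - F c)) ≤
        B * (C₃ * C₃ * 2 ^ d * (η / e) ^ d) := by gcongr
      have := mul_le_mul_of_nonneg_left this (mul_nonneg (by linarith : 0 ≤ 1 + C₁)
        (by linarith : 0 ≤ X (α - β) - ξ))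
      linarith
    have e2 : η / (3 * e) ≤ ζ / (X (α - β) - ξ) := by
      rw [div_le_div_iff₀ (by linarith) (by linarith)]
      have : X (α - β) - ξ ≤ e + η + ζ := by linarith
      have : η * (X (α - β) - ξ) ≤ η * (e + η + ζ) := by gcongr
      have t1 : η * e ≤ ζ * e := by gcongr
      have t2 : η * η ≤ ζ * e := mul_le_mul hζη.le (by linarith) hη0.le (by linarith)
      have t3 : ζ * η ≤ ζ * e := mul_le_mul_of_nonneg_left (by linarith) (by linarith)
      linarith
    have e3 := e2.trans e1
    calc η / e = 3 * (η / (3 * e)) := by field_simp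
      _ ≤ 3 * ((1 + C₁) * (B * (C₃ * C₃ * 2 ^ d * (η / e) ^ d))) := by gcongr
      _ = _ := by rw [hK]; ring
  have hr0 : 0 < η / e := by positivity
  have h1 : 1 ≤ K * (η / e) ^ (d - 1) := by
    rw [show d = 1 + (d - 1) by ring, Real.rpow_add hr0, Real.rpow_one] at hfin
    have : (η / e) * 1 ≤ (η / e) * (K * (η / e) ^ (1 + (d - 1) - 1)) := by
      rw [show 1 + (d - 1) - 1 = d - 1 by ring]; linarith
    have := le_of_mul_le_mul_left this hr0
    rwa [show 1 + (d - 1) - 1 = d - 1 by ring] at this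
  have h2 : 1 ≤ K ^ (1 / (d - 1)) * (η / e) := by
    have hd1 : 0 < d - 1 := by linarith
    have := Real.one_le_rpow h1 (show 0 ≤ 1 / (d - 1) by positivity)
    rwa [Real.mul_rpow (by linarith) (Real.rpow_nonneg hr0.le _), ← Real.rpow_mul hr0.le,
      mul_one_div_cancel hd1.ne', Real.rpow_one] at this
  have h3 : e ≤ K ^ (1 / (d - 1)) * η := by
    rw [← mul_div_assoc, one_le_div he0] at h2
    exact h2
  have : 0 ≤ 2 * C₁ * η := by positivity
  linarith

/-- Real bounds at the points of the dynamical partition. -/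
theorem rb_crit : ∃ C : ℝ, 1 ≤ C ∧ ∀ {qA qB : ℕ} {pA pB : ℤ},
    RState ρ qA pA qB pB → ∀ i : ℕ, i < qA + qB →
      X (i * ρ + (qA * ρ - pA)) - X (i * ρ) ≤ C * (X (i * ρ) - X (i * ρ - (pB - qB * ρ))) := by
  obtain ⟨C₁, hC₁, hrb⟩ := h.rb_long'
  obtain ⟨C₂, hC₂, hDB⟩ := h.DB_label
  obtain ⟨C₃, hC₃, hz⟩ := h.rb_crit_zero
  set B := Real.exp (C₂ * 2 * 2) with hB
  have hBp : 0 < B := Real.exp_pos _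
  have h1C : 1 ≤ (1 + C₃) ^ B := Real.one_le_rpow (by linarith) hBp.le
  refine ⟨(1 + C₁) * (1 + C₃) ^ B, by nlinarith, fun {qA qB pA pB} s i hi => ?_⟩
  have hβ := s.pos
  have hβα := s.lt
  have hqq := s.le
  have hz := hz s
  set α := qA * ρ - pA with hα
  set β := pB - qB * ρ with hβd
  have l1 : X (-α) < X (-β) := h.mono' (by linarith)
  have l2 : X (-β) < X 0 := h.mono' (by linarith)
  have l3 : X 0 < X α := h.mono' (by linarith)
  have hcr := Cr_le_rpow_of_DB (h.iterate_differentiable i) (h.iterate_strictMono i) hBp l1 l2 l3 (by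
    intro x hx y hy
    have := hDB s 2 2 i (by omega) (-α) x y hx.1 (by linarith [hx.2, hy.1]) (by
      refine hy.2.trans (le_of_eq ?_)
      congr 1; push_cast; ring)
    simpa [hB] using this)
  have hlow : 1 / (1 + C₃) ≤ Cr (X (-α)) (X (-β)) (X 0) (X α) := by
    unfold Cr
    rw [div_le_div_iff₀ (by linarith) (mul_pos (by linarith) (by linarith))]
    have : (X 0 - X (-α)) * (X α - X (-β)) ≤ (X α - X (-α)) * ((1 + C₃) * (X 0 - X (-β))) := by
      apply mul_le_mul <;> linarith
    linarith
  simp only [h.iterate] at hcr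
  have e0 : -α + i * ρ = i * ρ - α := by ring
  have e1 : -β + i * ρ = i * ρ - β := by ring
  have e2 : α + i * ρ = i * ρ + α := by ring
  rw [e0, e1, e2, zero_add] at hcr
  set t := i * ρ with ht
  have k1 : X (t - α) < X (t - β) := h.mono' (by linarith)
  have k2 : X (t - β) < X t := h.mono' (by linarith)
  have k3 : X t < X (t + α) := h.mono' (by linarith)
  have hp := Cr_pos k1 k2 k3
  have h4 : (1 / (1 + C₃)) ^ B ≤ Cr (X (t - α)) (X (t - β)) (X t) (X (t + α)) := by
    have := Real.rpow_le_rpow (by positivity) (hlow.trans hcr) hBp.le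
    rwa [← Real.rpow_mul hp.le, one_div_mul_cancel hBp.ne', Real.rpow_one] at this
  rw [Real.div_rpow zero_le_one (by linarith), Real.one_rpow] at h4
  unfold Cr at h4
  rw [div_le_div_iff₀ (by positivity) (mul_pos (by linarith) (by linarith)), one_mul] at h4
  have r := (hrb s t).1
  have g : X (t + α) - X (t - α) ≤ (1 + C₁) * (X t - X (t - α)) := by linarith
  have g2 : (X t - X (t - α)) * (X (t + α) - X (t - β)) ≤
      (X t - X (t - α)) * ((1 + C₁) * (1 + C₃) ^ B * (X t - X (t - β))) := by
    refine h4.trans ?_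
    have := mul_le_mul_of_nonneg_left g (mul_nonneg (by linarith : 0 ≤ X t - X (t - β))
      (by linarith : 0 ≤ (1 + C₃) ^ B))
    linarith
  have := le_of_mul_le_mul_left g2 (by linarith)
  linarith

end Coord

theorem deriv_le_of_DB_aux {D₁ D₂ r S C K g g₂ e e₁ e₂ : ℝ} (hC : 1 ≤ C) (hK : 0 ≤ K) (hg : 0 < g)
    (he : 0 < e) (hD₁ : 0 ≤ D₁) (he₂ : 0 < e₂) (hDB : D₁ * D₂ * r ^ 2 ≤ K * S ^ 2) (hS0 : 0 ≤ S)
    (hS : S ≤ 3 * C ^ 2 * g) (hr : e₁ ≤ r) (h1 : e ≤ C * e₁) (hD₂ : D₂ = g₂ / e₂)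
    (h2 : g ≤ C ^ 2 * g₂) (h3 : e₂ ≤ C ^ 2 * e) : D₁ ≤ 9 * K * C ^ 10 * g / e := by
  have hC0 : 0 < C := by linarith
  have a1 : g / (C ^ 4 * e) ≤ D₂ := by
    rw [hD₂, div_le_div_iff₀ (by positivity) he₂]
    have : g * e₂ ≤ (C ^ 2 * g₂) * (C ^ 2 * e) := mul_le_mul h2 h3 he₂.le (by linarith)
    linarith
  have a2 : e / C ≤ r := by
    refine le_trans ?_ hr
    rw [div_le_iff₀ hC0]; linarith
  have a3 : (e / C) ^ 2 ≤ r ^ 2 := pow_le_pow_left₀ (by positivity) a2 2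
  have a4 : S ^ 2 ≤ (3 * C ^ 2 * g) ^ 2 := pow_le_pow_left₀ hS0 hS 2
  have hD₂0 : 0 ≤ D₂ := le_trans (by positivity) a1
  have a5 : D₁ * (g / (C ^ 4 * e)) * (e / C) ^ 2 ≤ K * (3 * C ^ 2 * g) ^ 2 := by
    calc _ ≤ D₁ * D₂ * r ^ 2 := by gcongr
      _ ≤ K * S ^ 2 := hDB
      _ ≤ _ := by gcongr
  have e1 : D₁ * (g / (C ^ 4 * e)) * (e / C) ^ 2 = D₁ * e * g / C ^ 6 := by field_simp
  rw [e1, div_le_iff₀ (by positivity)] at a5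
  rw [le_div_iff₀ he]
  have : (D₁ * e) * g ≤ (9 * K * C ^ 10 * g) * g := by nlinarith
  exact le_of_mul_le_mul_right this hg

namespace Coord
variable {F : ℝ → ℝ} {c d ρ : ℝ} {X : ℝ → ℝ} (h : Coord F c d ρ X)
include h

theorem deriv_iterate_le : ∃ C : ℝ, 1 ≤ C ∧ ∀ {qA qB : ℕ} {pA pB : ℤ},
    RState ρ qA pA qB pB → ∀ i : ℕ, i ≤ qB → ∀ x ∈ Icc (X 0) (X (qA * ρ - pA)),
      deriv F^[i] x ≤ C * (X (i * ρ + (qA * ρ - pA)) - X (i * ρ)) / (X (qA * ρ - pA) - X 0) := by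
  obtain ⟨C, hC, hrb⟩ := h.rb_long
  obtain ⟨C₂, hC₂, hDB⟩ := h.DB_label
  set K := Real.exp (C₂ * 3 * 1) with hK
  have hK1 : 1 ≤ K := Real.one_le_exp (by positivity)
  have hC10 : 1 ≤ C ^ 10 := one_le_pow₀ hC
  refine ⟨9 * K * C ^ 10, by nlinarith, fun {qA qB pA pB} s i hi x hx => ?_⟩
  have hα : 0 < qA * ρ - pA := s.pos.trans s.lt
  set α := qA * ρ - pA with hαd
  obtain ⟨y, hy, hyd⟩ := exists_deriv_eq_slope F^[i]
    (h.mono' (show 2 * α < 3 * α by linarith)) (h.iterate_differentiable i).continuous.continuousOn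
    (h.iterate_differentiable i).differentiableOn
  have hxy : x ≤ y := by
    have := h.mono' (show α < 2 * α by linarith)
    linarith [hx.2, hy.1]
  have hdb : DB F^[i] x y K := by
    have := hDB s 3 1 i (by omega) 0 x y hx.1 hxy (by
      refine hy.2.le.trans (le_of_eq ?_)
      congr 1; push_cast; ring)
    simpa [hK] using this
  have e0 := hrb s 0
  have e1 := hrb s α
  have g0 := hrb s (i * ρ)
  have g1 := hrb s (i * ρ + α)
  rw [← hαd] at e0 e1 g0 g1
  rw [show α + 2 * α = 3 * α by ring, show α + α = 2 * α by ring] at e1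
  rw [zero_add, zero_add] at e0
  rw [show i * ρ + α + 2 * α = i * ρ + 3 * α by ring, show i * ρ + α + α = i * ρ + 2 * α by ring] at g1
  have k0 : X 0 < X α := h.mono' (by linarith)
  have k1 : X α < X (2 * α) := h.mono' (by linarith)
  have k2 : X (2 * α) < X (3 * α) := h.mono' (by linarith)
  have j0 : X (i * ρ) < X (i * ρ + α) := h.mono' (by linarith)
  have j1 : X (i * ρ + α) < X (i * ρ + 2 * α) := h.mono' (by linarith)
  have j2 : X (i * ρ + 2 * α) < X (i * ρ + 3 * α) := h.mono' (by linarith)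
  have hC0 : 0 < C := by linarith
  refine deriv_le_of_DB_aux (g := X (i * ρ + α) - X (i * ρ)) (e := X α - X 0)
    (e₁ := X (2 * α) - X α) hC (by linarith) (by linarith) (by linarith)
    ((h.iterate_strictMono i).monotone.deriv_nonneg) (sub_pos.2 k2) hdb
    (sub_nonneg.2 ((h.iterate_strictMono i).monotone hxy)) ?_ ?_ e0.2 hyd ?_ ?_
  · have l1 := (h.iterate_strictMono i).monotone hx.1
    have l2 := (h.iterate_strictMono i).monotone hy.2.le
    rw [h.iterate, zero_add] at l1
    rw [h.iterate, show 3 * α + i * ρ = i * ρ + 3 * α by ring] at l2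
    have m1 := g0.1
    have m2 := g1.1
    set p := X (i * ρ + α) - X (i * ρ)
    have m3 : C * (X (i * ρ + 2 * α) - X (i * ρ + α)) ≤ C * (C * p) := by gcongr
    have m4 : C * p ≤ C ^ 2 * p := by
      have : 0 < p := sub_pos.2 j0
      nlinarith [mul_pos hC0 this]
    have m5 : p ≤ C * p := by
      have : 0 < p := sub_pos.2 j0
      nlinarith
    linarith
  · linarith [hx.2, hy.1]
  · rw [h.iterate, h.iterate, show 3 * α + i * ρ = i * ρ + 3 * α by ring,
      show 2 * α + i * ρ = i * ρ + 2 * α by ring]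
    have := g0.2
    have m3 := mul_le_mul_of_nonneg_left g1.2 hC0.le
    linarith
  · have := mul_le_mul_of_nonneg_left e0.1 hC0.le
    linarith [e1.1]

theorem image_le : ∃ C : ℝ, 1 ≤ C ∧ ∀ {qA qB : ℕ} {pA pB : ℤ},
    RState ρ qA pA qB pB → ∀ i : ℕ, i ≤ qB → ∀ x y, X 0 ≤ x → x ≤ y → y ≤ X (qA * ρ - pA) →
      F^[i] y - F^[i] x ≤
        C * (X (i * ρ + (qA * ρ - pA)) - X (i * ρ)) / (X (qA * ρ - pA) - X 0) * (y - x) := by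
  obtain ⟨C, hC, hd⟩ := h.deriv_iterate_le
  refine ⟨C, hC, fun {qA qB pA pB} s i hi x y h1 h2 h3 => ?_⟩
  exact (convex_Icc (X 0) (X (qA * ρ - pA))).image_sub_le_mul_sub_of_deriv_le
    (h.iterate_differentiable i).continuous.continuousOn
    (h.iterate_differentiable i).differentiableOn
    (fun z hz => hd s i hi z (interior_subset hz)) x ⟨h1, h2.trans h3⟩ y ⟨h1.trans h2, h3⟩ h2

/-- Distortion of the first return, with a quantitatively small constant. -/
theorem DB_sharp : ∃ C : ℝ, 0 ≤ C ∧ ∀ {qA qB : ℕ} {pA pB : ℤ},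
    RState ρ qA pA qB pB → ∀ w : ℝ, (∀ t, X (t + (qA * ρ - pA)) - X t ≤ w) →
    ∀ k : ℕ, k ≤ qB → ∀ x y, X 0 ≤ x → x ≤ y → y ≤ X (qA * ρ - pA) →
      DB F^[k] x y (Real.exp (C * w * ((y - x) / (X (qA * ρ - pA) - X 0)) ^ 2)) := by
  obtain ⟨C₁, hC₁, him⟩ := h.image_le
  obtain ⟨C₂, hC₂, -, hDB⟩ := h.DB_basic
  refine ⟨C₂ * C₁ ^ 2, by positivity, fun {qA qB pA pB} s w hw k hk x y h1 h2 h3 => ?_⟩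
  have hα : 0 < qA * ρ - pA := s.pos.trans s.lt
  have him := fun i hi => him s i hi x y h1 h2 h3
  set α := qA * ρ - pA with hαd
  set e := X α - X 0 with he
  have he0 : 0 < e := sub_pos.2 (h.mono' hα)
  set E : ℕ → ℝ := fun i => X (i * ρ + α) - X (i * ρ) with hE
  have hE0 : ∀ i, 0 ≤ E i := fun i => sub_nonneg.2 (h.mono'.monotone (by linarith))
  have hsum : ∑ i ∈ Finset.range qB, E i ≤ 1 := by
    have := h.sum_le s (ξ := id) (κ := 1) monotone_id (fun x => rfl) (X 0)
    refine le_trans (le_of_eq (Finset.sum_congr rfl fun i _ => ?_)) this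
    simp only [id, hE]
    rw [h.T_eq, h.iterate, h.iterate]
    congr 2
    · push_cast; ring
    · ring
  have step : ∀ k ≤ qB, DB F^[k] x y
      (Real.exp (C₂ * C₁ ^ 2 * ((y - x) / e) ^ 2 * ∑ i ∈ Finset.range k, E i ^ 2)) := by
    intro k
    induction k with
    | zero => intro _; simp [DB]
    | succ n ih =>
      intro hn
      have hlt : n < qB := hn
      have hxn := (h.iterate_strictMono n).monotone h1
      have hyn := (h.iterate_strictMono n).monotone h3
      have hxy := (h.iterate_strictMono n).monotone h2
      rw [h.iterate, zero_add] at hxn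
      rw [h.iterate] at hyn
      have hnc : ∀ m : ℤ, c + m ∉ Ioo (F^[n] x) (F^[n] y) := by
        intro m hm
        rw [← h.zero, ← h.add_int, zero_add] at hm
        have b1 := h.mono'.lt_iff_lt.1 (hxn.trans_lt hm.1)
        have b2 := h.mono'.lt_iff_lt.1 (hm.2.trans_le hyn)
        have := s.not_mem_long (k := -(n : ℤ)) (m := -m) (by omega) (by omega)
          (by push_cast; linarith)
        push_cast at this
        linarith
      have hd := hDB _ _ hxy hnc
      rw [Function.iterate_succ', Finset.sum_range_succ, mul_add, Real.exp_add,
        mul_comm (Real.exp _) (Real.exp _)]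
      refine DB.comp (h.iterate_differentiable n x) (h.iterate_differentiable n y)
        (h.differentiable _) (h.differentiable _) (h.deriv_nonneg _) (h.deriv_nonneg _)
        (Real.exp_pos _).le (ih hlt.le) (hd.mono (Real.exp_le_exp.2 ?_))
      have hle := him n hlt.le
      have : (F^[n] y - F^[n] x) ^ 2 ≤ (C₁ * E n / e * (y - x)) ^ 2 :=
        pow_le_pow_left₀ (sub_nonneg.2 hxy) hle 2
      calc C₂ * (F^[n] y - F^[n] x) ^ 2 ≤ C₂ * (C₁ * E n / e * (y - x)) ^ 2 := by gcongr
        _ = _ := by ring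
  refine (step k hk).mono (Real.exp_le_exp.2 ?_)
  have hsq : ∑ i ∈ Finset.range k, E i ^ 2 ≤ w := by
    have hw0 : 0 ≤ w := (hE0 0).trans (hw _)
    calc _ ≤ ∑ i ∈ Finset.range qB, E i ^ 2 :=
          Finset.sum_le_sum_of_subset_of_nonneg (by simpa using hk) fun i _ _ => sq_nonneg _
      _ ≤ ∑ i ∈ Finset.range qB, w * E i := by
        refine Finset.sum_le_sum fun i _ => ?_
        rw [sq]; exact mul_le_mul_of_nonneg_right (hw _) (hE0 i)
      _ = w * ∑ i ∈ Finset.range qB, E i := by rw [Finset.mul_sum]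
      _ ≤ w := mul_le_of_le_one_right hw0 hsum
  calc _ ≤ C₂ * C₁ ^ 2 * ((y - x) / e) ^ 2 * w := by gcongr
    _ = _ := by ring

end Coord

/-- Difference of reciprocal increments of `b` at `p`. -/
def recipGap (b : ℝ → ℝ) (p x : ℝ) : ℝ := 1 / (b x - b p) - 1 / (x - p)

theorem recipGap_eq {b : ℝ → ℝ} (hb : StrictMono b) {p x : ℝ} (hx : x ≠ p) :
    recipGap b p x * ((x - p) * (b x - b p)) = (x - p) - (b x - b p) := by
  have h1 : b x - b p ≠ 0 := sub_ne_zero.2 (hb.injective.ne hx)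
  have h2 : x - p ≠ 0 := sub_ne_zero.2 hx
  unfold recipGap
  field_simp

theorem hasDerivAt_recipGap {b : ℝ → ℝ} (hb : StrictMono b) (hd : Differentiable ℝ b) {p x : ℝ}
    (hx : x ≠ p) :
    HasDerivAt (recipGap b p) (1 / (x - p) ^ 2 - deriv b x / (b x - b p) ^ 2) x := by
  have h1 : b x - b p ≠ 0 := sub_ne_zero.2 (hb.injective.ne hx)
  have h2 : x - p ≠ 0 := sub_ne_zero.2 hx
  have e1 := (((hd x).hasDerivAt.sub_const (b p)).inv h1)
  have e2 := (((hasDerivAt_id x).sub_const p).inv h2)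
  have := e1.sub e2
  refine (this.congr_deriv ?_).congr_of_eventuallyEq ?_
  · simp only [id]; field_simp; ring
  · filter_upwards with y
    simp [recipGap, one_div]

theorem tendsto_recipGap {b : ℝ → ℝ} (hb : StrictMono b) (hd : ContDiff ℝ 2 b) {p : ℝ}
    (hp : deriv b p = 1) :
    Tendsto (recipGap b p) (𝓝[≠] p) (𝓝 (-(deriv (deriv b) p) / 2)) := by
  have hdf : Differentiable ℝ b := hd.differentiable (by norm_num)
  have hdd : Differentiable ℝ (deriv b) :=
    (((contDiff_succ_iff_deriv (n := 1)).1 hd).2.2).differentiable (by norm_num)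
  have hslope : Tendsto (fun x => (b x - b p) / (x - p)) (𝓝[≠] p) (𝓝 1) := by
    have := (hdf p).hasDerivAt.tendsto_slope
    rw [hp] at this
    refine this.congr fun x => ?_
    rw [slope_def_field]
  have hl : Tendsto (fun x => ((x - p) - (b x - b p)) / (x - p) ^ 2) (𝓝[≠] p)
      (𝓝 (-(deriv (deriv b) p) / 2)) := by
    refine HasDerivAt.lhopital_zero_nhdsNE (f' := fun x => 1 - deriv b x)
      (g' := fun x => 2 * (x - p)) ?_ ?_ ?_ ?_ ?_ ?_
    · filter_upwards with x
      exact ((hasDerivAt_id x).sub_const p).sub ((hdf x).hasDerivAt.sub_const (b p))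
    · filter_upwards with x
      have := ((hasDerivAt_id x).sub_const p).pow 2
      refine this.congr_deriv ?_
      simp
    · filter_upwards [self_mem_nhdsWithin] with x hx
      exact mul_ne_zero two_ne_zero (sub_ne_zero.2 hx)
    · have : ContinuousAt (fun x => (x - p) - (b x - b p)) p :=
        ((continuous_id.sub continuous_const).sub (hdf.continuous.sub continuous_const)).continuousAt
      have h2 := this.tendsto
      simp only [sub_self] at h2
      exact h2.mono_left nhdsWithin_le_nhds
    · have : ContinuousAt (fun x => (x - p) ^ 2) p := by fun_prop
      have h2 := this.tendsto
      simp only [sub_self] at h2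
      rw [zero_pow two_ne_zero] at h2
      exact h2.mono_left nhdsWithin_le_nhds
    · have := (hdd p).hasDerivAt.tendsto_slope
      have h2 := (this.neg).div_const 2
      refine h2.congr' ?_
      filter_upwards [self_mem_nhdsWithin] with x hx
      have : x - p ≠ 0 := sub_ne_zero.2 hx
      rw [slope_def_field, hp]
      field_simp; ring
  have := hl.div hslope one_ne_zero
  rw [div_one] at this
  refine this.congr' ?_
  filter_upwards [self_mem_nhdsWithin] with x hx
  have h1 : b x - b p ≠ 0 := sub_ne_zero.2 (hb.injective.ne hx)
  have h2 : x - p ≠ 0 := sub_ne_zero.2 hx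
  simp only [Pi.div_apply, recipGap]
  field_simp

theorem recipGap_slope_aux {D r s ε : ℝ} (hr : r ≠ 0) (hs : s ≠ 0) (hr1 : r ^ 2 ≤ 1) (hε0 : 0 ≤ ε)
    (hε : ε ≤ 1) (h : D * r ^ 2 ≤ Real.exp (ε * r ^ 2) * s ^ 2) :
    0 ≤ 1 / r ^ 2 - D / s ^ 2 + 2 * ε := by
  have hr2 : 0 < r ^ 2 := by positivity
  have hs2 : 0 < s ^ 2 := by positivity
  have h1 : ε * r ^ 2 ≤ 1 := by nlinarith
  have h2 : Real.exp (ε * r ^ 2) ≤ 1 + 2 * (ε * r ^ 2) := by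
    have := Real.abs_exp_sub_one_le (x := ε * r ^ 2) (by rw [abs_of_nonneg (by positivity)]; exact h1)
    rw [abs_of_nonneg (show (0:ℝ) ≤ ε * r ^ 2 by positivity)] at this
    linarith [le_abs_self (Real.exp (ε * r ^ 2) - 1)]
  have h3 : D / s ^ 2 ≤ (1 + 2 * (ε * r ^ 2)) / r ^ 2 := by
    rw [div_le_div_iff₀ hs2 hr2]
    nlinarith
  have h4 : (1 + 2 * (ε * r ^ 2)) / r ^ 2 = 1 / r ^ 2 + 2 * ε := by field_simp
  linarith

theorem recipGap_bounds {b : ℝ → ℝ} (hb : StrictMono b) (hd : ContDiff ℝ 2 b) {p ε : ℝ}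
    (hp : deriv b p = 1) (hp0 : 0 < p) (hp1 : p < 1) (hε0 : 0 ≤ ε) (hε : ε ≤ 1)
    (hDB : ∀ x y, 0 ≤ x → x ≤ y → y ≤ 1 → DB b x y (Real.exp (ε * (y - x) ^ 2)))
    {x : ℝ} (hx0 : 0 ≤ x) (hx1 : x ≤ 1) (hx : x ≠ p) :
    recipGap b p 0 - 4 * ε ≤ recipGap b p x ∧ recipGap b p x ≤ recipGap b p 1 + 4 * ε := by
  classical
  have hdf : Differentiable ℝ b := hd.differentiable (by norm_num)
  set μ := -(deriv (deriv b) p) / 2 with hμ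
  set g : ℝ → ℝ := fun x => Function.update (recipGap b p) p μ x + 2 * ε * x with hg
  have hcont : Continuous g := by
    refine Continuous.add ?_ (by fun_prop)
    rw [continuous_iff_continuousAt]
    intro y
    by_cases hy : y = p
    · subst hy
      exact continuousAt_update_same.2 (tendsto_recipGap hb hd hp)
    · refine (continuousAt_update_of_ne hy).2 (hasDerivAt_recipGap hb hdf hy).continuousAt
  have hder : ∀ y, y ≠ p → HasDerivAt g
      (1 / (y - p) ^ 2 - deriv b y / (b y - b p) ^ 2 + 2 * ε) y := by
    intro y hy
    have e1 : HasDerivAt (Function.update (recipGap b p) p μ)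
        (1 / (y - p) ^ 2 - deriv b y / (b y - b p) ^ 2) y := by
      refine (hasDerivAt_recipGap hb hdf hy).congr_of_eventuallyEq ?_
      filter_upwards [isOpen_ne.mem_nhds hy] with z hz
      exact Function.update_of_ne hz _ _
    have e2 := ((hasDerivAt_id y).const_mul (2 * ε))
    rw [mul_one] at e2
    exact e1.add e2
  have hnn : ∀ y, 0 ≤ y → y ≤ 1 → y ≠ p →
      0 ≤ 1 / (y - p) ^ 2 - deriv b y / (b y - b p) ^ 2 + 2 * ε := by
    intro y hy0 hy1 hy
    refine recipGap_slope_aux (sub_ne_zero.2 hy) (sub_ne_zero.2 (hb.injective.ne hy)) ?_ hε0 hε ?_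
    · nlinarith
    · rcases lt_or_gt_of_ne hy with hlt | hgt
      · have := hDB y p hy0 hlt.le hp1.le
        unfold DB at this
        rw [hp] at this
        rw [show (y - p) ^ 2 = (p - y) ^ 2 by ring, show (b y - b p) ^ 2 = (b p - b y) ^ 2 by ring]
        linarith
      · have := hDB p y hp0.le hgt.le hy1
        unfold DB at this
        rw [hp] at this
        linarith
  have hmono : ∀ s t, 0 ≤ s → t ≤ 1 → p ∉ Ioo s t → MonotoneOn g (Icc s t) := by
    intro s t hs ht hst
    refine monotoneOn_of_deriv_nonneg (convex_Icc _ _) hcont.continuousOn ?_ ?_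
    · rw [interior_Icc]
      intro y hy
      exact (hder y (fun h => hst (h ▸ hy))).differentiableAt.differentiableWithinAt
    · rw [interior_Icc]
      intro y hy
      have hyp : y ≠ p := fun h => hst (h ▸ hy)
      rw [(hder y hyp).deriv]
      exact hnn y (by linarith [hy.1]) (by linarith [hy.2]) hyp
  have hm : ∀ s t, 0 ≤ s → s ≤ t → t ≤ 1 → g s ≤ g t := by
    intro s t hs hst ht
    by_cases h : p ∈ Ioo s t
    · have h1 := hmono s p hs hp1.le (fun h => lt_irrefl _ h.2) (left_mem_Icc.2 h.1.le)
        (right_mem_Icc.2 h.1.le) h.1.le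
      have h2 := hmono p t hp0.le ht (fun h => lt_irrefl _ h.1) (left_mem_Icc.2 h.2.le)
        (right_mem_Icc.2 h.2.le) h.2.le
      exact h1.trans h2
    · exact hmono s t hs ht h (left_mem_Icc.2 hst) (right_mem_Icc.2 hst) hst
  have hgv : ∀ y, y ≠ p → g y = recipGap b p y + 2 * ε * y := by
    intro y hy
    simp only [hg, Function.update_of_ne hy]
  have h0 := hm 0 x le_rfl hx0 hx1
  have h1 := hm x 1 hx0 hx1 le_rfl
  rw [hgv x hx, hgv 0 hp0.ne] at h0
  rw [hgv x hx, hgv 1 hp1.ne'] at h1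
  constructor <;> nlinarith

theorem quad_aux {N r s ν : ℝ} (hν : 0 < ν) (hν1 : ν ≤ 1) (hN0 : ν / 6 ≤ N) (hN1 : N ≤ 2 / ν)
    (h : N * (r * s) = r - s) (hr1 : r ^ 2 ≤ 1) (hrs : 0 < r * s) (hdv : r - s ≤ 1 / ν) :
    ν / 7 * r ^ 2 ≤ r - s ∧ r - s ≤ 16 / ν ^ 3 * r ^ 2 := by
  have hN : 0 < N := by have : 0 < ν / 6 := by positivity
                        linarith
  have hd0 : 0 < r - s := by rw [← h]; positivity
  rcases lt_trichotomy r 0 with hr | hr | hr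
  · have hs : s < 0 := by nlinarith
    have hrm : -1 ≤ r := by nlinarith
    constructor
    · have : r ^ 2 ≤ r * s := by nlinarith
      have h2 : ν / 6 * r ^ 2 ≤ N * (r * s) := by
        apply mul_le_mul hN0 this (sq_nonneg r) hN.le
      have h3 : ν / 7 * r ^ 2 ≤ ν / 6 * r ^ 2 := by
        apply mul_le_mul_of_nonneg_right _ (sq_nonneg r); linarith
      linarith
    · by_cases hc : ν / 4 ≤ -r
      · have h1 : ν ^ 2 / 16 ≤ r ^ 2 := by nlinarith
        have : 16 / ν ^ 3 * (ν ^ 2 / 16) = 1 / ν := by field_simp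
        have h2 : 16 / ν ^ 3 * (ν ^ 2 / 16) ≤ 16 / ν ^ 3 * r ^ 2 := by gcongr
        linarith
      · push Not at hc
        have h1 : N * (-r) ≤ 1 / 2 := by
          calc N * (-r) ≤ 2 / ν * (ν / 4) := mul_le_mul hN1 hc.le (by linarith) (by positivity)
            _ = 1 / 2 := by field_simp; norm_num
        have h2 : r - s = N * r ^ 2 + (N * (-r)) * (r - s) := by rw [← h]; linear_combination (N*r) * h
        have h3 : r - s ≤ 2 * N * r ^ 2 := by nlinarith
        have h4 : 2 * N ≤ 16 / ν ^ 3 := by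
          have : 2 * (2 / ν) ≤ 16 / ν ^ 3 := by
            rw [show 2 * (2 / ν) = 4 / ν by ring, div_le_div_iff₀ hν (by positivity)]
            nlinarith [mul_pos hν hν]
          linarith
        have := mul_le_mul_of_nonneg_right h4 (sq_nonneg r)
        linarith
  · rw [hr] at hrs; simp at hrs
  · have hs : 0 < s := by nlinarith
    have hrm : r ≤ 1 := by nlinarith
    constructor
    · have e : (r - s) * (1 + N * r) = N * r ^ 2 := by linear_combination (-1:ℝ) * h
      have h0 : ν * (N * r) ≤ 1 * (N * 1) :=
        mul_le_mul hν1 (mul_le_mul_of_nonneg_left hrm hN.le) (by positivity) zero_le_one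
      have h1 : ν / 7 * (1 + N * r) ≤ N := by linarith
      have h2 : ν / 7 * r ^ 2 * (1 + N * r) ≤ (r - s) * (1 + N * r) := by
        rw [e]; nlinarith [sq_nonneg r]
      exact le_of_mul_le_mul_right h2 (by positivity)
    · have h1 : r * s ≤ r ^ 2 := by nlinarith
      have h2 : N * (r * s) ≤ 2 / ν * r ^ 2 := mul_le_mul hN1 h1 hrs.le (by positivity)
      have h3 : 2 / ν ≤ 16 / ν ^ 3 := by
        rw [div_le_div_iff₀ hν (by positivity)]
        nlinarith [mul_pos hν hν]
      have := mul_le_mul_of_nonneg_right h3 (sq_nonneg r)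
      linarith

/-- The return map of a saddle-node bridge, in the coordinate where the bridge is `[0,1]`. -/
structure Bridge (b : ℝ → ℝ) (ν ε : ℝ) (a : ℕ) : Prop where
  mono : StrictMono b
  smooth : ContDiff ℝ 2 b
  DB : ∀ x y, 0 ≤ x → x ≤ y → y ≤ 1 → DB b x y (Real.exp (ε * (y - x) ^ 2))
  lt : ∀ x, b x < x
  nu_pos : 0 < ν
  nu_le : ν ≤ 1
  eps_nonneg : 0 ≤ ε
  eps_le : ε ≤ ν / 24
  left : ν ≤ 0 - b 0
  right : ∀ x, x ≤ 1 → b (b 1) ≤ x → ν ≤ x - b x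
  bdd : ∀ x, 0 ≤ x → x ≤ 1 → x - b x ≤ 1 / ν
  next : ∀ x, 0 ≤ b x → x ≤ 1 → ν * (x - b x) ≤ b x - b (b x)
  prev : ∀ x, 0 ≤ b x → x ≤ 1 → ν * (b x - b (b x)) ≤ x - b x
  one_le : 1 ≤ a
  last : 0 ≤ b^[a] 1
  last_gap : ν ≤ b^[a] 1 - b (b^[a] 1)

namespace Bridge
variable {b : ℝ → ℝ} {ν ε : ℝ} {a : ℕ} (h : Bridge b ν ε a)
include h

theorem anti : StrictAnti (fun j => b^[j] 1) := by
  refine strictAnti_nat_of_succ_lt fun n => ?_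
  rw [Function.iterate_succ_apply']
  exact h.lt _

theorem mem {j : ℕ} (hj : j ≤ a) : 0 ≤ b^[j] 1 ∧ b^[j] 1 ≤ 1 := by
  refine ⟨h.last.trans (h.anti.antitone hj), ?_⟩
  have := h.anti.antitone (Nat.zero_le j)
  simpa using this

theorem quad {p : ℝ} (hp0 : 0 ≤ p) (hp1 : p ≤ 1) (hmin : ∀ x, 0 ≤ x → x ≤ 1 → p - b p ≤ x - b x)
    (hσ : p - b p < ν / 2) {x : ℝ} (hx0 : 0 ≤ x) (hx1 : x ≤ 1) :
    ν / 7 * (x - p) ^ 2 ≤ (x - b x) - (p - b p) ∧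
      (x - b x) - (p - b p) ≤ 16 / ν ^ 3 * (x - p) ^ 2 := by
  have hν := h.nu_pos
  have hν1 := h.nu_le
  have hd : Differentiable ℝ b := h.smooth.differentiable (by norm_num)
  have hp0' : 0 < p := by
    rcases hp0.eq_or_lt with rfl | h'
    · have := h.left; linarith
    · exact h'
  have hpb : p < b (b 1) := by
    by_contra hc
    have := h.right p hp1 (not_lt.1 hc); linarith
  have hb1 := h.lt 1
  have hbb1 := h.lt (b 1)
  have hp1' : p < 1 := by linarith
  have hder : deriv b p = 1 := by
    have hloc : IsLocalMin (fun x => x - b x) p := by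
      filter_upwards [Ioo_mem_nhds hp0' hp1'] with y hy
      exact hmin y hy.1.le hy.2.le
    have := hloc.hasDerivAt_eq_zero ((hasDerivAt_id p).sub (hd p).hasDerivAt)
    linarith
  by_cases hxp : x = p
  · subst hxp; simp
  have hbd := recipGap_bounds h.mono h.smooth hder hp0' hp1' h.eps_nonneg
    (by linarith [h.eps_le]) h.DB hx0 hx1 hxp
  have hb1p : ν ≤ b 1 - b p := by
    have := h.right (b 1) hb1.le hbb1.le
    have := h.lt p
    linarith
  have hN1 : recipGap b p 1 ≤ 1 / ν := by
    unfold recipGap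
    have h1 : 1 / (b 1 - b p) ≤ 1 / ν := one_div_le_one_div_of_le hν hb1p
    have h2 : 0 ≤ 1 / (1 - p) := by apply one_div_nonneg.2; linarith
    linarith
  have hN0 : ν / 3 ≤ recipGap b p 0 := by
    have e : recipGap b p 0 = 1 / p - 1 / (b p - b 0) := by
      unfold recipGap
      rw [zero_sub, ← neg_sub (b p) (b 0), one_div_neg_eq_neg_one_div, one_div_neg_eq_neg_one_div]
      ring
    have h1 : p + ν / 2 ≤ b p - b 0 := by linarith [h.left]
    have h2 : 1 / (b p - b 0) ≤ 1 / (p + ν / 2) := one_div_le_one_div_of_le (by positivity) h1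
    have h3 : ν / 3 ≤ 1 / p - 1 / (p + ν / 2) := by
      rw [div_sub_div _ _ hp0'.ne' (by positivity), le_div_iff₀ (by positivity)]
      have : p * (p + ν / 2) ≤ 3 / 2 := by nlinarith
      nlinarith
    linarith
  have hε := h.eps_le
  have hone : 1 ≤ 1 / ν := by rw [le_div_iff₀ hν]; linarith
  have hv := h.bdd x hx0 hx1
  have hσ0 : 0 < p - b p := sub_pos.2 (h.lt p)
  have := quad_aux (N := recipGap b p x) (r := x - p) (s := b x - b p) hν hν1 (by linarith)
    (by have : 2 / ν = 1 / ν + 1 / ν := by ring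
        linarith) (recipGap_eq h.mono hxp) (by nlinarith)
    (by
      rcases lt_or_gt_of_ne hxp with hlt | hgt
      · exact mul_pos_of_neg_of_neg (by linarith) (by linarith [h.mono hlt])
      · exact mul_pos (by linarith) (by linarith [h.mono hgt])) (by linarith)
  constructor <;> [have := this.1; have := this.2] <;> linarith

end Bridge

/-- The relative size of the `j`-th fundamental domain in a saddle-node bridge of length `a`. -/
def bridgeWeight (a j : ℕ) : ℝ := 1 / ((min (j + 1) (a - j) : ℕ) : ℝ) ^ 2

theorem bridgeWeight_pos {a j : ℕ} (hj : j < a) : 0 < bridgeWeight a j := by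
  have : 0 < min (j + 1) (a - j) := by omega
  unfold bridgeWeight; positivity

theorem bridgeWeight_le_one {a j : ℕ} (hj : j < a) : bridgeWeight a j ≤ 1 := by
  have h : 1 ≤ min (j + 1) (a - j) := by omega
  have h' : (1:ℝ) ≤ ((min (j + 1) (a - j) : ℕ) : ℝ) := by exact_mod_cast h
  unfold bridgeWeight
  rw [div_le_one (by positivity)]
  exact one_le_pow₀ h'

theorem recip_seq {z : ℕ → ℝ} {a : ℕ} {R : ℕ → Prop} {L e D : ℝ} (he : 0 < e) (heh : e ≤ 1 / 2)
    (hL : 0 ≤ L) (hD : 0 ≤ D)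
    (h0 : 1 / 2 ≤ z 0) (h0' : z 0 ≤ D) (ha : z a ≤ D) (hapos : 0 ≤ z a)
    (hR : ∀ j, R (j + 1) → R j) (hz1 : ∀ j < a, |z (j + 1) - z j| ≤ L)
    (hz2 : ∀ j < a, R (j + 1) → e ≤ z (j + 1) - z j)
    (hz3 : ∀ j < a, ¬ R j → e ≤ z j - z (j + 1)) {j : ℕ} (hj : j < a) :
    e * ((min (j + 1) (a - j) : ℕ) : ℝ) ≤ z j ∧
      z j ≤ (D + 2 * L + D) * ((min (j + 1) (a - j) : ℕ) : ℝ) := by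
  have up1 : ∀ i, i ≤ a → z i ≤ D + L * i := by
    intro i
    induction i with
    | zero => intro _; simpa using h0'
    | succ i ih =>
      intro hi
      have h1 := ih (by omega)
      have h2 := abs_le.1 (hz1 i (by omega))
      push_cast; linarith [h2.2]
  have up2 : ∀ k, k ≤ a → z (a - k) ≤ D + L * k := by
    intro k
    induction k with
    | zero => intro _; simpa using ha
    | succ k ih =>
      intro hk
      have h1 := ih (by omega)
      have h2 := abs_le.1 (hz1 (a - (k + 1)) (by omega))
      rw [show a - (k + 1) + 1 = a - k by omega] at h2
      push_cast; linarith [h2.1]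
  have lo1 : ∀ i, i ≤ a → R i → e * (i + 1) ≤ z i := by
    intro i
    induction i with
    | zero => intro _ _; push_cast; linarith
    | succ i ih =>
      intro hi hRi
      have h1 := ih (by omega) (hR i hRi)
      have h2 := hz2 i (by omega) hRi
      push_cast; linarith
  have lo2 : ∀ k, k ≤ a → ¬ R (a - k) → e * k ≤ z (a - k) := by
    intro k
    induction k with
    | zero => intro _ _; simpa using hapos
    | succ k ih =>
      intro hk hRk
      have h2 := hz3 (a - (k + 1)) (by omega) hRk
      rw [show a - (k + 1) + 1 = a - k by omega] at h2
      have h1 := ih (by omega) (fun hh => hRk (hR _ (by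
        rw [show a - (k + 1) + 1 = a - k by omega]; exact hh)))
      push_cast; linarith
  have u1 := up1 j hj.le
  have u2 := up2 (a - j) (by omega)
  have l2 := lo2 (a - j) (by omega)
  rw [show a - (a - j) = j by omega] at u2 l2
  have l1 := lo1 j hj.le
  have hj1 : (1:ℝ) ≤ ((a - j : ℕ) : ℝ) := by
    have : 1 ≤ a - j := by omega
    exact_mod_cast this
  constructor
  · by_cases hRj : R j
    · refine le_trans ?_ (l1 hRj)
      have : ((min (j + 1) (a - j) : ℕ) : ℝ) ≤ ((j + 1 : ℕ) : ℝ) := by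
        exact_mod_cast min_le_left _ _
      push_cast at this ⊢
      exact mul_le_mul_of_nonneg_left this he.le
    · refine le_trans ?_ (l2 hRj)
      have : ((min (j + 1) (a - j) : ℕ) : ℝ) ≤ ((a - j : ℕ) : ℝ) := by
        exact_mod_cast min_le_right _ _
      exact mul_le_mul_of_nonneg_left this he.le
  · rcases le_total (j + 1) (a - j) with hc | hc
    · rw [min_eq_left hc]
      have : (0:ℝ) ≤ j := Nat.cast_nonneg j
      push_cast
      nlinarith
    · rw [min_eq_right hc]
      nlinarith

theorem recip_sub {y y' : ℝ} (hy : 0 < y) (hy' : 0 < y') : 1 / y' - 1 / y = (y - y') / (y * y') := by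
  field_simp

/-- Conversion of quadratic speed bounds into bounds for the reciprocals. -/
theorem quad_seq {l Y : ℕ → ℝ} {a : ℕ} {R : ℕ → Prop} {c C K η : ℝ} (hc : 0 < c) (hc1 : c ≤ 1 / 2)
    (hC : 0 ≤ C) (hK : 1 ≤ K) (hη : 0 < η)
    (hY : ∀ j ≤ a, 0 < Y j) (hY2 : Y 0 ≤ 2) (hl : ∀ j ≤ a, c * Y j ^ 2 ≤ l j ∧ l j ≤ C * Y j ^ 2)
    (habs : ∀ j < a, |Y (j + 1) - Y j| ≤ l j) (hK1 : ∀ j < a, Y j ≤ K * Y (j + 1))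
    (hK2 : ∀ j < a, Y (j + 1) ≤ K * Y j) (hR : ∀ j, R (j + 1) → R j)
    (hR1 : ∀ j < a, R (j + 1) → Y j - Y (j + 1) = l j)
    (hR2 : ∀ j < a, ¬ R j → Y (j + 1) - Y j = l j) (h0 : η ≤ Y 0) (ha : η ≤ Y a)
    {j : ℕ} (hj : j < a) :
    l j ≤ C / (c / K) ^ 2 * bridgeWeight a j ∧
      c / (1 / η + 2 * (C * K) + 1 / η) ^ 2 * bridgeWeight a j ≤ l j := by
  have hK0 : 0 < K := by linarith
  have he : 0 < c / K := by positivity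
  have heh : c / K ≤ c := div_le_self hc.le hK
  have hmul : ∀ i < a, 0 < Y i * Y (i + 1) := fun i hi => mul_pos (hY i hi.le) (hY (i + 1) hi)
  have key := recip_seq (z := fun i => 1 / Y i) (a := a) (R := R) (L := C * K) (e := c / K)
    (D := 1 / η) he (by linarith) (by positivity) (by positivity)
    (one_div_le_one_div_of_le (hY 0 (by omega)) hY2) (one_div_le_one_div_of_le hη h0)
    (one_div_le_one_div_of_le hη ha) (one_div_pos.2 (hY a le_rfl)).le hR
    (by
      intro i hi
      have y0 := hY i hi.le
      have y1 := hY (i + 1) hi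
      rw [recip_sub y0 y1, abs_div, abs_of_pos (hmul i hi), div_le_iff₀ (hmul i hi), abs_sub_comm]
      have h1 := (habs i hi).trans (hl i hi.le).2
      have h2 := mul_le_mul_of_nonneg_left (mul_le_mul_of_nonneg_left (hK1 i hi) y0.le) hC
      calc |Y (i + 1) - Y i| ≤ C * (Y i * Y i) := by rw [← sq]; exact h1
        _ ≤ C * (Y i * (K * Y (i + 1))) := h2
        _ = C * K * (Y i * Y (i + 1)) := by ring)
    (by
      intro i hi hRi
      have y0 := hY i hi.le
      have y1 := hY (i + 1) hi
      rw [recip_sub y0 y1, le_div_iff₀ (hmul i hi), hR1 i hi hRi]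
      have h3 := (hl i hi.le).1
      have h4 : Y (i + 1) ≤ Y i := by
        have := hR1 i hi hRi
        have : 0 ≤ c * Y i ^ 2 := by positivity
        linarith
      calc c / K * (Y i * Y (i + 1)) ≤ c * (Y i * Y i) :=
            mul_le_mul heh (mul_le_mul_of_nonneg_left h4 y0.le) (hmul i hi).le hc.le
        _ ≤ l i := by rw [← sq]; exact h3)
    (by
      intro i hi hRi
      have y0 := hY i hi.le
      have y1 := hY (i + 1) hi
      rw [recip_sub y1 y0, le_div_iff₀ (by rw [mul_comm]; exact hmul i hi), hR2 i hi hRi]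
      have h3 := (hl i hi.le).1
      have h5 := mul_le_mul_of_nonneg_left (mul_le_mul_of_nonneg_right (hK2 i hi) y0.le) he.le
      calc c / K * (Y (i + 1) * Y i) ≤ c / K * (K * Y i * Y i) := h5
        _ = c * Y i ^ 2 := by field_simp
        _ ≤ l i := h3) hj
  set m : ℝ := ((min (j + 1) (a - j) : ℕ) : ℝ) with hm
  have hm0 : 0 < m := by
    have : 0 < min (j + 1) (a - j) := by omega
    rw [hm]; exact_mod_cast this
  have yj := hY j hj.le
  have hw : bridgeWeight a j = 1 / m ^ 2 := rfl
  rw [hw]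
  obtain ⟨k1, k2⟩ := key
  set D := 1 / η + 2 * (C * K) + 1 / η with hD
  have hDpos : 0 < D := by
    have : 0 < 1 / η := by positivity
    have : 0 ≤ C * K := by positivity
    rw [hD]; linarith
  rw [le_div_iff₀ yj] at k1
  rw [div_le_iff₀ yj] at k2
  constructor
  · refine (hl j hj.le).2.trans ?_
    have : Y j ≤ 1 / (c / K * m) := by rw [le_div_iff₀ (by positivity)]; linarith
    calc C * Y j ^ 2 ≤ C * (1 / (c / K * m)) ^ 2 := by gcongr
      _ = _ := by field_simp
  · refine le_trans ?_ (hl j hj.le).1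
    have : 1 / (D * m) ≤ Y j := by rw [div_le_iff₀ (by positivity)]; linarith
    calc _ = c * (1 / (D * m)) ^ 2 := by field_simp
      _ ≤ c * Y j ^ 2 := by gcongr

theorem sqrt_quad_aux {r σ v c C : ℝ} (hσ : 0 ≤ σ) (hc0 : 0 ≤ c) (hc : c ≤ 1) (hC : 1 ≤ C)
    (h1 : c * r ^ 2 ≤ v - σ) (h2 : v - σ ≤ C * r ^ 2) :
    c / 2 * (|r| + √σ) ^ 2 ≤ v ∧ v ≤ C * (|r| + √σ) ^ 2 := by
  have hs : √σ ^ 2 = σ := Real.sq_sqrt hσ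
  have hr : |r| ^ 2 = r ^ 2 := sq_abs r
  have h0 : 0 ≤ √σ := Real.sqrt_nonneg σ
  have hr0 : 0 ≤ |r| := abs_nonneg r
  constructor
  · have : (|r| + √σ) ^ 2 ≤ 2 * (r ^ 2 + σ) := by
      nlinarith [sq_nonneg (|r| - √σ)]
    have h3 : c / 2 * (|r| + √σ) ^ 2 ≤ c / 2 * (2 * (r ^ 2 + σ)) := by gcongr
    nlinarith
  · have : r ^ 2 + σ ≤ (|r| + √σ) ^ 2 := by nlinarith [mul_nonneg hr0 h0]
    have h3 : C * (r ^ 2 + σ) ≤ C * (|r| + √σ) ^ 2 := by gcongr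
    nlinarith

theorem le_mul_of_sq_le {y y' c C ν v v' : ℝ} (hc : 0 < c) (hν : 0 < ν)
    (hy' : 0 ≤ y') (h1 : c * y ^ 2 ≤ v) (h2 : v' ≤ C * y' ^ 2) (h : ν * v ≤ v') (K : ℝ)
    (hK0 : 0 ≤ K) (hK : C / (c * ν) ≤ K ^ 2) : y ≤ K * y' := by
  refine abs_le_of_sq_le_sq' ?_ (by positivity) |>.2
  have h3 : ν * (c * y ^ 2) ≤ C * y' ^ 2 := by
    have := mul_le_mul_of_nonneg_left h1 hν.le
    linarith
  have h4 : y ^ 2 ≤ C / (c * ν) * y' ^ 2 := by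
    rw [div_mul_eq_mul_div, le_div_iff₀ (by positivity)]
    linarith
  have h5 := mul_le_mul_of_nonneg_right hK (sq_nonneg y')
  rw [mul_pow]; linarith

theorem Bridge.gap_of_large {b : ℝ → ℝ} {ν ε : ℝ} {a : ℕ} (h : Bridge b ν ε a)
    (hmin : ∀ x, 0 ≤ x → x ≤ 1 → ν / 2 ≤ x - b x) {j : ℕ} (hj : j < a) :
    b^[j] 1 - b^[j + 1] 1 ≤ 4 / ν ^ 3 * bridgeWeight a j ∧
      ν / 2 * bridgeWeight a j ≤ b^[j] 1 - b^[j + 1] 1 := by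
  have hν := h.nu_pos
  have hν1 := h.nu_le
  have hm := h.mem hj.le
  have hl := hmin _ hm.1 hm.2
  have hu := h.bdd _ hm.1 hm.2
  rw [Function.iterate_succ_apply']
  have hw0 := bridgeWeight_pos hj
  have hw1 := bridgeWeight_le_one hj
  have hsum : ∀ i, i ≤ a → b^[i] 1 ≤ 1 - i * (ν / 2) := by
    intro i
    induction i with
    | zero => intro _; simp
    | succ i ih =>
      intro hi
      have h1 := ih (by omega)
      have h2 := h.mem (show i ≤ a by omega)
      have h3 := hmin _ h2.1 h2.2
      rw [Function.iterate_succ_apply']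
      push_cast; linarith
  have ha : (a:ℝ) * (ν / 2) ≤ 1 := by linarith [hsum a le_rfl, h.last]
  have hm' : ((min (j + 1) (a - j) : ℕ) : ℝ) ≤ a := by
    have : min (j + 1) (a - j) ≤ a := by omega
    exact_mod_cast this
  have hmp : 0 < ((min (j + 1) (a - j) : ℕ) : ℝ) := by
    have : 0 < min (j + 1) (a - j) := by omega
    exact_mod_cast this
  have hw : ν ^ 2 / 4 ≤ bridgeWeight a j := by
    unfold bridgeWeight
    rw [le_div_iff₀ (by positivity)]
    have : ((min (j + 1) (a - j) : ℕ) : ℝ) * (ν / 2) ≤ 1 := by nlinarith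
    have h0 : 0 ≤ ((min (j + 1) (a - j) : ℕ) : ℝ) * (ν / 2) := by positivity
    nlinarith
  constructor
  · refine hu.trans ?_
    calc 1 / ν = 4 / ν ^ 3 * (ν ^ 2 / 4) := by field_simp
      _ ≤ _ := by gcongr
  · nlinarith

theorem Bridge.gap (ν : ℝ) (hν : 0 < ν) (hν1 : ν ≤ 1) : ∃ C : ℝ, 1 ≤ C ∧ ∀ {b : ℝ → ℝ} {ε : ℝ} {a : ℕ}, Bridge b ν ε a →
    ∀ j < a, b^[j] 1 - b^[j + 1] 1 ≤ C * bridgeWeight a j ∧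
      bridgeWeight a j ≤ C * (b^[j] 1 - b^[j + 1] 1) := by
  set c := ν / 7 / 2 with hc
  set C := 16 / ν ^ 3 with hC
  set K := 1 + C / (c * ν) with hK
  set η := ν / 16 * ν with hη
  have hc0 : 0 < c := by positivity
  have hC0 : 0 < C := by positivity
  have hC1 : 1 ≤ C := by
    rw [hC, le_div_iff₀ (by positivity)]
    have : ν ^ 3 ≤ 1 := pow_le_one₀ hν.le hν1
    linarith
  have hKpos : 0 < C / (c * ν) := by positivity
  have hK1 : 1 ≤ K := by rw [hK]; linarith
  have hKsq : C / (c * ν) ≤ K ^ 2 := by rw [hK]; nlinarith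
  set U := C / (c / K) ^ 2 with hU
  set V := c / (1 / η + 2 * (C * K) + 1 / η) ^ 2 with hV
  have hU0 : 0 < U := by positivity
  have hV0 : 0 < V := by positivity
  refine ⟨1 + U + 1 / V + 4 / ν ^ 3 + 2 / ν, ?_, ?_⟩
  · have : 0 < 1 / V := by positivity
    have : 0 < 4 / ν ^ 3 := by positivity
    have : 0 < 2 / ν := by positivity
    linarith
  intro b ε a h j hj
  have p1 : 0 < 1 / V := by positivity
  have p2 : 0 < 4 / ν ^ 3 := by positivity
  have p3 : 0 < 2 / ν := by positivity
  have hw0 := bridgeWeight_pos hj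
  have conv : ∀ {U' V' l : ℝ}, 0 < V' → U' ≤ 1 + U + 1 / V + 4 / ν ^ 3 + 2 / ν →
      1 / V' ≤ 1 + U + 1 / V + 4 / ν ^ 3 + 2 / ν → l ≤ U' * bridgeWeight a j →
      V' * bridgeWeight a j ≤ l → l ≤ (1 + U + 1 / V + 4 / ν ^ 3 + 2 / ν) * bridgeWeight a j ∧
        bridgeWeight a j ≤ (1 + U + 1 / V + 4 / ν ^ 3 + 2 / ν) * l := by
    intro U' V' l hV' hU1 hV1 h1 h2
    have hl : 0 ≤ l := le_trans (by positivity) h2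
    refine ⟨h1.trans (mul_le_mul_of_nonneg_right hU1 hw0.le), ?_⟩
    refine le_trans ?_ (mul_le_mul_of_nonneg_right hV1 hl)
    rw [one_div, ← div_eq_inv_mul, le_div_iff₀ hV']; linarith
  have hcb : Continuous b := h.smooth.continuous
  obtain ⟨p, hp, hmin⟩ := isCompact_Icc.exists_isMinOn (nonempty_Icc.2 (zero_le_one (α := ℝ)))
    (f := fun x => x - b x) (continuous_id.sub hcb).continuousOn
  have hmin' : ∀ x, 0 ≤ x → x ≤ 1 → p - b p ≤ x - b x := fun x h0 h1 => hmin ⟨h0, h1⟩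
  by_cases hσ : p - b p < ν / 2
  swap
  · push Not at hσ
    have := h.gap_of_large (fun x h0 h1 => hσ.trans (hmin' x h0 h1)) hj
    refine conv (by positivity) (by linarith) ?_ this.1 this.2
    rw [one_div_div]; linarith
  have hσ0 : 0 < p - b p := sub_pos.2 (h.lt p)
  set σ := p - b p with hσd
  have hs0 : 0 < √σ := Real.sqrt_pos.2 hσ0
  have hs1 : √σ ≤ 1 := Real.sqrt_le_one.2 (by linarith)
  set x : ℕ → ℝ := fun i => b^[i] 1 with hx
  have hxs : ∀ i, x (i + 1) = b (x i) := fun i => Function.iterate_succ_apply' _ _ _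
  have hxm : ∀ i ≤ a, 0 ≤ x i ∧ x i ≤ 1 := fun i hi => h.mem hi
  have hq : ∀ i ≤ a, c * (|x i - p| + √σ) ^ 2 ≤ x i - x (i + 1) ∧
      x i - x (i + 1) ≤ C * (|x i - p| + √σ) ^ 2 := by
    intro i hi
    have := h.quad hp.1 hp.2 hmin' hσ (hxm i hi).1 (hxm i hi).2
    rw [hxs]
    exact sqrt_quad_aux hσ0.le (by positivity) (by linarith) hC1 this.1 this.2
  have hxlt : ∀ i, x (i + 1) < x i := fun i => by rw [hxs]; exact h.lt _
  have hpos : ∀ i, 0 < |x i - p| + √σ := fun i => by positivity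
  have hηY : ∀ i ≤ a, ν ≤ x i - x (i + 1) → η ≤ |x i - p| + √σ := by
    intro i hi hv
    have h1 := (hq i hi).2
    have h2 : ν ≤ C * (|x i - p| + √σ) ^ 2 := hv.trans h1
    rw [hC, div_mul_eq_mul_div, le_div_iff₀ (by positivity)] at h2
    have h3 : η ^ 2 ≤ (|x i - p| + √σ) ^ 2 := by
      have : η ^ 2 = ν ^ 4 / 256 := by rw [hη]; ring
      nlinarith [pow_pos hν 4]
    exact (abs_le_of_sq_le_sq' h3 (hpos i).le).2
  have := quad_seq (l := fun i => x i - x (i + 1)) (Y := fun i => |x i - p| + √σ) (a := a)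
    (R := fun i => p ≤ x i) (c := c) (C := C) (K := K) (η := η) hc0 (by rw [hc]; linarith) hC0.le hK1
    (by positivity) (fun i _ => hpos i) (by
      have : |x 0 - p| ≤ 1 := by
        rw [show x 0 = 1 from rfl, abs_of_nonneg (by linarith [hp.2])]; linarith [hp.1]
      linarith) hq
    (by
      intro i hi
      have : |x (i + 1) - p| + √σ - (|x i - p| + √σ) = |x (i + 1) - p| - |x i - p| := by ring
      rw [this]
      refine (abs_abs_sub_abs_le_abs_sub _ _).trans ?_
      rw [show x (i + 1) - p - (x i - p) = -(x i - x (i + 1)) by ring, abs_neg,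
        abs_of_pos (by linarith [hxlt i])])
    (by
      intro i hi
      refine le_mul_of_sq_le hc0 hν (hpos _).le (hq i hi.le).1 (hq (i + 1) hi).2 ?_ K (by linarith) hKsq
      have := h.next (x i) (by rw [← hxs]; exact (hxm (i + 1) hi).1) (hxm i hi.le).2
      rw [hxs (i + 1), hxs i]; exact this)
    (by
      intro i hi
      refine le_mul_of_sq_le hc0 hν (hpos _).le (hq (i + 1) hi).1 (hq i hi.le).2 ?_ K (by linarith) hKsq
      have := h.prev (x i) (by rw [← hxs]; exact (hxm (i + 1) hi).1) (hxm i hi.le).2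
      rw [hxs (i + 1), hxs i]; exact this)
    (fun i hi => hi.trans (hxlt i).le)
    (by
      intro i hi hR
      have hR : p ≤ x (i + 1) := hR
      rw [abs_of_nonneg (by linarith [hxlt i]), abs_of_nonneg (by linarith)]; ring)
    (by
      intro i hi hR
      have hR : x i < p := not_le.1 hR
      rw [abs_of_neg (by linarith [hxlt i]), abs_of_neg (by linarith)]; ring)
    (hηY 0 (by omega) (by
      have := h.right 1 le_rfl ((h.lt _).trans (h.lt _)).le
      simpa [hx] using this))
    (hηY a le_rfl (by rw [hxs]; exact h.last_gap)) hj
  exact conv hV0 (by linarith) (by linarith) this.1 this.2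

namespace Coord
variable {F : ℝ → ℝ} {c d ρ : ℝ} {X : ℝ → ℝ} (h : Coord F c d ρ X)
include h

theorem rb_crit_right : ∃ C : ℝ, 1 ≤ C ∧ ∀ {qA qB : ℕ} {pA pB : ℤ},
    RState ρ qA pA qB pB → ∀ i : ℕ, i < qB →
      X (i * ρ + (qA * ρ - pA)) - X (i * ρ) ≤
        C * (X (i * ρ + (qA * ρ - pA)) - X (i * ρ + (qA * ρ - pA) - (pB - qB * ρ))) := by
  obtain ⟨C₁, hC₁, hrb⟩ := h.rb_long'
  obtain ⟨C₂, hC₂, hcr⟩ := h.rb_crit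
  refine ⟨C₁ * C₂, one_le_mul_of_one_le_of_one_le hC₁ hC₂, fun {qA qB pA pB} s i hi => ?_⟩
  have h1 := (hrb s (i * ρ + (qA * ρ - pA))).2
  have h2 := hcr s (i + qA) (by omega)
  rw [show i * ρ + (qA * ρ - pA) - (qA * ρ - pA) = i * ρ by ring] at h1
  have e1 := h.add_int (((i + qA : ℕ) : ℝ) * ρ + (qA * ρ - pA)) (-pA)
  have e2 := h.add_int (((i + qA : ℕ) : ℝ) * ρ) (-pA)
  have e3 := h.add_int (((i + qA : ℕ) : ℝ) * ρ - (pB - qB * ρ)) (-pA)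
  rw [show ((i + qA : ℕ) : ℝ) * ρ + (qA * ρ - pA) + ((-pA : ℤ) : ℝ) =
    i * ρ + (qA * ρ - pA) + (qA * ρ - pA) by push_cast; ring] at e1
  rw [show ((i + qA : ℕ) : ℝ) * ρ + ((-pA : ℤ) : ℝ) = i * ρ + (qA * ρ - pA) by push_cast; ring] at e2
  rw [show ((i + qA : ℕ) : ℝ) * ρ - (pB - qB * ρ) + ((-pA : ℤ) : ℝ) =
    i * ρ + (qA * ρ - pA) - (pB - qB * ρ) by push_cast; ring] at e3
  rw [mul_assoc]
  refine h1.trans (mul_le_mul_of_nonneg_left ?_ (by linarith))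
  rw [e1, e2, e3]
  linarith

theorem short_near : ∃ C : ℝ, 1 ≤ C ∧ ∀ {qA qB : ℕ} {pA pB : ℤ},
    RState ρ qA pA qB pB → ∀ t u, |t - u| ≤ pB - qB * ρ →
      X u - X (u - (pB - qB * ρ)) ≤ C * (X t - X (t - (pB - qB * ρ))) := by
  obtain ⟨C, hC, hrb⟩ := h.rb_short'
  refine ⟨1 + C, by linarith, fun {qA qB pA pB} s t u htu => ?_⟩
  have hβ := s.pos
  set β := pB - qB * ρ
  obtain ⟨h1, h2⟩ := abs_le.1 htu
  rcases le_total t u with hle | hle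
  · have m1 := h.mono'.monotone (show u ≤ t + β by linarith)
    have m2 := h.mono'.monotone (show t - β ≤ u - β by linarith)
    have := (hrb s t).1
    linarith
  · have m1 := h.mono'.monotone hle
    have m2 := h.mono'.monotone (show t - β - β ≤ u - β by linarith)
    have := (hrb s (t - β)).2
    rw [sub_add_cancel] at this
    linarith

theorem iterate_contDiff (k : ℕ) : ContDiff ℝ 3 F^[k] := by
  induction k with
  | zero => exact contDiff_id
  | succ n ih => rw [Function.iterate_succ]; exact ih.comp h.smooth

set_option maxHeartbeats 1000000 in
/-- The normalised return map on the fundamental interval. -/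
theorem exists_bridge : ∃ ν : ℝ, 0 < ν ∧ ν ≤ 1 ∧ ∃ w₀ : ℝ, 0 < w₀ ∧ ∀ {qA qB : ℕ} {pA pB : ℤ},
    RState ρ qA pA qB pB → (∀ t, X (t + (qA * ρ - pA)) - X t ≤ w₀) → ∀ a : ℕ, 1 ≤ a →
    0 < qA * ρ - pA - a * (pB - qB * ρ) → qA * ρ - pA - a * (pB - qB * ρ) < pB - qB * ρ →
    ∃ (b : ℝ → ℝ) (ε : ℝ), Bridge b ν ε a ∧ ∀ j : ℕ, b^[j] 1 =
      (X (qA * ρ - pA - j * (pB - qB * ρ)) - X 0) / (X (qA * ρ - pA) - X 0) := by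
  obtain ⟨C₁, hC₁, hcr⟩ := h.rb_crit
  obtain ⟨C₂, hC₂, hcr'⟩ := h.rb_crit_right
  obtain ⟨C₃, hC₃, hnear⟩ := h.short_near
  obtain ⟨C₄, hC₄, hlong⟩ := h.rb_long'
  obtain ⟨C₅, hC₅, hshort⟩ := h.rb_short'
  obtain ⟨C₆, hC₆, hDB⟩ := h.DB_sharp
  set K := C₁ * C₂ * C₃ ^ 2 * (1 + C₄) * C₅ with hK
  have k3 : 1 ≤ C₃ ^ 2 := one_le_pow₀ hC₃
  have h33 : C₃ ≤ C₃ ^ 2 := by nlinarith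
  have g1 : 1 ≤ C₁ * C₂ * C₃ ^ 2 := one_le_mul_of_one_le_of_one_le
    (one_le_mul_of_one_le_of_one_le hC₁ hC₂) k3
  have g2 : 1 ≤ (1 + C₄) * C₅ := one_le_mul_of_one_le_of_one_le (by linarith) hC₅
  have hK1 : 1 ≤ K := by
    rw [hK, mul_assoc (C₁ * C₂ * C₃ ^ 2)]; exact one_le_mul_of_one_le_of_one_le g1 g2
  have hK23 : C₂ * C₃ ^ 2 ≤ K := by
    have : K = (C₂ * C₃ ^ 2) * (C₁ * ((1 + C₄) * C₅)) := by rw [hK]; ring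
    rw [this]
    exact le_mul_of_one_le_right (by positivity) (one_le_mul_of_one_le_of_one_le hC₁ g2)
  have hK13 : C₁ * C₃ ≤ K := by
    have : K = (C₁ * C₃ ^ 2) * (C₂ * ((1 + C₄) * C₅)) := by rw [hK]; ring
    rw [this]
    calc C₁ * C₃ ≤ C₁ * C₃ ^ 2 := by gcongr
      _ ≤ _ := le_mul_of_one_le_right (by positivity) (one_le_mul_of_one_le_of_one_le hC₂ g2)
  have hKC1 : C₁ ≤ K := le_trans (le_mul_of_one_le_right (by linarith) hC₃) hK13
  have hK4 : 1 + C₄ ≤ K := by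
    have : K = (1 + C₄) * (C₁ * C₂ * C₃ ^ 2 * C₅) := by rw [hK]; ring
    rw [this]
    exact le_mul_of_one_le_right (by positivity) (one_le_mul_of_one_le_of_one_le g1 hC₅)
  have hK5 : C₅ ≤ K := by
    have : K = C₅ * (C₁ * C₂ * C₃ ^ 2 * (1 + C₄)) := by rw [hK]; ring
    rw [this]
    exact le_mul_of_one_le_right (by positivity) (one_le_mul_of_one_le_of_one_le g1 (by linarith))
  have hK0 : 0 < K := by linarith
  refine ⟨1 / K, by positivity, by rw [div_le_one hK0]; exact hK1, 1 / K / 24 / (C₆ + 1),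
    by positivity, fun {qA qB pA pB} s hw a ha ha1 ha2 => ?_⟩
  have hβ := s.pos
  have hβα := s.lt
  have hs1 := s.one_le
  have hs2 := s.le
  have hDB := hDB s _ hw qB le_rfl
  have hn0 := hcr s 0 (by omega)
  have hnr := hcr' s 0 (by omega)
  have hnear := hnear s
  have hlong := hlong s
  have hshort := hshort s
  simp only [Nat.cast_zero, zero_mul, zero_add, zero_sub] at hn0 hnr
  set α := qA * ρ - pA with hα
  have hB : ∀ t, F^[qB] (X t) - pB = X (t - (pB - qB * ρ)) := by
    intro t
    have := h.add_int (t + qB * ρ) (-pB)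
    rw [h.iterate]
    rw [show t + qB * ρ + ((-pB : ℤ) : ℝ) = t - (pB - qB * ρ) by push_cast; ring] at this
    rw [this]; push_cast; ring
  set β := pB - qB * ρ with hβd
  set e := X α - X 0 with he
  have he0 : 0 < e := sub_pos.2 (h.mono' (by linarith))
  set b : ℝ → ℝ := fun u => (F^[qB] (X 0 + e * u) - pB - X 0) / e with hb
  have hbX : ∀ t, b ((X t - X 0) / e) = (X (t - β) - X 0) / e := by
    intro t
    simp only [hb]
    rw [mul_div_cancel₀ _ he0.ne', add_sub_cancel, hB]
  have hrep : ∀ u, ∃ t, u = (X t - X 0) / e := by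
    intro u
    obtain ⟨t, ht⟩ := h.surjective' (X 0 + e * u)
    refine ⟨t, ?_⟩
    rw [ht]; field_simp; ring
  have hle : ∀ t t', (X t - X 0) / e ≤ (X t' - X 0) / e ↔ t ≤ t' := by
    intro t t'
    rw [div_le_div_iff_of_pos_right he0, sub_le_sub_iff_right, h.mono'.le_iff_le]
  have hone : (1 : ℝ) = (X α - X 0) / e := (div_self he0.ne').symm
  have hzero : (0 : ℝ) = (X 0 - X 0) / e := by simp
  have hle0 : ∀ t, 0 ≤ (X t - X 0) / e ↔ 0 ≤ t := by
    intro t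
    rw [← hle 0 t, sub_self, zero_div]
  have hbm : StrictMono b := by
    intro u v huv
    simp only [hb]
    have := h.iterate_strictMono qB (show X 0 + e * u < X 0 + e * v by
      have := mul_lt_mul_of_pos_left huv he0; linarith)
    apply div_lt_div_of_pos_right _ he0; linarith
  have hgap : ∀ t t' : ℝ, (X t - X 0) / e - (X t' - X 0) / e = (X t - X t') / e := by
    intro t t'; ring
  have hC30 : 0 ≤ C₃ := by linarith
  have hC20 : 0 ≤ C₂ := by linarith
  have hend : ∀ t, t ≤ α → α - β - β ≤ t → e ≤ K * (X t - X (t - β)) := by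
    intro t h1 h2
    have hm0 : 0 ≤ X t - X (t - β) := (sub_pos.2 (h.mono' (by linarith))).le
    have : ∃ t', |t - t'| ≤ β ∧ |t' - α| ≤ β := by
      rcases le_total t (α - β) with h3 | h3
      · exact ⟨α - β, by rw [abs_le]; constructor <;> linarith, by rw [abs_le]; constructor <;> linarith⟩
      · exact ⟨α, by rw [abs_le]; constructor <;> linarith, by rw [abs_le]; constructor <;> linarith⟩
    obtain ⟨t', e1, e2⟩ := this
    have f1 := hnear t t' e1
    have f2 := hnear t' α e2
    calc e ≤ C₂ * (X α - X (α - β)) := hnr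
      _ ≤ C₂ * (C₃ * (C₃ * (X t - X (t - β)))) := by gcongr; exact f2.trans (by gcongr)
      _ = C₂ * C₃ ^ 2 * (X t - X (t - β)) := by ring
      _ ≤ _ := by gcongr
  have tonu : ∀ y, e ≤ K * y → 1 / K ≤ y / e := by
    intro y hy
    rw [div_le_div_iff₀ hK0 he0]; linarith
  have hiter : ∀ j : ℕ, b^[j] 1 = (X (α - j * β) - X 0) / e := by
    intro j
    induction j with
    | zero => simpa using hone
    | succ j ih =>
      rw [Function.iterate_succ_apply', ih, hbX]
      congr 3; push_cast; ring
  refine ⟨b, C₆ * (1 / K / 24 / (C₆ + 1)), ⟨hbm, ?_, ?_, ?_, by positivity, ?_, by positivity, ?_, ?_, ?_, ?_,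
    ?_, ?_, ha, ?_, ?_⟩, hiter⟩
  · have := (h.iterate_contDiff qB).of_le (show (2:WithTop ℕ∞) ≤ 3 by norm_num)
    simp only [hb]
    fun_prop
  · intro u v hu huv hv
    have hder : ∀ u, deriv b u = deriv F^[qB] (X 0 + e * u) := by
      intro u
      have h1 : HasDerivAt (fun u => X 0 + e * u) e u := by
        simpa using ((hasDerivAt_id u).const_mul e).const_add (X 0)
      have h2 := ((h.iterate_differentiable qB) (X 0 + e * u)).hasDerivAt
      have h3 := (((HasDerivAt.comp u h2 h1).sub_const (pB : ℝ)).sub_const (X 0)).div_const e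
      rw [mul_div_assoc, div_self he0.ne', mul_one] at h3
      exact h3.deriv
    have := hDB (X 0 + e * u) (X 0 + e * v) (by nlinarith) (by nlinarith) (by
      have : e * v ≤ e * 1 := mul_le_mul_of_nonneg_left hv he0.le
      linarith)
    unfold DB at this ⊢
    rw [hder, hder]
    rw [show X 0 + e * v - (X 0 + e * u) = e * (v - u) by ring,
      mul_div_cancel_left₀ _ he0.ne'] at this
    have e1 : b v - b u = (F^[qB] (X 0 + e * v) - F^[qB] (X 0 + e * u)) / e := by
      simp only [hb]; ring
    rw [e1, div_pow, ← mul_div_assoc, le_div_iff₀ (by positivity)]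
    linarith
  · intro u
    obtain ⟨t, rfl⟩ := hrep u
    rw [hbX, ← not_le, hle]; linarith
  · rw [div_le_one hK0]; exact hK1
  · rw [← mul_div_assoc, div_le_iff₀ (by positivity)]
    have : 0 < 1 / K / 24 := by positivity
    nlinarith
  · conv_rhs => rw [hzero]
    rw [hbX, hgap]
    apply tonu
    have : 0 ≤ X 0 - X (0 - β) := (sub_pos.2 (h.mono' (by linarith))).le
    rw [zero_sub] at this ⊢
    calc e ≤ C₁ * (X 0 - X (-β)) := hn0
      _ ≤ _ := by gcongr
  · intro u hu1 hu2
    obtain ⟨t, rfl⟩ := hrep u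
    rw [hone, hle] at hu1
    rw [hone, hbX, hbX, hle] at hu2
    rw [hbX, hgap]
    exact tonu _ (hend t hu1 hu2)
  · intro u hu1 hu2
    obtain ⟨t, rfl⟩ := hrep u
    rw [hone, hle] at hu2
    rw [hle0] at hu1
    rw [hbX, hgap, one_div_one_div, div_le_iff₀ he0]
    have m1 := h.mono'.monotone hu2
    have m2 := h.mono'.monotone (show 0 - α ≤ t - β by linarith)
    have m3 := (hlong 0).2
    rw [zero_add] at m3
    calc X t - X (t - β) ≤ (1 + C₄) * e := by rw [he]; linarith
      _ ≤ _ := by gcongr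
  · intro u hu1 hu2
    obtain ⟨t, rfl⟩ := hrep u
    rw [hbX, hbX, hgap, hgap, ← mul_div_assoc]
    apply div_le_div_of_nonneg_right _ he0.le
    have := (hshort (t - β)).1
    rw [sub_add_cancel] at this
    have m0 : 0 ≤ X (t - β) - X (t - β - β) := (sub_pos.2 (h.mono' (by linarith))).le
    rw [one_div, ← div_eq_inv_mul, div_le_iff₀ hK0, mul_comm]
    exact this.trans (by gcongr)
  · intro u hu1 hu2
    obtain ⟨t, rfl⟩ := hrep u
    rw [hbX, hbX, hgap, hgap, ← mul_div_assoc]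
    apply div_le_div_of_nonneg_right _ he0.le
    have := (hshort (t - β)).2
    rw [sub_add_cancel] at this
    have m0 : 0 ≤ X t - X (t - β) := (sub_pos.2 (h.mono' (by linarith))).le
    rw [one_div, ← div_eq_inv_mul, div_le_iff₀ hK0, mul_comm]
    exact this.trans (by gcongr)
  · rw [hiter, hle0]; exact ha1.le
  · rw [hiter, hbX, hgap]
    apply tonu
    have f1 := hnear (α - a * β) 0 (by rw [sub_zero, abs_of_pos ha1]; exact ha2.le)
    have m0 : 0 ≤ X (α - a * β) - X (α - a * β - β) := (sub_pos.2 (h.mono' (by linarith))).le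
    rw [zero_sub] at f1
    calc e ≤ C₁ * (X 0 - X (-β)) := hn0
      _ ≤ C₁ * (C₃ * (X (α - a * β) - X (α - a * β - β))) := by gcongr
      _ = C₁ * C₃ * (X (α - a * β) - X (α - a * β - β)) := by ring
      _ ≤ _ := by gcongr

end Coord

theorem RState.next_bounds {ρ : ℝ} {qA qB a : ℕ} {pA pB : ℤ}
    (s' : RState (-ρ) qB (-pB) (qA + a * qB) (-(pA + a * pB))) :
    0 < qA * ρ - pA - a * (pB - qB * ρ) ∧ qA * ρ - pA - a * (pB - qB * ρ) < pB - qB * ρ := by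
  have h1 := s'.pos
  have h2 := s'.lt
  push_cast at h1 h2
  constructor <;> linarith

theorem exp_le_one_add_two_mul {z : ℝ} (h0 : 0 ≤ z) (h1 : z ≤ 1) : Real.exp z ≤ 1 + 2 * z := by
  have := Real.abs_exp_sub_one_le (x := z) (by rwa [abs_of_nonneg h0])
  rw [abs_of_nonneg h0] at this
  linarith [le_abs_self (Real.exp z - 1)]

theorem Irrational.exists_dist_pos {ρ : ℝ} (hρ : Irrational ρ) (Q : ℕ) : ∃ δ : ℝ, 0 < δ ∧
    ∀ q : ℕ, 1 ≤ q → q ≤ Q → ∀ m : ℤ, δ ≤ |q * ρ - m| := by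
  induction Q with
  | zero => exact ⟨1, one_pos, fun q h1 h2 => by omega⟩
  | succ Q ih =>
    obtain ⟨δ, hδ, h⟩ := ih
    have hne : ((Q + 1 : ℕ) : ℝ) * ρ - round (((Q + 1 : ℕ) : ℝ) * ρ) ≠ 0 := by
      have := hρ.mul_add_int_ne (k := ((Q + 1 : ℕ) : ℤ)) (m := -round (((Q + 1 : ℕ) : ℝ) * ρ))
        (by omega)
      push_cast at this ⊢
      rwa [sub_eq_add_neg]
    refine ⟨min δ |((Q + 1 : ℕ) : ℝ) * ρ - round (((Q + 1 : ℕ) : ℝ) * ρ)|,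
      lt_min hδ (abs_pos.2 hne), fun q h1 h2 m => ?_⟩
    rcases Nat.lt_or_ge q (Q + 1) with h3 | h3
    · exact (min_le_left _ _).trans (h q h1 (by omega) m)
    · obtain rfl : q = Q + 1 := by omega
      exact (min_le_right _ _).trans (round_le _ _)

theorem neg_log_Cr_le_of_sharp {G : ℝ → ℝ} (hG : Differentiable ℝ G) (hm : StrictMono G)
    {a b c d e ε : ℝ} (h1 : a < b) (h2 : b < c) (h3 : c < d) (he : e = d - a) (hε0 : 0 ≤ ε)
    (hε : ε ≤ 1)
    (hDB : ∀ x y, a ≤ x → x ≤ y → y ≤ d → DB G x y (Real.exp (ε * ((y - x) / e) ^ 2))) :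
    Real.exp (-2) * Cr a b c d ≤ Cr (G a) (G b) (G c) (G d) := by
  have he0 : 0 < e := by rw [he]; linarith
  have key := neg_log_Cr_le hG hm (B := 1) (κ := 2 * ε / e ^ 2) h1 h2 h3 (by
    intro x hx y hy
    have hxy : x < y := by linarith [hx.2, hy.1]
    have n1 : 0 < G y - G x := sub_pos.2 (hm hxy)
    have n2 : 0 < y - x := by linarith
    have hd := hDB x y hx.1 hxy.le hy.2
    unfold DB at hd
    have hq : ((y - x) / e) ^ 2 ≤ 1 := by
      apply pow_le_one₀ (by positivity)
      rw [div_le_one he0, he]; linarith [hx.1, hy.2]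
    have hz := exp_le_one_add_two_mul (z := ε * ((y - x) / e) ^ 2) (by positivity) (by nlinarith)
    rw [div_le_iff₀ (by positivity)]
    have h4 : deriv G x * deriv G y * (y - x) ^ 2 ≤
        (1 + 2 * (ε * ((y - x) / e) ^ 2)) * (G y - G x) ^ 2 :=
      hd.trans (mul_le_mul_of_nonneg_right hz (sq_nonneg _))
    have h5 : deriv G x * deriv G y ≤
        (1 + 2 * (ε * ((y - x) / e) ^ 2)) * (G y - G x) ^ 2 / (y - x) ^ 2 := by
      rwa [le_div_iff₀ (by positivity)]
    refine h5.trans (le_of_eq ?_)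
    field_simp)
  have hκ : 2 * ε / e ^ 2 * ((b - a) * (d - c)) ≤ 2 := by
    have : (b - a) * (d - c) ≤ e * e :=
      mul_le_mul (by rw [he]; linarith) (by rw [he]; linarith) (by linarith) he0.le
    calc 2 * ε / e ^ 2 * ((b - a) * (d - c)) ≤ 2 * ε / e ^ 2 * (e * e) := by gcongr
      _ = 2 * ε := by field_simp
      _ ≤ 2 := by linarith
  have c1 := Cr_pos h1 h2 h3
  have c2 := Cr_pos (hm h1) (hm h2) (hm h3)
  rw [← Real.log_le_log_iff (by positivity) c2, Real.log_mul (by positivity) c1.ne', Real.log_exp]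
  linarith

theorem gap_le_of_Cr_aux {a' b' c' d' E K w Cr₀ : ℝ} (hab : a' < b') (hbc : b' < c') (hcd : c' < d')
    (hE : E = d' - a') (hK : 0 < K) (h1 : E ≤ K * (c' - a')) (h2 : E ≤ K * (d' - b'))
    (h : Real.exp (-2) * Cr₀ ≤ Cr a' b' c' d') (hw : w ≤ K * Cr₀) :
    w * E ≤ Real.exp 2 * K ^ 3 * (c' - b') := by
  have hE0 : 0 < E := by rw [hE]; linarith
  have p1 : 0 < c' - a' := by linarith
  have p2 : 0 < d' - b' := by linarith
  have h3 : E * E ≤ K ^ 2 * ((c' - a') * (d' - b')) := by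
    calc E * E ≤ (K * (c' - a')) * (K * (d' - b')) := mul_le_mul h1 h2 hE0.le (by positivity)
      _ = _ := by ring
  have h4 : Cr₀ ≤ Real.exp 2 * Cr a' b' c' d' := by
    have := mul_le_mul_of_nonneg_left h (Real.exp_pos 2).le
    rw [← mul_assoc, ← Real.exp_add] at this
    simpa using this
  have h5 : Cr a' b' c' d' * (E * E) ≤ K ^ 2 * ((c' - b') * E) := by
    have e1 : Cr a' b' c' d' * ((c' - a') * (d' - b')) = (c' - b') * E := by
      unfold Cr; rw [hE]; field_simp
    have := mul_le_mul_of_nonneg_left h3 (Cr_pos hab hbc hcd).le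
    calc _ ≤ _ := this
      _ = K ^ 2 * (Cr a' b' c' d' * ((c' - a') * (d' - b'))) := by ring
      _ = _ := by rw [e1]
  have h6 : w * (E * E) ≤ (Real.exp 2 * K ^ 3 * (c' - b')) * E := by
    calc w * (E * E) ≤ (K * (Real.exp 2 * Cr a' b' c' d')) * (E * E) := by
          apply mul_le_mul_of_nonneg_right _ (by positivity)
          exact hw.trans (mul_le_mul_of_nonneg_left h4 hK.le)
      _ = K * Real.exp 2 * (Cr a' b' c' d' * (E * E)) := by ring
      _ ≤ K * Real.exp 2 * (K ^ 2 * ((c' - b') * E)) := by gcongr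
      _ = _ := by ring
  exact le_of_mul_le_mul_right (by linarith) hE0

namespace Coord
variable {F : ℝ → ℝ} {c d ρ : ℝ} {X : ℝ → ℝ} (h : Coord F c d ρ X)
include h

theorem fract_shift (t u : ℝ) : X (t + u) - X t = X (Int.fract t + u) - X (Int.fract t) := by
  have e1 := h.add_int (Int.fract t + u) ⌊t⌋
  have e2 := h.add_int (Int.fract t) ⌊t⌋
  rw [show Int.fract t + u + (⌊t⌋ : ℝ) = t + u by linarith [Int.fract_add_floor t]] at e1
  rw [Int.fract_add_floor t] at e2
  rw [e1, e2]; ring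

theorem exists_uniform {w : ℝ} (hw : 0 < w) : ∃ δ : ℝ, 0 < δ ∧ ∀ u, u < δ → ∀ t,
    X (t + u) - X t ≤ w := by
  have huc := (isCompact_Icc (a := (0:ℝ)) (b := 2)).uniformContinuousOn_of_continuous h.cont'.continuousOn
  rw [Metric.uniformContinuousOn_iff] at huc
  obtain ⟨δ, hδ, hd⟩ := huc w hw
  refine ⟨min δ 1, lt_min hδ one_pos, fun u hu t => ?_⟩
  rcases le_or_gt u 0 with h0 | h0
  · have := h.mono'.monotone (show t + u ≤ t by linarith)
    linarith
  rw [h.fract_shift]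
  have f0 := Int.fract_nonneg t
  have f1 := Int.fract_lt_one t
  have u1 : u < 1 := hu.trans_le (min_le_right _ _)
  have := hd (Int.fract t + u) ⟨by linarith, by linarith⟩ (Int.fract t) ⟨f0, by linarith⟩ (by
    rw [Real.dist_eq, add_sub_cancel_left, abs_of_pos h0]
    exact hu.trans_le (min_le_left _ _))
  rw [Real.dist_eq] at this
  exact (le_abs_self _).trans this.le

theorem exists_lower {u : ℝ} (hu : 0 < u) : ∃ δ : ℝ, 0 < δ ∧ ∀ v, u ≤ v → ∀ t, δ ≤ X (t + v) - X t := by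
  obtain ⟨p, hp, hmin⟩ := (isCompact_Icc (a := (0:ℝ)) (b := 1)).exists_isMinOn
    (nonempty_Icc.2 zero_le_one) (f := fun t => X (t + u) - X t)
    ((h.cont'.comp (continuous_id.add continuous_const)).sub h.cont').continuousOn
  refine ⟨X (p + u) - X p, sub_pos.2 (h.mono' (by linarith)), fun v hv t => ?_⟩
  have h1 : X (p + u) - X p ≤ X (t + u) - X t := by
    rw [h.fract_shift t]
    exact hmin ⟨Int.fract_nonneg t, (Int.fract_lt_one t).le⟩
  have := h.mono'.monotone (show t + u ≤ t + v by linarith)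
  linarith

/-- Bounded levels: all fundamental domains are comparable. -/
theorem bridge_gap_of_large {α₀ : ℝ} (hα₀ : 0 < α₀) : ∃ C : ℝ, 1 ≤ C ∧ ∀ {qA qB a : ℕ} {pA pB : ℤ},
    RState ρ qA pA qB pB → 0 < qA * ρ - pA - a * (pB - qB * ρ) → α₀ ≤ qA * ρ - pA →
    ∀ j < a, ∀ t,
      X (t + (qA * ρ - pA) - j * (pB - qB * ρ)) - X (t + (qA * ρ - pA) - (j + 1) * (pB - qB * ρ)) ≤
        C * (bridgeWeight a j * (X (t + (qA * ρ - pA)) - X t)) ∧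
      bridgeWeight a j * (X (t + (qA * ρ - pA)) - X t) ≤
        C * (X (t + (qA * ρ - pA) - j * (pB - qB * ρ)) -
          X (t + (qA * ρ - pA) - (j + 1) * (pB - qB * ρ))) := by
  obtain ⟨β₀, hβ₀, hdist⟩ := h.irr.exists_dist_pos ⌈1 / α₀⌉₊
  obtain ⟨δ, hδ, hlow⟩ := h.exists_lower hβ₀
  refine ⟨1 + 1 / (δ * β₀ ^ 2) + 1 / δ, ?_, fun {qA qB a pA pB} s ha hα j hj t => ?_⟩
  · have : 0 < 1 / (δ * β₀ ^ 2) := by positivity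
    have : 0 < 1 / δ := by positivity
    linarith
  have hβ := s.pos
  have hdet := s.det_real
  have hle := s.alpha_le_one
  have hlt := s.lt
  have hqA : (1:ℝ) ≤ qA := by exact_mod_cast s.one_le
  have hβ₀β : β₀ ≤ pB - qB * ρ := by
    have hq : (qB : ℝ) ≤ 1 / α₀ := by
      rw [le_div_iff₀ hα₀]
      have : (0:ℝ) ≤ qB := by positivity
      nlinarith
    have := hdist qB (s.one_le.trans s.le) (by exact_mod_cast hq.trans (Nat.le_ceil _)) pB
    rwa [abs_sub_comm, abs_of_pos hβ] at this
  set α := qA * ρ - pA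
  set β := pB - qB * ρ
  set m : ℝ := ((min (j + 1) (a - j) : ℕ) : ℝ) with hm
  have hw0 := bridgeWeight_pos hj
  have hw1 := bridgeWeight_le_one hj
  have hm0 : 0 < m := by
    have : 0 < min (j + 1) (a - j) := by omega
    rw [hm]; exact_mod_cast this
  have hma : m ≤ a := by
    have : min (j + 1) (a - j) ≤ a := by omega
    rw [hm]; exact_mod_cast this
  have hw : β₀ ^ 2 ≤ bridgeWeight a j := by
    change _ ≤ 1 / m ^ 2
    rw [le_div_iff₀ (by positivity), ← mul_pow]
    apply pow_le_one₀ (by positivity)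
    calc β₀ * m ≤ β * a := mul_le_mul hβ₀β hma hm0.le hβ.le
      _ ≤ 1 := by linarith
  have hE : δ ≤ X (t + α) - X t := hlow α (by linarith) t
  have hE1 : X (t + α) - X t ≤ 1 := by
    have := h.mono'.monotone (show t + α ≤ t + 1 by linarith)
    rw [h.per'] at this; linarith
  have hl : δ ≤ X (t + α - j * β) - X (t + α - (j + 1) * β) := by
    have := hlow β hβ₀β (t + α - (j + 1) * β)
    rwa [show t + α - (j + 1) * β + β = t + α - j * β by ring] at this
  have hl1 : X (t + α - j * β) - X (t + α - (j + 1) * β) ≤ 1 := by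
    have := h.mono'.monotone (show t + α - j * β ≤ t + α - (j + 1) * β + 1 by linarith)
    rw [h.per'] at this; linarith
  set l := X (t + α - j * β) - X (t + α - (j + 1) * β)
  set E := X (t + α) - X t
  have q1 : 0 < 1 / (δ * β₀ ^ 2) := by positivity
  have q2 : 0 < 1 / δ := by positivity
  constructor
  · have : β₀ ^ 2 * δ ≤ bridgeWeight a j * E := mul_le_mul hw hE hδ.le hw0.le
    calc l ≤ 1 := hl1
      _ = 1 / (δ * β₀ ^ 2) * (β₀ ^ 2 * δ) := by field_simp
      _ ≤ (1 + 1 / (δ * β₀ ^ 2) + 1 / δ) * (bridgeWeight a j * E) :=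
        mul_le_mul (by linarith) this (by positivity) (by linarith)
  · calc bridgeWeight a j * E ≤ 1 * 1 := mul_le_mul hw1 hE1 (by linarith) (by norm_num)
      _ = 1 / δ * δ := by field_simp
      _ ≤ (1 + 1 / (δ * β₀ ^ 2) + 1 / δ) * l := mul_le_mul (by linarith) hl hδ.le (by linarith)

end Coord

namespace Coord
variable {F : ℝ → ℝ} {c d ρ : ℝ} {X : ℝ → ℝ} (h : Coord F c d ρ X)
include h

theorem bridge_gap_zero : ∃ C : ℝ, 1 ≤ C ∧ ∃ w₀ : ℝ, 0 < w₀ ∧ ∀ {qA qB a : ℕ} {pA pB : ℤ},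
    RState ρ qA pA qB pB → (∀ t, X (t + (qA * ρ - pA)) - X t ≤ w₀) → 1 ≤ a →
    0 < qA * ρ - pA - a * (pB - qB * ρ) → qA * ρ - pA - a * (pB - qB * ρ) < pB - qB * ρ →
    ∀ j < a,
      X (qA * ρ - pA - j * (pB - qB * ρ)) - X (qA * ρ - pA - (j + 1) * (pB - qB * ρ)) ≤
        C * (bridgeWeight a j * (X (qA * ρ - pA) - X 0)) ∧
      bridgeWeight a j * (X (qA * ρ - pA) - X 0) ≤
        C * (X (qA * ρ - pA - j * (pB - qB * ρ)) - X (qA * ρ - pA - (j + 1) * (pB - qB * ρ))) := by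
  obtain ⟨ν, hν, hν1, w₀, hw₀, hbr⟩ := h.exists_bridge
  obtain ⟨C, hC, hgap⟩ := Bridge.gap ν hν hν1
  refine ⟨C, hC, w₀, hw₀, fun {qA qB a pA pB} s hw ha h1 h2 j hj => ?_⟩
  obtain ⟨b, ε, hb, hbi⟩ := hbr s hw a ha h1 h2
  have he : 0 < X (qA * ρ - pA) - X 0 := sub_pos.2 (h.mono' (s.pos.trans s.lt))
  have := hgap hb j hj
  rw [hbi, hbi, ← sub_div, sub_sub_sub_cancel_right] at this
  push_cast at this
  obtain ⟨g1, g2⟩ := this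
  rw [div_le_iff₀ he] at g1
  rw [← mul_div_assoc, le_div_iff₀ he] at g2
  exact ⟨by linarith, by linarith⟩

theorem bridge_gap_small : ∃ C : ℝ, 1 ≤ C ∧ ∃ w₀ : ℝ, 0 < w₀ ∧ ∀ {qA qB a : ℕ} {pA pB : ℤ},
    RState ρ qA pA qB pB → (∀ t, X (t + (qA * ρ - pA)) - X t ≤ w₀) → 1 ≤ a →
    0 < qA * ρ - pA - a * (pB - qB * ρ) → qA * ρ - pA - a * (pB - qB * ρ) < pB - qB * ρ →
    ∀ j < a, ∀ i : ℕ, i < qB →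
      X (i * ρ + (qA * ρ - pA) - j * (pB - qB * ρ)) -
          X (i * ρ + (qA * ρ - pA) - (j + 1) * (pB - qB * ρ)) ≤
        C * (bridgeWeight a j * (X (i * ρ + (qA * ρ - pA)) - X (i * ρ))) ∧
      bridgeWeight a j * (X (i * ρ + (qA * ρ - pA)) - X (i * ρ)) ≤
        C * (X (i * ρ + (qA * ρ - pA) - j * (pB - qB * ρ)) -
          X (i * ρ + (qA * ρ - pA) - (j + 1) * (pB - qB * ρ))) := by
  obtain ⟨C₁, hC₁, w₀, hw₀, hz⟩ := h.bridge_gap_zero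
  obtain ⟨C₂, hC₂, him⟩ := h.image_le
  obtain ⟨C₃, hC₃, hDB⟩ := h.DB_sharp
  obtain ⟨C₄, hC₄, hcr'⟩ := h.rb_crit_right
  obtain ⟨C₅, hC₅, hcr⟩ := h.rb_crit
  obtain ⟨C₆, hC₆, hshort⟩ := h.rb_short'
  set K := C₁ * C₂ * C₄ * (C₅ * C₆) with hK
  have hC56 : 1 ≤ C₅ * C₆ := one_le_mul_of_one_le_of_one_le hC₅ hC₆
  have hC12 : 1 ≤ C₁ * C₂ := one_le_mul_of_one_le_of_one_le hC₁ hC₂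
  have hC124 : 1 ≤ C₁ * C₂ * C₄ := one_le_mul_of_one_le_of_one_le hC12 hC₄
  have hK1 : 1 ≤ K := one_le_mul_of_one_le_of_one_le hC124 hC56
  have k56 : C₅ * C₆ ≤ K := le_mul_of_one_le_left (by positivity) hC124
  have k124 : C₁ * C₂ * C₄ ≤ K := le_mul_of_one_le_right (by positivity) hC56
  have k12 : C₁ * C₂ ≤ K := (le_mul_of_one_le_right (by positivity) hC₄).trans k124
  have k1 : C₁ ≤ K := (le_mul_of_one_le_right (by positivity) hC₂).trans k12
  have k4 : C₄ ≤ K := (le_mul_of_one_le_left (by positivity) hC12).trans k124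
  have hK0 : 0 < K := by linarith
  have hexp : 1 ≤ Real.exp 2 := Real.one_le_exp (by norm_num)
  set L := Real.exp 2 * K ^ 3 with hL
  have hKL : K ≤ L := by
    have h1 : K ≤ K ^ 3 := le_self_pow₀ hK1 (by norm_num)
    exact h1.trans (le_mul_of_one_le_left (by positivity) hexp)
  refine ⟨L, hK1.trans hKL, min w₀ (1 / (C₃ + 1)), lt_min hw₀ (by positivity),
    fun {qA qB a pA pB} s hw ha h1 h2 j hj i hi => ?_⟩
  have hα := s.pos.trans s.lt
  have hβ := s.pos
  have hβα := s.lt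
  have hz := hz s (fun t => (hw t).trans (min_le_left _ _)) ha h1 h2 j hj
  have him := him s i hi.le
  have hDB := hDB s _ (fun t => (hw t).trans (min_le_right _ _)) i hi.le
  have hcr' := hcr' s i hi
  have hcr := hcr s i (by omega)
  have hshort := (hshort s (i * ρ)).2
  have hw0 := bridgeWeight_pos hj
  have hw1 := bridgeWeight_le_one hj
  have hja : ((j:ℝ) + 1) * (pB - qB * ρ) ≤ a * (pB - qB * ρ) := by
    apply mul_le_mul_of_nonneg_right _ hβ.le
    exact_mod_cast hj
  set α := qA * ρ - pA
  set β := pB - qB * ρ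
  have he : 0 < X α - X 0 := sub_pos.2 (h.mono' hα)
  have hE : 0 < X (i * ρ + α) - X (i * ρ) := sub_pos.2 (h.mono' (by linarith))
  have hit : ∀ t, F^[i] (X t) = X (i * ρ + t) := fun t => by rw [h.iterate, add_comm]
  have ea : ∀ y, i * ρ + (α - y) = i * ρ + α - y := fun y => by ring
  have hlt1 : 0 < α - (j + 1) * β := by linarith
  have hlt2 : α - (j + 1) * β < α - j * β := by linarith
  constructor
  · have g1 := him (X (α - (j + 1) * β)) (X (α - j * β)) (h.mono'.monotone hlt1.le)
      (h.mono'.monotone hlt2.le) (h.mono'.monotone (by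
        have : 0 ≤ j * β := by positivity
        linarith))
    rw [hit, hit, ea (j * β), ea ((j + 1) * β)] at g1
    refine g1.trans ?_
    set E := X (i * ρ + α) - X (i * ρ)
    calc C₂ * E / (X α - X 0) * (X (α - j * β) - X (α - (j + 1) * β))
        ≤ C₂ * E / (X α - X 0) * (C₁ * (bridgeWeight a j * (X α - X 0))) := by
          gcongr; exact hz.1
      _ = C₁ * C₂ * (bridgeWeight a j * E) := by field_simp
      _ ≤ L * (bridgeWeight a j * E) := by
          apply mul_le_mul_of_nonneg_right (k12.trans hKL) (by positivity)
  · rcases Nat.eq_zero_or_pos j with rfl | hj0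
    · simp only [Nat.cast_zero, zero_mul, sub_zero, zero_add, one_mul] at hcr' ⊢
      have hd0 : 0 ≤ X (i * ρ + α) - X (i * ρ + α - β) := (sub_pos.2 (h.mono' (by linarith))).le
      calc bridgeWeight a 0 * (X (i * ρ + α) - X (i * ρ)) ≤ 1 * (X (i * ρ + α) - X (i * ρ)) := by
            gcongr
        _ ≤ C₄ * (X (i * ρ + α) - X (i * ρ + α - β)) := by rw [one_mul]; exact hcr'
        _ ≤ _ := by gcongr; exact k4.trans hKL
    · have hj1 : (1:ℝ) ≤ j := by exact_mod_cast hj0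
      have hjβ : β ≤ j * β := le_mul_of_one_le_left hβ.le hj1
      have hsh := neg_log_Cr_le_of_sharp (h.iterate_differentiable i) (h.iterate_strictMono i)
        (a := X 0) (b := X (α - (j + 1) * β)) (c := X (α - j * β)) (d := X α)
        (h.mono' hlt1) (h.mono' hlt2) (h.mono' (by linarith)) rfl
        (show 0 ≤ C₃ * (1 / (C₃ + 1)) by positivity)
        (by rw [mul_one_div, div_le_one (by positivity)]; linarith) hDB
      rw [hit, hit, hit, hit, add_zero, ea (j * β), ea ((j + 1) * β)] at hsh
      have p1 : 0 < X (α - j * β) - X 0 := sub_pos.2 (h.mono' (by linarith))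
      have p2 : 0 < X α - X (α - (j + 1) * β) := sub_pos.2 (h.mono' (by linarith))
      have p3 : 0 < X (α - j * β) - X (α - (j + 1) * β) := sub_pos.2 (h.mono' (by linarith))
      refine gap_le_of_Cr_aux (a' := X (i * ρ)) (d' := X (i * ρ + α)) (h.mono' (by linarith))
        (h.mono' (by linarith)) (h.mono' (by linarith)) rfl hK0 ?_ ?_ hsh ?_
      · have m1 := h.mono'.monotone (show i * ρ + β ≤ i * ρ + α - j * β by linarith)
        have m2 : 0 ≤ X (i * ρ + β) - X (i * ρ) := (sub_pos.2 (h.mono' (by linarith))).le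
        calc _ ≤ C₅ * (X (i * ρ) - X (i * ρ - β)) := hcr
          _ ≤ C₅ * (C₆ * (X (i * ρ + β) - X (i * ρ))) := by gcongr
          _ = C₅ * C₆ * (X (i * ρ + β) - X (i * ρ)) := by ring
          _ ≤ K * (X (i * ρ + β) - X (i * ρ)) := by gcongr
          _ ≤ _ := by gcongr
      · have m1 := h.mono'.monotone (show i * ρ + α - (j + 1) * β ≤ i * ρ + α - β by linarith)
        have m2 : 0 ≤ X (i * ρ + α) - X (i * ρ + α - β) := (sub_pos.2 (h.mono' (by linarith))).le
        calc _ ≤ C₄ * (X (i * ρ + α) - X (i * ρ + α - β)) := hcr'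
          _ ≤ K * (X (i * ρ + α) - X (i * ρ + α - β)) := by gcongr
          _ ≤ _ := by gcongr
      · have q1 : bridgeWeight a j ≤ C₁ * ((X (α - j * β) - X (α - (j + 1) * β)) / (X α - X 0)) := by
          rw [← mul_div_assoc, le_div_iff₀ he]; exact hz.2
        have q2 : (X (α - j * β) - X (α - (j + 1) * β)) / (X α - X 0) ≤
            Cr (X 0) (X (α - (j + 1) * β)) (X (α - j * β)) (X α) := by
          unfold Cr
          rw [div_le_div_iff₀ he (by positivity), mul_assoc]
          apply mul_le_mul_of_nonneg_left _ p3.le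
          have m1 := h.mono'.monotone (show α - j * β ≤ α by linarith)
          have m2 := h.mono'.monotone hlt1.le
          apply mul_le_mul <;> linarith
        calc _ ≤ _ := q1
          _ ≤ K * Cr (X 0) (X (α - (j + 1) * β)) (X (α - j * β)) (X α) := by gcongr

/-- Geometry of saddle-node bridges: the position of the points of the next dynamical partition
inside a long interval, up to bounded factors. -/
theorem bridge_gap : ∃ C : ℝ, 1 ≤ C ∧ ∀ {qA qB a : ℕ} {pA pB : ℤ},
    RState ρ qA pA qB pB → RState (-ρ) qB (-pB) (qA + a * qB) (-(pA + a * pB)) →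
    ∀ j < a, ∀ i : ℕ, i < qB →
      X (i * ρ + (qA * ρ - pA) - j * (pB - qB * ρ)) -
          X (i * ρ + (qA * ρ - pA) - (j + 1) * (pB - qB * ρ)) ≤
        C * (bridgeWeight a j * (X (i * ρ + (qA * ρ - pA)) - X (i * ρ))) ∧
      bridgeWeight a j * (X (i * ρ + (qA * ρ - pA)) - X (i * ρ)) ≤
        C * (X (i * ρ + (qA * ρ - pA) - j * (pB - qB * ρ)) -
          X (i * ρ + (qA * ρ - pA) - (j + 1) * (pB - qB * ρ))) := by
  obtain ⟨C, hC, w₀, hw₀, hsm⟩ := h.bridge_gap_small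
  obtain ⟨α₀, hα₀, hun⟩ := h.exists_uniform hw₀
  obtain ⟨C', hC', hlg⟩ := h.bridge_gap_of_large hα₀
  refine ⟨max C C', hC.trans (le_max_left _ _), fun {qA qB a pA pB} s s' j hj i hi => ?_⟩
  obtain ⟨n1, n2⟩ := s'.next_bounds
  have key : ∀ {K w : ℝ}, 0 ≤ w → ∀ {l : ℝ}, 0 ≤ l → K ≤ max C C' → l ≤ K * w ∧ w ≤ K * l →
      l ≤ max C C' * w ∧ w ≤ max C C' * l := fun hw _ hl hK hh =>
    ⟨hh.1.trans (mul_le_mul_of_nonneg_right hK hw), hh.2.trans (mul_le_mul_of_nonneg_right hK hl)⟩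
  have hα := s.pos.trans s.lt
  have hβ := s.pos
  have p1 : 0 ≤ bridgeWeight a j * (X (i * ρ + (qA * ρ - pA)) - X (i * ρ)) :=
    mul_nonneg (bridgeWeight_pos hj).le (sub_pos.2 (h.mono' (by linarith))).le
  have p2 : 0 ≤ X (i * ρ + (qA * ρ - pA) - j * (pB - qB * ρ)) -
          X (i * ρ + (qA * ρ - pA) - (j + 1) * (pB - qB * ρ)) :=
    (sub_pos.2 (h.mono' (by linarith))).le
  rcases lt_or_ge (qA * ρ - pA) α₀ with h0 | h0
  · exact key p1 p2 (le_max_left _ _) (hsm s (hun _ h0) (by omega) n1 n2 j hj i hi)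
  · exact key p1 p2 (le_max_right _ _) (hlg s n1 h0 j hj (i * ρ))

/-- The last piece of a long interval in the next dynamical partition. -/
theorem bridge_last : ∃ C : ℝ, 1 ≤ C ∧ ∀ {qA qB a : ℕ} {pA pB : ℤ},
    RState ρ qA pA qB pB → RState (-ρ) qB (-pB) (qA + a * qB) (-(pA + a * pB)) →
    ∀ i : ℕ, i < qA + qB →
      X (i * ρ + (qA * ρ - pA)) - X (i * ρ) ≤
        C * (X (i * ρ + (qA * ρ - pA) - a * (pB - qB * ρ)) - X (i * ρ)) := by
  obtain ⟨C₁, hC₁, hcr⟩ := h.rb_crit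
  obtain ⟨C₂, hC₂, hcr'⟩ := h.reflect.rb_crit
  refine ⟨C₁ * C₂, one_le_mul_of_one_le_of_one_le hC₁ hC₂, fun {qA qB a pA pB} s s' i hi => ?_⟩
  have h1 := hcr s i hi
  have h2 := hcr' s' i (by
    have := s'.le; have := s.one_le; have := s.le
    omega)
  push_cast at h2
  rw [show -(i * -ρ + (qB * -ρ - -(pB:ℝ))) = i * ρ - (pB - qB * ρ) by ring,
    show -(i * -ρ) = i * ρ by ring,
    show -(i * -ρ - (-(pA + a * (pB:ℝ)) - (qA + a * qB) * -ρ)) =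
      i * ρ + (qA * ρ - pA) - a * (pB - qB * ρ) by ring] at h2
  rw [mul_assoc]
  refine h1.trans (mul_le_mul_of_nonneg_left ?_ (by linarith))
  linarith

end Coord

theorem nested_ratio_aux {a b c a' b' c' C D : ℝ} (hb : 0 < b) (hb' : 0 < b') (ha' : 0 < a') (hc' : 0 < c')
    (hC : 0 < C) (h1 : a * b' ≤ C * (a' * b)) (h2 : b * c' ≤ D * (b' * c)) :
    a * c' ≤ D * C * (a' * c) := by
  have : a * b' * (b * c') ≤ C * (a' * b) * (D * (b' * c)) := by gcongr
  have h3 : (b * b') * (a * c') ≤ (b * b') * (D * C * (a' * c)) := by linarith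
  exact le_of_mul_le_mul_left h3 (by positivity)

theorem ratio_of_nested_aux {xJ yJ xP yP xI yI C K : ℝ}
    (hxI : 0 < xI) (hxJ : 0 < xJ) (hK : 0 < K) (hC : 0 < C)
    (h1 : yJ * xP ≤ K * (xJ * yP)) (h2 : yP ≤ C * yI) (h3 : xI ≤ C * xP) (hyI : 0 < yI) :
    yJ ≤ K * C ^ 2 * (yI / xI) * xJ := by
  have e : K * C ^ 2 * (yI / xI) * xJ = K * C ^ 2 * yI * xJ / xI := by ring
  rw [e, le_div_iff₀ hxI]
  have h4 : yJ * xP ≤ K * (xJ * (C * yI)) := h1.trans (by gcongr)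
  rcases le_or_gt yJ 0 with h5 | h5
  · have : yJ * xI ≤ 0 := mul_nonpos_of_nonpos_of_nonneg h5 hxI.le
    exact this.trans (by positivity)
  · calc yJ * xI ≤ yJ * (C * xP) := by gcongr
      _ = C * (yJ * xP) := by ring
      _ ≤ C * (K * (xJ * (C * yI))) := by gcongr
      _ = _ := by ring

/-- A nested sequence of partitions of the line (`Gp n u v` says that `[u, v]` is an atom of level
`n`) for which `X` and `Y` have bounded geometry and comparable relative sizes. -/
structure Grid (Gp : ℕ → ℝ → ℝ → Prop) (X Y : ℝ → ℝ) (C : ℝ) : Prop where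
  one_le : 1 ≤ C
  monoX : StrictMono X
  monoY : StrictMono Y
  cover : ∀ n t, ∃ u v, Gp n u v ∧ u ≤ t ∧ t < v
  width : ∀ n, ∃ δ > 0, ∀ u v, Gp n u v → δ ≤ v - u
  base : ∃ δ > 0, ∀ u v, Gp 0 u v → δ ≤ X v - X u
  sep : ∀ n u v u' v', Gp n u v → Gp n u' v' → ¬(u < u' ∧ u' < v) ∧ ¬(u < v' ∧ v' < v)
  right : ∀ n u v, Gp n u v → ∃ w, Gp n v w ∧
    X w - X v ≤ C * (X v - X u) ∧ X v - X u ≤ C * (X w - X v) ∧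
    Y w - Y v ≤ C * (Y v - Y u) ∧ Y v - Y u ≤ C * (Y w - Y v)
  left : ∀ n u v, Gp n u v → ∃ w, Gp n w u ∧
    X u - X w ≤ C * (X v - X u) ∧ X v - X u ≤ C * (X u - X w) ∧
    Y u - Y w ≤ C * (Y v - Y u) ∧ Y v - Y u ≤ C * (Y u - Y w)
  nest : ∀ n u v, Gp (n + 1) u v → ∃ u' v', Gp n u' v' ∧ u' ≤ u ∧ v ≤ v' ∧
    (X v - X u) * (Y v' - Y u') ≤ C * ((Y v - Y u) * (X v' - X u')) ∧
    (Y v - Y u) * (X v' - X u') ≤ C * ((X v - X u) * (Y v' - Y u'))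
  shrink : ∀ n u v u' v', Gp (n + 2) u v → Gp n u' v' → v - u < v' - u'

namespace Grid
variable {Gp : ℕ → ℝ → ℝ → Prop} {X Y : ℝ → ℝ} {C : ℝ} (g : Grid Gp X Y C)
include g

theorem lt {n : ℕ} {u v : ℝ} (h : Gp n u v) : u < v := by
  obtain ⟨δ, hδ, h1⟩ := g.width n
  linarith [h1 u v h]

theorem eq_of_overlap {n : ℕ} {u v u' v' : ℝ} (h : Gp n u v) (h' : Gp n u' v') (h1 : u < v')
    (h2 : u' < v) : u = u' ∧ v = v' := by
  have a := g.sep _ _ _ _ _ h h'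
  have b := g.sep _ _ _ _ _ h' h
  have hu : u = u' := by
    rcases lt_trichotomy u u' with h3 | h3 | h3
    · exact absurd ⟨h3, h2⟩ a.1
    · exact h3
    · exact absurd ⟨h3, h1⟩ b.1
  refine ⟨hu, ?_⟩
  rcases lt_trichotomy v v' with h3 | h3 | h3
  · exact absurd ⟨h2, h3⟩ b.2
  · exact h3
  · exact absurd ⟨h1, h3⟩ a.2

theorem nest_iter (n k : ℕ) {u v : ℝ} (h : Gp (n + k) u v) : ∃ u' v', Gp n u' v' ∧ u' ≤ u ∧ v ≤ v' ∧
    (X v - X u) * (Y v' - Y u') ≤ C ^ k * ((Y v - Y u) * (X v' - X u')) ∧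
    (Y v - Y u) * (X v' - X u') ≤ C ^ k * ((X v - X u) * (Y v' - Y u')) := by
  induction k generalizing u v with
  | zero => exact ⟨u, v, h, le_rfl, le_rfl, by simp [mul_comm], by simp [mul_comm]⟩
  | succ k ih =>
    obtain ⟨u₁, v₁, h1, hu, hv, e1, e2⟩ := g.nest (n + k) u v h
    obtain ⟨u₂, v₂, h2, hu2, hv2, e3, e4⟩ := ih h1
    have hC : 0 < C := by linarith [g.one_le]
    have l0 := g.lt h
    have l1 := g.lt h1
    have l2 := g.lt h2
    have pX := fun {a b : ℝ} (hab : a < b) => sub_pos.2 (g.monoX hab)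
    have pY := fun {a b : ℝ} (hab : a < b) => sub_pos.2 (g.monoY hab)
    refine ⟨u₂, v₂, h2, hu2.trans hu, hv.trans hv2, ?_, ?_⟩
    · rw [pow_succ]
      exact nested_ratio_aux (pX l1) (pY l1) (pY l0) (pY l2) hC e1 e3
    · rw [pow_succ]
      exact nested_ratio_aux (pY l1) (pX l1) (pX l0) (pX l2) hC e2 e4

theorem sub_of_overlap (n k : ℕ) {u v u' v' : ℝ} (h : Gp (n + k) u v) (h' : Gp n u' v')
    (h1 : u < v') (h2 : u' < v) : u' ≤ u ∧ v ≤ v' ∧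
    (X v - X u) * (Y v' - Y u') ≤ C ^ k * ((Y v - Y u) * (X v' - X u')) ∧
    (Y v - Y u) * (X v' - X u') ≤ C ^ k * ((X v - X u) * (Y v' - Y u')) := by
  obtain ⟨a, b, hab, ha, hb, e⟩ := g.nest_iter n k h
  have := g.lt h
  obtain ⟨rfl, rfl⟩ := g.eq_of_overlap hab h' (by linarith) (by linarith)
  exact ⟨ha, hb, e⟩

theorem shrink_two (n : ℕ) {u v u' v' : ℝ} (h : Gp (n + 2) u v) (h' : Gp n u' v')
    (h1 : u' ≤ u) (h2 : v ≤ v') : X v - X u ≤ C / (C + 1) * (X v' - X u') := by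
  have hC : 0 < C := by linarith [g.one_le]
  have hs := g.shrink _ _ _ _ _ h h'
  have key : ∀ e I J : ℝ, J ≤ C * e → J + e ≤ I → J ≤ C / (C + 1) * I := by
    intro e I J h3 h4
    rw [div_mul_eq_mul_div, le_div_iff₀ (by linarith)]
    have : C * (J + e) ≤ C * I := by gcongr
    linarith
  rcases h1.eq_or_lt with h3 | h3
  · have h4 : v < v' := by linarith
    obtain ⟨w, hw, -, e, -⟩ := g.right _ _ _ h
    have := g.lt hw
    have := g.lt h
    have := (g.sub_of_overlap n 2 hw h' h4 (by linarith)).2.1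
    have := g.monoX.monotone this
    exact key (X w - X v) _ _ e (by rw [h3]; linarith)
  · obtain ⟨w, hw, -, e, -⟩ := g.left _ _ _ h
    have := g.lt hw
    have := (g.sub_of_overlap n 2 hw h' (by linarith [g.lt h]) h3).1
    have := g.monoX.monotone this
    have := g.monoX.monotone h2
    exact key (X u - X w) _ _ e (by linarith)

theorem shrink_iter (n k : ℕ) {u v u' v' : ℝ} (h : Gp (n + 2 * k) u v) (h' : Gp n u' v')
    (h1 : u' ≤ u) (h2 : v ≤ v') : X v - X u ≤ (C / (C + 1)) ^ k * (X v' - X u') := by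
  have hC : 0 < C := by linarith [g.one_le]
  induction k generalizing u v with
  | zero => 
    have := g.monoX.monotone h1
    have := g.monoX.monotone h2
    simp; linarith
  | succ k ih =>
    have h0 : Gp (n + 2 * k + 2) u v := h
    have l := g.lt h
    obtain ⟨a, b, hab, ha, hb, -⟩ := g.nest_iter (n + 2 * k) 2 h0
    have h3 := g.sub_of_overlap n (2 * k) hab h' (by linarith) (by linarith)
    calc X v - X u ≤ C / (C + 1) * (X b - X a) := g.shrink_two _ h0 hab ha hb
      _ ≤ C / (C + 1) * ((C / (C + 1)) ^ k * (X v' - X u')) := by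
        gcongr; exact ih hab h3.1 h3.2.1
      _ = _ := by ring

theorem chain {n : ℕ} {l K : ℝ} {u v u₁ v₁ : ℝ} (h : Gp n u v) (h' : Gp n u₁ v₁) (hu : u ≤ u₁)
    (H : ∀ a b, Gp n a b → u ≤ a → b ≤ v₁ →
      l * (X b - X a) ≤ Y b - Y a ∧ Y b - Y a ≤ K * (X b - X a)) :
    l * (X v₁ - X u) ≤ Y v₁ - Y u ∧ Y v₁ - Y u ≤ K * (X v₁ - X u) := by
  obtain ⟨δ, hδ, hw⟩ := g.width n
  obtain ⟨m, hm⟩ := exists_nat_gt ((u₁ - u) / δ)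
  rw [div_lt_iff₀ hδ] at hm
  induction m generalizing u v with
  | zero => simp at hm; linarith
  | succ m ih =>
    rcases hu.eq_or_lt with rfl | hlt
    · obtain ⟨-, rfl⟩ := g.eq_of_overlap h h' (g.lt h') (g.lt h)
      exact H _ _ h le_rfl le_rfl
    · have hv : v ≤ u₁ := not_lt.1 fun hv => (g.sep _ _ _ _ _ h h').1 ⟨hlt, hv⟩
      obtain ⟨w, hw', -⟩ := g.right _ _ _ h
      have l1 := g.lt h
      have l2 := g.lt h'
      have h3 := ih hw' hv (fun a b hab h1 h2 => H a b hab (by linarith) h2) (by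
        have := hw _ _ h
        push_cast at hm
        linarith)
      have h4 := H _ _ h le_rfl (by linarith)
      exact ⟨by linarith, by linarith⟩

theorem sum_bounds {n : ℕ} {l K D s t : ℝ} (hl : 0 ≤ l) (hK : 0 ≤ K) (hD : 0 < D)
    (hst : X t - X s = D)
    (H : ∀ a b, Gp n a b → a ≤ t → s < b → X b - X a ≤ D / 4 ∧
      l * (X b - X a) ≤ Y b - Y a ∧ Y b - Y a ≤ K * (X b - X a)) :
    l * (D / 2) ≤ Y t - Y s ∧ Y t - Y s ≤ K * (3 / 2 * D) := by
  have hlt : s < t := g.monoX.lt_iff_lt.1 (by linarith)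
  obtain ⟨u₀, v₀, h0, hu0, hv0⟩ := g.cover n s
  obtain ⟨u₁, v₁, h1, hu1, hv1⟩ := g.cover n t
  have s0 := (H _ _ h0 (by linarith) hv0).1
  have s1 := (H _ _ h1 hu1 (by linarith)).1
  have m := g.monoX.monotone
  have m0 := m hu0
  have m1 := m hv0.le
  have m2 := m hu1
  have m3 := m hv1.le
  have hv : v₀ < u₁ := g.monoX.lt_iff_lt.1 (by linarith)
  have l0 := g.lt h0
  have l1 := g.lt h1
  constructor
  · obtain ⟨w, hw, -⟩ := g.right _ _ _ h0
    obtain ⟨w', hw', -⟩ := g.left _ _ _ h1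
    have := g.lt hw
    have := g.lt hw'
    have hww : v₀ ≤ w' := not_lt.1 fun h => (g.sep _ _ _ _ _ hw' h0).2 ⟨h, hv⟩
    have h3 := (g.chain (l := l) (K := K) hw hw' hww (fun a b hab h1 h2 =>
      (H a b hab (by linarith [g.lt hab]) (by linarith [g.lt hab])).2)).1
    have n1 := g.monoY.monotone hv0.le
    have n2 := g.monoY.monotone hu1
    have : l * (D / 2) ≤ l * (X u₁ - X v₀) := by gcongr; linarith
    linarith
  · have h3 := (g.chain (l := l) (K := K) h0 h1 (by linarith) (fun a b hab h2 h3 => by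
      have := g.lt hab
      refine (H a b hab ?_ ?_).2
      · by_contra! hc
        have := g.eq_of_overlap hab h1 (by linarith) (by linarith)
        linarith
      · by_contra! hc
        exact (g.sep _ _ _ _ _ h0 hab).2 ⟨by linarith, by linarith⟩)).2
    have n1 := g.monoY.monotone hu0
    have n2 := g.monoY.monotone hv1.le
    have : K * (X v₁ - X u₀) ≤ K * (3 / 2 * D) := by gcongr; linarith
    linarith

/-- The scale of an interval: the level at which the atom containing `b` is just larger
than `C * D`. -/
theorem exists_level : ∃ D₀ > 0, ∀ b D, 0 < D → D ≤ D₀ → ∃ n u v u' v', Gp n u v ∧ u ≤ b ∧ b < v ∧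
    C * D ≤ X v - X u ∧ Gp (n + 1) u' v' ∧ u' ≤ b ∧ b < v' ∧ X v' - X u' < C * D := by
  obtain ⟨δ, hδ, hb⟩ := g.base
  have hC : 0 < C := by linarith [g.one_le]
  refine ⟨δ / C, by positivity, fun b D hD hD0 => ?_⟩
  choose U V hG hU hV using fun n => g.cover n b
  rw [le_div_iff₀ hC] at hD0
  have hex : ∃ n, X (V n) - X (U n) < C * D := by
    have ht : Tendsto (fun k => (C / (C + 1)) ^ k * (X (V 0) - X (U 0))) atTop (𝓝 (0 * _)) :=
      (tendsto_pow_atTop_nhds_zero_of_lt_one (by positivity)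
        ((div_lt_one (by linarith)).2 (by linarith))).mul_const _
    rw [zero_mul] at ht
    obtain ⟨k, hk⟩ := (ht.eventually_lt_const (by positivity : 0 < C * D)).exists
    refine ⟨0 + 2 * k, lt_of_le_of_lt ?_ hk⟩
    have h3 := g.sub_of_overlap 0 (2 * k) (hG (0 + 2 * k)) (hG 0)
      ((hU _).trans_lt (hV _)) ((hU _).trans_lt (hV _))
    exact g.shrink_iter 0 k (hG _) (hG 0) h3.1 h3.2.1
  classical
  obtain ⟨n, hn⟩ : ∃ n, Nat.find hex = n + 1 := Nat.exists_eq_succ_of_ne_zero fun h0 => by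
    have h1 := Nat.find_spec hex
    rw [h0] at h1
    linarith [hb _ _ (hG 0)]
  have h1 := Nat.find_spec hex
  have h2 := Nat.find_min hex (m := n) (by omega)
  rw [hn] at h1
  exact ⟨n, U n, V n, U (n + 1), V (n + 1), hG n, hU n, hV n, not_lt.1 h2, hG _, hU _, hV _, h1⟩

theorem parent_compare {n : ℕ} {u v w z p q : ℝ} (h : Gp n u v) (hw : Gp n w u) (hz : Gp n v z)
    (hp : Gp n p q) (h1 : p < z) (h2 : w < q) :
    X q - X p ≤ C * (X v - X u) ∧ X v - X u ≤ C * (X q - X p) ∧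
    Y q - Y p ≤ C * (Y v - Y u) ∧ Y v - Y u ≤ C * (Y q - Y p) := by
  have l0 := g.lt h
  have l1 := g.lt hw
  have l2 := g.lt hz
  have l3 := g.lt hp
  rcases lt_or_ge p u with h3 | h3
  · obtain ⟨rfl, rfl⟩ := g.eq_of_overlap hp hw h3 h2
    obtain ⟨w', hw', e⟩ := g.left _ _ _ h
    obtain ⟨rfl, -⟩ := g.eq_of_overlap hw' hw (g.lt hw') l3 |>.imp id id
    exact e
  · rcases lt_or_ge p v with h4 | h4
    · obtain ⟨rfl, rfl⟩ := g.eq_of_overlap hp h h4 (by linarith)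
      have := g.one_le
      have a1 := sub_pos.2 (g.monoX l0)
      have a2 := sub_pos.2 (g.monoY l0)
      exact ⟨le_mul_of_one_le_left a1.le this, le_mul_of_one_le_left a1.le this,
        le_mul_of_one_le_left a2.le this, le_mul_of_one_le_left a2.le this⟩
    · obtain ⟨rfl, rfl⟩ := g.eq_of_overlap hp hz h1 (by linarith)
      obtain ⟨w', hw', e⟩ := g.right _ _ _ h
      obtain ⟨-, rfl⟩ := g.eq_of_overlap hw' hz l3 (g.lt hw') |>.imp id id
      exact e

theorem size_le {n : ℕ} {u v b D s t : ℝ} (h : Gp n u v) (hu : u ≤ b) (hv : b < v)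
    (hD : 0 < D) (hs : X v - X u < C * D) (hst : X t - X s = D) (hb : s = b ∨ t = b) {p q : ℝ}
    (hp : Gp n p q) (h1 : p ≤ t) (h2 : s < q) : X q - X p ≤ C ^ 2 * D := by
  have hC := g.one_le
  have hlt : s < t := g.monoX.lt_iff_lt.1 (by linarith)
  have l1 := g.lt hp
  have hCD : C * D ≤ C ^ 2 * D := by
    have : 0 ≤ C * D * (C - 1) := mul_nonneg (by positivity) (by linarith)
    linarith
  have hDC : D ≤ C * D := le_mul_of_one_le_left hD.le hC
  have one : ∀ {p q}, Gp n p q → p ≤ b → b < q → X q - X p ≤ C * D := by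
    intro p q hp h1 h2
    obtain ⟨rfl, rfl⟩ := g.eq_of_overlap hp h (by linarith) (by linarith)
    exact hs.le
  rcases hb with rfl | rfl
  · rcases le_or_gt p s with h3 | h3
    · exact (one hp h3 h2).trans hCD
    · obtain ⟨w, hw, -, e, -⟩ := g.left _ _ _ hp
      have : X p - X w ≤ C * D := by
        rcases le_or_gt w s with h4 | h4
        · exact one hw h4 h3
        · have := g.monoX h4
          have := g.monoX.monotone h1
          linarith
      calc _ ≤ C * (X p - X w) := e
        _ ≤ C * (C * D) := by gcongr
        _ = _ := by ring
  · rcases lt_or_ge t q with h3 | h3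
    · exact (one hp h1 h3).trans hCD
    · obtain ⟨w, hw, -, e, -⟩ := g.right _ _ _ hp
      have : X w - X q ≤ C * D := by
        rcases lt_or_ge t w with h4 | h4
        · exact one hw h3 h4
        · have := g.monoX.monotone h4
          have := g.monoX h2
          linarith
      calc _ ≤ C * (X w - X q) := e
        _ ≤ C * (C * D) := by gcongr
        _ = _ := by ring

theorem local_qs : ∃ K ≥ 1, ∃ D₀ > 0, ∀ b D, 0 < D → D ≤ D₀ → ∃ l > 0, ∀ s t, X t - X s = D →
    (s = b ∨ t = b) → l * D ≤ K * (Y t - Y s) ∧ Y t - Y s ≤ K * (l * D) := by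
  obtain ⟨D₀, hD0, hlev⟩ := g.exists_level
  have hC := g.one_le
  have hC0 : 0 < C := by linarith
  obtain ⟨T, hT⟩ : ∃ T : ℕ, (C / (C + 1)) ^ T < 1 / (4 * C ^ 2) :=
    exists_pow_lt_of_lt_one (by positivity) ((div_lt_one (by linarith)).2 (by linarith))
  rw [lt_div_iff₀ (by positivity)] at hT
  set K₀ := C ^ (1 + 2 * T) * C ^ 2 with hK0
  have hK01 : 1 ≤ K₀ := one_le_mul_of_one_le_of_one_le (one_le_pow₀ hC) (one_le_pow₀ hC)
  refine ⟨2 * K₀, by linarith, D₀, hD0, fun b D hD hDD => ?_⟩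
  obtain ⟨n, u, v, u', v', h, hu, hv, hsz, h', hu', hv', hsz'⟩ := hlev b D hD hDD
  obtain ⟨w, hw, -, ew, -⟩ := g.left _ _ _ h
  obtain ⟨z, hz, -, ez, -⟩ := g.right _ _ _ h
  have hxI := sub_pos.2 (g.monoX (g.lt h))
  have hyI := sub_pos.2 (g.monoY (g.lt h))
  refine ⟨(Y v - Y u) / (X v - X u), by positivity, fun s t hst hb => ?_⟩
  have hlt : s < t := g.monoX.lt_iff_lt.1 (by linarith)
  have gw : D ≤ X u - X w := le_of_mul_le_mul_left (hsz.trans ew) hC0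
  have gz : D ≤ X z - X v := le_of_mul_le_mul_left (hsz.trans ez) hC0
  have hws : w ≤ s := by
    rcases hb with rfl | rfl
    · linarith [g.lt hw]
    · have := g.monoX.monotone hu
      exact g.monoX.le_iff_le.1 (by linarith)
  have htz : t < z := by
    rcases hb with rfl | rfl
    · have := g.monoX hv
      exact g.monoX.lt_iff_lt.1 (by linarith)
    · linarith [g.lt hz]
  set lam := (Y v - Y u) / (X v - X u) with hlam
  have hl0 : 0 < lam := by positivity
  have hlow : 0 ≤ lam / K₀ := by positivity
  have H := g.sum_bounds (n := n + (1 + 2 * T)) (l := lam / K₀) (K := K₀ * lam)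
    (by positivity) (by positivity) hD hst (by
    intro p q hp h1 h2
    have lJ := g.lt hp
    have hxJ := sub_pos.2 (g.monoX lJ)
    have hyJ := sub_pos.2 (g.monoY lJ)
    refine ⟨?_, ?_⟩
    · have hp' : Gp (n + 1 + 2 * T) p q := by rwa [add_assoc]
      obtain ⟨p', q', hpq, e1, e2, -⟩ := g.nest_iter (n + 1) (2 * T) hp'
      have s1 := g.size_le h' hu' hv' hD hsz' hst hb hpq (e1.trans h1) (h2.trans_le e2)
      calc X q - X p ≤ (C / (C + 1)) ^ T * (X q' - X p') := g.shrink_iter _ _ hp' hpq e1 e2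
        _ ≤ (C / (C + 1)) ^ T * (C ^ 2 * D) := by gcongr
        _ = (C / (C + 1)) ^ T * (4 * C ^ 2) * (D / 4) := by ring
        _ ≤ 1 * (D / 4) := by gcongr
        _ = _ := one_mul _
    · obtain ⟨p', q', hpq, e1, e2, r1, r2⟩ := g.nest_iter n (1 + 2 * T) hp
      obtain ⟨c1, c2, c3, c4⟩ := g.parent_compare h hw hz hpq (by linarith) (by linarith)
      have hk : 0 < C ^ (1 + 2 * T) := by positivity
      refine ⟨?_, ratio_of_nested_aux hxI hxJ hk hC0 r2 c3 c2 hyI⟩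
      have := ratio_of_nested_aux hyI hyJ hk hC0 r1 c1 c4 hxI
      rw [div_mul_eq_mul_div, div_le_iff₀ (by positivity)]
      calc lam * (X q - X p) ≤ lam * (K₀ * ((X v - X u) / (Y v - Y u)) * (Y q - Y p)) := by
            gcongr
        _ = (Y q - Y p) * K₀ := by rw [hlam]; field_simp)
  constructor
  · have h3 := H.1
    rw [div_mul_eq_mul_div, div_le_iff₀ (by positivity)] at h3
    linarith
  · calc Y t - Y s ≤ K₀ * lam * (3 / 2 * D) := H.2
      _ = 3 / 2 * (K₀ * (lam * D)) := by ring
      _ ≤ 2 * (K₀ * (lam * D)) := by gcongr; norm_num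
      _ = _ := by ring

end Grid

/-- The atoms of the dynamical partition associated with a renormalization state, in the linear
coordinate. -/
def RGap (ρ : ℝ) (qA : ℕ) (pA : ℤ) (qB : ℕ) (pB : ℤ) (u v : ℝ) : Prop :=
  ∃ m : ℤ, (∃ i : ℕ, i < qB ∧ u = i * ρ + m ∧ v = u + (qA * ρ - pA)) ∨
    (∃ i : ℕ, i < qA ∧ v = i * ρ + m ∧ u = v - (pB - qB * ρ))

namespace RGap
variable {ρ : ℝ} {qA qB : ℕ} {pA pB : ℤ} {u v : ℝ}

theorem length (h : RGap ρ qA pA qB pB u v) :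
    v = u + (qA * ρ - pA) ∨ v = u + (pB - qB * ρ) := by
  obtain ⟨m, ⟨i, -, -, h⟩ | ⟨i, -, -, h⟩⟩ := h
  · exact Or.inl h
  · right; rw [h]; ring

theorem left_mem (h : RGap ρ qA pA qB pB u v) : ∃ i : ℕ, i < qA + qB ∧ ∃ m : ℤ, u = i * ρ + m := by
  obtain ⟨m, ⟨i, h1, h2, h3⟩ | ⟨i, h1, h2, h3⟩⟩ := h
  · exact ⟨i, by omega, m, h2⟩
  · exact ⟨i + qB, by omega, m - pB, by rw [h3, h2]; push_cast; ring⟩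

theorem right_mem (h : RGap ρ qA pA qB pB u v) : ∃ i : ℕ, i < qA + qB ∧ ∃ m : ℤ, v = i * ρ + m := by
  obtain ⟨m, ⟨i, h1, h2, h3⟩ | ⟨i, h1, h2, h3⟩⟩ := h
  · exact ⟨i + qA, by omega, m - pA, by rw [h3, h2]; push_cast; ring⟩
  · exact ⟨i, by omega, m, h2⟩

theorem not_between (s : RState ρ qA pA qB pB) (h : RGap ρ qA pA qB pB u v) {i : ℕ} {m : ℤ}
    (hi : i < qA + qB) : ¬(u < i * ρ + m ∧ i * ρ + m < v) := by
  rintro ⟨h1, h2⟩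
  obtain ⟨n, ⟨j, g1, g2, g3⟩ | ⟨j, g1, g2, g3⟩⟩ := h
  · have := s.not_mem_long (k := i - j) (m := n - m) (by omega) (by omega) (by push_cast; linarith)
    push_cast at this; linarith
  · have := s.not_mem_short (k := i - j) (m := n - m) (by omega) (by omega)
      (by push_cast; linarith)
    push_cast at this; linarith

theorem exists_right (qA : ℕ) (pA : ℤ) (pB : ℤ) {i : ℕ} (hi : i < qA + qB) (m : ℤ) :
    ∃ w, RGap ρ qA pA qB pB (i * ρ + m) w := by
  by_cases h : i < qB
  · exact ⟨_, m, Or.inl ⟨i, h, rfl, rfl⟩⟩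
  · refine ⟨i * ρ + m + (pB - qB * ρ), m + pB, Or.inr ⟨i - qB, by omega, ?_, by ring⟩⟩
    push_cast [Nat.cast_sub (not_lt.1 h)]
    ring

theorem exists_left (qB : ℕ) (pA : ℤ) (pB : ℤ) {i : ℕ} (hi : i < qA + qB) (m : ℤ) :
    ∃ w, RGap ρ qA pA qB pB w (i * ρ + m) := by
  by_cases h : i < qA
  · exact ⟨_, m, Or.inr ⟨i, h, rfl, rfl⟩⟩
  · refine ⟨i * ρ + m - (qA * ρ - pA), m + pA, Or.inl ⟨i - qA, by omega, ?_, by ring⟩⟩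
    push_cast [Nat.cast_sub (not_lt.1 h)]
    ring

theorem width (s : RState ρ qA pA qB pB) (h : RGap ρ qA pA qB pB u v) : pB - qB * ρ ≤ v - u := by
  have := s.lt
  rcases h.length with h | h <;> rw [h] <;> linarith

theorem width_le (s : RState ρ qA pA qB pB) (h : RGap ρ qA pA qB pB u v) :
    v - u ≤ qA * ρ - pA := by
  have := s.lt
  rcases h.length with h | h <;> rw [h] <;> linarith

theorem cover (s : RState ρ qA pA qB pB) (t : ℝ) : ∃ u v, RGap ρ qA pA qB pB u v ∧ u ≤ t ∧ t ≤ v := by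
  have hβ := s.pos
  have key : ∀ n : ℕ, ∀ u v, RGap ρ qA pA qB pB u v → u ≤ t → t - u ≤ n * (pB - qB * ρ) →
      ∃ u v, RGap ρ qA pA qB pB u v ∧ u ≤ t ∧ t ≤ v := by
    intro n
    induction n with
    | zero =>
      intro u v h h1 h2
      have := h.width s
      exact ⟨u, v, h, h1, by push_cast at h2; linarith⟩
    | succ n ih =>
      intro u v h h1 h2
      rcases le_or_gt t v with h3 | h3
      · exact ⟨u, v, h, h1, h3⟩
      · obtain ⟨i, hi, m, rfl⟩ := h.right_mem
        obtain ⟨w, hw⟩ := exists_right (ρ := ρ) qA pA pB hi m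
        have := h.width s
        exact ih _ w hw h3.le (by push_cast at h2; linarith)
  obtain ⟨n, hn⟩ := exists_nat_ge ((t - ⌊t⌋) / (pB - qB * ρ))
  have := s.le
  have := s.one_le
  refine key n ⌊t⌋ _ ⟨⌊t⌋, Or.inl ⟨0, by omega, by simp, rfl⟩⟩ (Int.floor_le t) ?_
  rwa [div_le_iff₀ hβ] at hn

end RGap

theorem mul_le_mul_of_weight {xJ xI yJ yI w C D : ℝ} (hC : 0 < C)
    (hyI : 0 ≤ yI) (hxI : 0 ≤ xI) (h1 : xJ ≤ C * (w * xI)) (h2 : w * yI ≤ D * yJ) :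
    xJ * yI ≤ C * D * (yJ * xI) := by
  calc xJ * yI ≤ C * (w * xI) * yI := by gcongr
    _ = C * xI * (w * yI) := by ring
    _ ≤ C * xI * (D * yJ) := by gcongr
    _ = _ := by ring

namespace Coord
variable {F G : ℝ → ℝ} {c d c' d' ρ : ℝ} {X Y : ℝ → ℝ}

theorem gap_adj (h : Coord F c d ρ X) : ∃ C : ℝ, 1 ≤ C ∧ ∀ {qA qB : ℕ} {pA pB : ℤ},
    RState ρ qA pA qB pB → ∀ u t w, RGap ρ qA pA qB pB u t → RGap ρ qA pA qB pB t w →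
    X w - X t ≤ C * (X t - X u) ∧ X t - X u ≤ C * (X w - X t) := by
  obtain ⟨C₁, hC₁, hl⟩ := h.rb_long'
  obtain ⟨C₂, hC₂, hs⟩ := h.rb_short'
  obtain ⟨C₃, hC₃, hc⟩ := h.rb_crit
  have h13 := one_le_mul_of_one_le_of_one_le hC₁ hC₃
  have h23 := one_le_mul_of_one_le_of_one_le hC₂ hC₃
  have h123 := one_le_mul_of_one_le_of_one_le h13 hC₂
  refine ⟨C₁ * C₃ * C₂, h123, fun {qA qB pA pB} s u t w hu hw => ?_⟩
  have hα := s.lt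
  have hβ := s.pos
  obtain ⟨i, hi, m, rfl⟩ := hu.right_mem
  have hl := hl s (i * ρ + m)
  have hs := hs s (i * ρ + m)
  have hc : X (i * ρ + m + (qA * ρ - pA)) - X (i * ρ + m) ≤
      C₃ * (X (i * ρ + m) - X (i * ρ + m - (pB - qB * ρ))) := by
    have := hc s i hi
    rw [show i * ρ + m + (qA * ρ - pA) = i * ρ + (qA * ρ - pA) + m by ring,
      show i * ρ + m - (pB - qB * ρ) = i * ρ - (pB - qB * ρ) + m by ring, h.add_int, h.add_int,
      h.add_int, add_sub_add_right_eq_sub, add_sub_add_right_eq_sub]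
    exact this
  set t := i * ρ + m
  set α := qA * ρ - pA
  set β := pB - qB * ρ
  have m1 : X (t + β) ≤ X (t + α) := h.mono'.monotone (by linarith)
  have m2 : X (t - α) ≤ X (t - β) := h.mono'.monotone (by linarith)
  have m3 : X t < X (t + β) := h.mono' (by linarith)
  have m4 : X (t - β) < X t := h.mono' (by linarith)
  have hu' : u = t - α ∨ u = t - β := by
    rcases hu.length with h | h
    · left; rw [h]; simp [α]
    · right; rw [h]; simp [β]
  have hw' : w = t + α ∨ w = t + β := hw.length
  -- every gap at `t` lies between the two short ones and the two long ones
  have r1 : X t - X (t - α) ≤ C₁ * C₃ * (X t - X (t - β)) := by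
    calc _ ≤ C₁ * (X (t + α) - X t) := hl.2
      _ ≤ C₁ * (C₃ * (X t - X (t - β))) := by gcongr
      _ = _ := by ring
  have r2 : C₁ * C₃ * (X t - X (t - β)) ≤ C₁ * C₃ * C₂ * (X (t + β) - X t) := by
    rw [mul_assoc (C₁ * C₃)]; gcongr; exact hs.2
  have r3 : X (t + α) - X t ≤ C₁ * C₃ * C₂ * (X t - X (t - β)) := by
    calc _ ≤ C₃ * (X t - X (t - β)) := hc
      _ ≤ C₁ * C₃ * C₂ * (X t - X (t - β)) := by
        gcongr
        rw [mul_right_comm]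
        exact le_mul_of_one_le_left (by linarith) (one_le_mul_of_one_le_of_one_le hC₁ hC₂)
  have hu1 : X u ≤ X (t - β) := by rcases hu' with h | h <;> rw [h]; exact m2
  have hu2 : X (t - α) ≤ X u := by rcases hu' with h | h <;> rw [h]; exact m2
  have hw1 : X w ≤ X (t + α) := by rcases hw' with h | h <;> rw [h]; exact m1
  have hw2 : X (t + β) ≤ X w := by rcases hw' with h | h <;> rw [h]; exact m1
  constructor
  · calc X w - X t ≤ X (t + α) - X t := by linarith
      _ ≤ _ := r3
      _ ≤ _ := by gcongr
  · calc X t - X u ≤ X t - X (t - α) := by linarith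
      _ ≤ _ := r1
      _ ≤ _ := r2
      _ ≤ _ := by gcongr

theorem gap_nest (h : Coord F c d ρ X) (k : Coord G c' d' ρ Y) :
    ∃ C : ℝ, 1 ≤ C ∧ ∀ {qA qB a : ℕ} {pA pB : ℤ},
    RState ρ qA pA qB pB → RState (-ρ) qB (-pB) (qA + a * qB) (-(pA + a * pB)) →
    ∀ u v, RGap (-ρ) qB (-pB) (qA + a * qB) (-(pA + a * pB)) (-v) (-u) →
    ∃ u' v', RGap ρ qA pA qB pB u' v' ∧ u' ≤ u ∧ v ≤ v' ∧
    (X v - X u) * (Y v' - Y u') ≤ C * ((Y v - Y u) * (X v' - X u')) ∧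
    (Y v - Y u) * (X v' - X u') ≤ C * ((X v - X u) * (Y v' - Y u')) := by
  obtain ⟨C₁, hC₁, b1⟩ := h.bridge_gap
  obtain ⟨C₂, hC₂, b2⟩ := k.bridge_gap
  obtain ⟨C₃, hC₃, l1⟩ := h.bridge_last
  obtain ⟨C₄, hC₄, l2⟩ := k.bridge_last
  have k12 := one_le_mul_of_one_le_of_one_le hC₁ hC₂
  have k34 := one_le_mul_of_one_le_of_one_le hC₃ hC₄
  have mX := h.mono'.monotone
  have mY := k.mono'.monotone
  set K := C₁ * C₂ * (C₃ * C₄) with hK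
  have hK1 : 1 ≤ K := one_le_mul_of_one_le_of_one_le k12 k34
  have kk1 : C₁ * C₂ ≤ K := le_mul_of_one_le_right (by linarith) k34
  have kk2 : C₃ * C₄ ≤ K := le_mul_of_one_le_left (by linarith) k12
  have kk3 : C₃ ≤ K := (le_mul_of_one_le_right (by linarith) hC₄).trans kk2
  have kk4 : C₄ ≤ K := (le_mul_of_one_le_left (by linarith) hC₃).trans kk2
  refine ⟨K, hK1, fun {qA qB a pA pB} s s' u v hg => ?_⟩
  have hα := s.lt
  have hβ := s.pos
  obtain ⟨n1, n2⟩ := s'.next_bounds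
  have b1 := @b1 _ _ _ _ _ s s'
  have b2 := @b2 _ _ _ _ _ s s'
  have l1 := @l1 _ _ _ _ _ s s'
  have l2 := @l2 _ _ _ _ _ s s'
  obtain ⟨m, ⟨i, hi, e1, e2⟩ | ⟨i, hi, e1, e2⟩⟩ := hg
  · push_cast at e2
    by_cases hiA : i < qA
    · have hvu : u ≤ v := by linarith
      have x1 := sub_nonneg.2 (mX hvu)
      have y1 := sub_nonneg.2 (mY hvu)
      refine ⟨u, v, ⟨-m, Or.inr ⟨i, hiA, by push_cast; linarith, by linarith⟩⟩, le_rfl, le_rfl, ?_, ?_⟩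
      · rw [mul_comm (Y v - Y u)]; exact le_mul_of_one_le_left (by positivity) hK1
      · rw [mul_comm (X v - X u)]; exact le_mul_of_one_le_left (by positivity) hK1
    · have hqB : 0 < qB := s.one_le.trans s.le
      obtain ⟨j, i₀, hi0, hij⟩ : ∃ j i₀ : ℕ, i₀ < qB ∧ i = qA + j * qB + i₀ :=
        ⟨(i - qA) / qB, (i - qA) % qB, Nat.mod_lt _ hqB, by
          have := Nat.div_add_mod' (i - qA) qB
          omega⟩
      have hja : j < a := by
        by_contra! hc
        have := Nat.mul_le_mul_right qB hc
        omega
      have hir : (i:ℝ) = qA + j * qB + i₀ := by rw [hij]; push_cast; ring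
      have hv : v = i₀ * ρ + (qA * ρ - pA) - j * (pB - qB * ρ) + (pA + j * pB - m : ℤ) := by
        rw [hir] at e1; push_cast; linarith
      have hu : u = i₀ * ρ + (qA * ρ - pA) - (j + 1) * (pB - qB * ρ) + (pA + j * pB - m : ℤ) := by
        rw [hir] at e1; push_cast; linarith
      have hja' : ((j:ℝ) + 1) * (pB - qB * ρ) ≤ a * (pB - qB * ρ) := by
        apply mul_le_mul_of_nonneg_right _ hβ.le
        exact_mod_cast hja
      have hj0 : 0 ≤ j * (pB - qB * ρ) := by positivity
      set M : ℤ := pA + j * pB - m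
      have b1 := b1 j hja i₀ hi0
      have b2 := b2 j hja i₀ hi0
      refine ⟨i₀ * ρ + M, i₀ * ρ + (qA * ρ - pA) + M,
        ⟨M, Or.inl ⟨i₀, hi0, rfl, by ring⟩⟩, by linarith, by linarith, ?_⟩
      rw [hu, hv]
      simp only [h.add_int, k.add_int, add_sub_add_right_eq_sub]
      have x1 : 0 ≤ X (i₀ * ρ + (qA * ρ - pA)) - X (i₀ * ρ) := sub_nonneg.2 (mX (by linarith))
      have y1 : 0 ≤ Y (i₀ * ρ + (qA * ρ - pA)) - Y (i₀ * ρ) := sub_nonneg.2 (mY (by linarith))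
      have x2 : 0 ≤ X (i₀ * ρ + (qA * ρ - pA) - j * (pB - qB * ρ)) -
        X (i₀ * ρ + (qA * ρ - pA) - (j + 1) * (pB - qB * ρ)) := sub_nonneg.2 (mX (by linarith))
      have y2 : 0 ≤ Y (i₀ * ρ + (qA * ρ - pA) - j * (pB - qB * ρ)) -
        Y (i₀ * ρ + (qA * ρ - pA) - (j + 1) * (pB - qB * ρ)) := sub_nonneg.2 (mY (by linarith))
      constructor
      · refine (mul_le_mul_of_weight (by linarith) y1 x1 b1.1 b2.2).trans ?_
        gcongr
      · refine (mul_le_mul_of_weight (by linarith) x1 y1 b2.1 b1.2).trans ?_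
        rw [mul_comm C₂]
        gcongr
  · have hu : u = i * ρ + (-m : ℤ) := by push_cast; linarith
    have hv : v = i * ρ + (qA * ρ - pA) - a * (pB - qB * ρ) + (-m : ℤ) := by
      push_cast at e2 ⊢; linarith
    have l1 := l1 i (by omega)
    have l2 := l2 i (by omega)
    have ha0 : 0 ≤ a * (pB - qB * ρ) := by positivity
    refine ⟨i * ρ + (-m : ℤ), i * ρ + (qA * ρ - pA) + (-m : ℤ),
      ⟨-m, Or.inl ⟨i, hi, rfl, by ring⟩⟩, hu.ge, by linarith, ?_⟩
    rw [hu, hv]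
    simp only [h.add_int, k.add_int, add_sub_add_right_eq_sub]
    have x1 : 0 ≤ X (i * ρ + (qA * ρ - pA) - a * (pB - qB * ρ)) - X (i * ρ) :=
      sub_nonneg.2 (mX (by linarith))
    have y1 : 0 ≤ Y (i * ρ + (qA * ρ - pA) - a * (pB - qB * ρ)) - Y (i * ρ) :=
      sub_nonneg.2 (mY (by linarith))
    have x2 : X (i * ρ + (qA * ρ - pA) - a * (pB - qB * ρ)) ≤ X (i * ρ + (qA * ρ - pA)) :=
      mX (by linarith)
    have y2 : Y (i * ρ + (qA * ρ - pA) - a * (pB - qB * ρ)) ≤ Y (i * ρ + (qA * ρ - pA)) :=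
      mY (by linarith)
    have x3 := x1.trans (sub_le_sub_right x2 _)
    have y3 := y1.trans (sub_le_sub_right y2 _)
    constructor
    · calc _ ≤ (X (i * ρ + (qA * ρ - pA)) - X (i * ρ)) *
            (C₄ * (Y (i * ρ + (qA * ρ - pA) - a * (pB - qB * ρ)) - Y (i * ρ))) := by gcongr
        _ = C₄ * ((Y (i * ρ + (qA * ρ - pA) - a * (pB - qB * ρ)) - Y (i * ρ)) *
            (X (i * ρ + (qA * ρ - pA)) - X (i * ρ))) := by ring
        _ ≤ _ := by gcongr
    · calc _ ≤ (Y (i * ρ + (qA * ρ - pA)) - Y (i * ρ)) *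
            (C₃ * (X (i * ρ + (qA * ρ - pA) - a * (pB - qB * ρ)) - X (i * ρ))) := by gcongr
        _ = C₃ * ((X (i * ρ + (qA * ρ - pA) - a * (pB - qB * ρ)) - X (i * ρ)) *
            (Y (i * ρ + (qA * ρ - pA)) - Y (i * ρ))) := by ring
        _ ≤ _ := by gcongr

end Coord

/-- A renormalization level: a state together with its orientation. -/
structure Lev where
  pos : Bool
  qA : ℕ
  pA : ℤ
  qB : ℕ
  pB : ℤ

namespace Lev

/-- The level is a genuine renormalization state of `ρ` or of `-ρ`. -/
def Ok (ρ : ℝ) (L : Lev) : Prop := RState (bif L.pos then ρ else -ρ) L.qA L.pA L.qB L.pB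

/-- The atoms of the partition of a level. -/
def gap (ρ : ℝ) (L : Lev) (u v : ℝ) : Prop :=
  bif L.pos then RGap ρ L.qA L.pA L.qB L.pB u v else RGap (-ρ) L.qA L.pA L.qB L.pB (-v) (-u)

/-- The next renormalization level. -/
def next (L : Lev) (a : ℕ) : Lev := ⟨!L.pos, L.qB, -L.pB, L.qA + a * L.qB, -(L.pA + a * L.pB)⟩

/-- The length of the short atoms. -/
def short (ρ : ℝ) (L : Lev) : ℝ := L.pB - L.qB * (bif L.pos then ρ else -ρ)

/-- The length of the long atoms. -/
def long (ρ : ℝ) (L : Lev) : ℝ := L.qA * (bif L.pos then ρ else -ρ) - L.pA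

variable {ρ : ℝ} {L : Lev}

theorem exists_ok (hρ : Irrational ρ) : ∃ L : Lev, L.Ok ρ := by
  rcases RState.base hρ with h | h
  · exact ⟨⟨true, _, _, _, _⟩, h⟩
  · exact ⟨⟨false, _, _, _, _⟩, h⟩

theorem Ok.next (hL : L.Ok ρ) (hρ : Irrational ρ) : ∃ a, (L.next a).Ok ρ := by
  obtain ⟨b, qA, pA, qB, pB⟩ := L
  cases b
  · obtain ⟨a, -, h⟩ := RState.next hL hρ.neg
    exact ⟨a, by simpa [Ok, Lev.next] using h⟩
  · obtain ⟨a, -, h⟩ := RState.next hL hρ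
    exact ⟨a, by simpa [Ok, Lev.next] using h⟩

theorem Ok.short_pos (hL : L.Ok ρ) : 0 < L.short ρ := RState.pos hL

theorem Ok.short_lt (hL : L.Ok ρ) : L.short ρ < L.long ρ := RState.lt hL

theorem long_next (a : ℕ) : (L.next a).long ρ = L.short ρ := by
  obtain ⟨b, qA, pA, qB, pB⟩ := L
  cases b <;> simp [long, short, next] <;> ring

theorem Ok.width (hL : L.Ok ρ) {u v : ℝ} (h : L.gap ρ u v) :
    L.short ρ ≤ v - u ∧ v - u ≤ L.long ρ := by
  obtain ⟨b, qA, pA, qB, pB⟩ := L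
  cases b
  · have h1 := RGap.width hL h
    have h2 := RGap.width_le hL h
    simp only [short, long, cond_false] at h1 h2 ⊢
    constructor <;> linarith
  · exact ⟨RGap.width hL h, RGap.width_le hL h⟩

theorem exists_right {u v : ℝ} (h : L.gap ρ u v) : ∃ w, L.gap ρ v w := by
  obtain ⟨b, qA, pA, qB, pB⟩ := L
  cases b
  · obtain ⟨i, hi, m, e⟩ := RGap.left_mem h
    obtain ⟨w, hw⟩ := RGap.exists_left (ρ := -ρ) qB pA pB hi m
    exact ⟨-w, by simpa [gap, e] using hw⟩
  · obtain ⟨i, hi, m, e⟩ := RGap.right_mem h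
    obtain ⟨w, hw⟩ := RGap.exists_right (ρ := ρ) qA pA pB hi m
    exact ⟨w, by simpa [gap, e] using hw⟩

theorem exists_left {u v : ℝ} (h : L.gap ρ u v) : ∃ w, L.gap ρ w u := by
  obtain ⟨b, qA, pA, qB, pB⟩ := L
  cases b
  · obtain ⟨i, hi, m, e⟩ := RGap.right_mem h
    obtain ⟨w, hw⟩ := RGap.exists_right (ρ := -ρ) qA pA pB hi m
    exact ⟨-w, by simpa [gap, e] using hw⟩
  · obtain ⟨i, hi, m, e⟩ := RGap.left_mem h
    obtain ⟨w, hw⟩ := RGap.exists_left (ρ := ρ) qB pA pB hi m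
    exact ⟨w, by simpa [gap, e] using hw⟩

theorem Ok.cover (hL : L.Ok ρ) (t : ℝ) : ∃ u v, L.gap ρ u v ∧ u ≤ t ∧ t < v := by
  have hc : ∃ u v, L.gap ρ u v ∧ u ≤ t ∧ t ≤ v := by
    obtain ⟨b, qA, pA, qB, pB⟩ := L
    cases b
    · obtain ⟨u, v, h, h1, h2⟩ := RGap.cover hL (-t)
      exact ⟨-v, -u, by simpa [gap] using h, by linarith, by linarith⟩
    · exact RGap.cover hL t
  obtain ⟨u, v, h, h1, h2⟩ := hc
  rcases h2.lt_or_eq with h2 | rfl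
  · exact ⟨u, v, h, h1, h2⟩
  · obtain ⟨w, hw⟩ := exists_right h
    exact ⟨t, w, hw, le_rfl, by linarith [hL.short_pos, (hL.width hw).1]⟩

theorem Ok.sep (hL : L.Ok ρ) {u v u' v' : ℝ} (h : L.gap ρ u v) (h' : L.gap ρ u' v') :
    ¬(u < u' ∧ u' < v) ∧ ¬(u < v' ∧ v' < v) := by
  obtain ⟨b, qA, pA, qB, pB⟩ := L
  cases b
  · obtain ⟨i, hi, m, e⟩ := RGap.left_mem h'
    obtain ⟨i', hi', m', e'⟩ := RGap.right_mem h'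
    refine ⟨fun h1 => RGap.not_between hL h (i := i') (m := m') hi' ?_,
      fun h1 => RGap.not_between hL h (i := i) (m := m) hi ?_⟩ <;>
    simp only [cond_false] <;> constructor <;> linarith [h1.1, h1.2]
  · obtain ⟨i, hi, m, e⟩ := RGap.left_mem h'
    obtain ⟨i', hi', m', e'⟩ := RGap.right_mem h'
    exact ⟨fun h1 => RGap.not_between hL h (i := i) (m := m) hi (e ▸ h1),
      fun h1 => RGap.not_between hL h (i := i') (m := m') hi' (e' ▸ h1)⟩

end Lev

namespace Coord
variable {F G : ℝ → ℝ} {c d c' d' ρ : ℝ} {X Y : ℝ → ℝ}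

theorem lev_adj (h : Coord F c d ρ X) : ∃ C : ℝ, 1 ≤ C ∧ ∀ L : Lev, L.Ok ρ → ∀ u t w,
    L.gap ρ u t → L.gap ρ t w → X w - X t ≤ C * (X t - X u) ∧ X t - X u ≤ C * (X w - X t) := by
  obtain ⟨C₁, h1, H1⟩ := h.gap_adj
  obtain ⟨C₂, h2, H2⟩ := h.reflect.gap_adj
  refine ⟨max C₁ C₂, h1.trans (le_max_left _ _), fun L hL u t w hu hw => ?_⟩
  have s1 : 0 ≤ X t - X u := by
    have := hL.short_pos
    exact sub_nonneg.2 (h.mono'.monotone (by linarith [(hL.width hu).1]))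
  have s2 : 0 ≤ X w - X t := by
    have := hL.short_pos
    exact sub_nonneg.2 (h.mono'.monotone (by linarith [(hL.width hw).1]))
  have key : ∀ C ≤ max C₁ C₂, X w - X t ≤ C * (X t - X u) ∧ X t - X u ≤ C * (X w - X t) →
      X w - X t ≤ max C₁ C₂ * (X t - X u) ∧ X t - X u ≤ max C₁ C₂ * (X w - X t) :=
    fun C hC e => ⟨e.1.trans (by gcongr), e.2.trans (by gcongr)⟩
  obtain ⟨b, qA, pA, qB, pB⟩ := L
  cases b
  · refine key C₂ (le_max_right _ _) ?_
    have := H2 hL _ _ _ hw hu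
    simp only [neg_neg] at this
    constructor <;> linarith [this.1, this.2]
  · exact key C₁ (le_max_left _ _) (H1 hL _ _ _ hu hw)

theorem lev_nest (h : Coord F c d ρ X) (k : Coord G c' d' ρ Y) : ∃ C : ℝ, 1 ≤ C ∧
    ∀ (L : Lev) a, L.Ok ρ → (L.next a).Ok ρ → ∀ u v, (L.next a).gap ρ u v →
    ∃ u' v', L.gap ρ u' v' ∧ u' ≤ u ∧ v ≤ v' ∧
    (X v - X u) * (Y v' - Y u') ≤ C * ((Y v - Y u) * (X v' - X u')) ∧
    (Y v - Y u) * (X v' - X u') ≤ C * ((X v - X u) * (Y v' - Y u')) := by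
  obtain ⟨C₁, h1, H1⟩ := h.gap_nest k
  obtain ⟨C₂, h2, H2⟩ := h.reflect.gap_nest k.reflect
  refine ⟨max C₁ C₂, h1.trans (le_max_left _ _), fun L a hL hL' u v huv => ?_⟩
  have hlt : u ≤ v := by linarith [hL'.short_pos, (hL'.width huv).1]
  have x1 := sub_nonneg.2 (h.mono'.monotone hlt)
  have y1 := sub_nonneg.2 (k.mono'.monotone hlt)
  obtain ⟨b, qA, pA, qB, pB⟩ := L
  cases b
  · obtain ⟨u', v', g, e1, e2, r1, r2⟩ := H2 hL (by simpa [Lev.Ok, Lev.next] using hL') (-v) (-u)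
      (by simpa [Lev.gap, Lev.next] using huv)
    have hle : -v' ≤ -u' := by linarith
    have x2 := sub_nonneg.2 (h.mono'.monotone hle)
    have y2 := sub_nonneg.2 (k.mono'.monotone hle)
    refine ⟨-v', -u', by simpa [Lev.gap] using g, by linarith, by linarith, ?_, ?_⟩
    · simp only [neg_neg, neg_sub_neg] at r1
      exact r1.trans (mul_le_mul_of_nonneg_right (le_max_right _ _) (by positivity))
    · simp only [neg_neg, neg_sub_neg] at r2
      exact r2.trans (mul_le_mul_of_nonneg_right (le_max_right _ _) (by positivity))
  · obtain ⟨u', v', g, e1, e2, r1, r2⟩ := H1 hL (by simpa [Lev.Ok, Lev.next] using hL') u v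
      (by simpa [Lev.gap, Lev.next] using huv)
    have hle : u' ≤ v' := by linarith
    have x2 := sub_nonneg.2 (h.mono'.monotone hle)
    have y2 := sub_nonneg.2 (k.mono'.monotone hle)
    exact ⟨u', v', g, e1, e2,
      r1.trans (mul_le_mul_of_nonneg_right (le_max_left _ _) (by positivity)),
      r2.trans (mul_le_mul_of_nonneg_right (le_max_left _ _) (by positivity))⟩

theorem exists_grid (h : Coord F c d ρ X) (k : Coord G c' d' ρ Y) : ∃ Gp C, Grid Gp X Y C := by
  obtain ⟨C₁, h1, H1⟩ := h.lev_adj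
  obtain ⟨C₂, h2, H2⟩ := k.lev_adj
  obtain ⟨C₃, h3, H3⟩ := h.lev_nest k
  obtain ⟨L₀, hL₀⟩ := Lev.exists_ok h.irr
  choose a ha using fun L : {L : Lev // L.Ok ρ} => L.2.next h.irr
  set nx : {L : Lev // L.Ok ρ} → {L : Lev // L.Ok ρ} := fun L => ⟨L.1.next (a L), ha L⟩ with hnx
  set S : ℕ → {L : Lev // L.Ok ρ} := fun n => nx^[n] ⟨L₀, hL₀⟩ with hS
  have hsucc : ∀ n, (S (n + 1)).1 = (S n).1.next (a (S n)) := fun n => by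
    simp only [hS, Function.iterate_succ_apply', hnx]
  have c1 : C₁ ≤ max (max C₁ C₂) C₃ := (le_max_left _ _).trans (le_max_left _ _)
  have c2 : C₂ ≤ max (max C₁ C₂) C₃ := (le_max_right _ _).trans (le_max_left _ _)
  have c3 : C₃ ≤ max (max C₁ C₂) C₃ := le_max_right _ _
  set C := max (max C₁ C₂) C₃
  have hlt : ∀ {n u v}, (S n).1.gap ρ u v → u ≤ v := fun {n u v} huv => by
    linarith [(S n).2.short_pos, ((S n).2.width huv).1]
  have pX : ∀ {n u v}, (S n).1.gap ρ u v → 0 ≤ X v - X u := fun huv =>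
    sub_nonneg.2 (h.mono'.monotone (hlt huv))
  have pY : ∀ {n u v}, (S n).1.gap ρ u v → 0 ≤ Y v - Y u := fun huv =>
    sub_nonneg.2 (k.mono'.monotone (hlt huv))
  have adj : ∀ n u t w, (S n).1.gap ρ u t → (S n).1.gap ρ t w →
      X w - X t ≤ C * (X t - X u) ∧ X t - X u ≤ C * (X w - X t) ∧
      Y w - Y t ≤ C * (Y t - Y u) ∧ Y t - Y u ≤ C * (Y w - Y t) := fun n u t w hu hw => by
    have e1 := H1 _ (S n).2 u t w hu hw
    have e2 := H2 _ (S n).2 u t w hu hw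
    exact ⟨e1.1.trans (mul_le_mul_of_nonneg_right c1 (pX hu)),
      e1.2.trans (mul_le_mul_of_nonneg_right c1 (pX hw)),
      e2.1.trans (mul_le_mul_of_nonneg_right c2 (pY hu)),
      e2.2.trans (mul_le_mul_of_nonneg_right c2 (pY hw))⟩
  refine ⟨fun n => (S n).1.gap ρ, C, ?_⟩
  exact {
    one_le := h1.trans c1
    monoX := h.mono'
    monoY := k.mono'
    cover := fun n t => (S n).2.cover t
    width := fun n => ⟨(S n).1.short ρ, (S n).2.short_pos, fun u v huv => ((S n).2.width huv).1⟩
    base := by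
      obtain ⟨δ, hδ, hl⟩ := h.exists_lower (S 0).2.short_pos
      refine ⟨δ, hδ, fun u v huv => ?_⟩
      simpa using hl _ ((S 0).2.width huv).1 u
    sep := fun n u v u' v' => (S n).2.sep
    right := fun n u v huv => by
      obtain ⟨w, hw⟩ := Lev.exists_right huv
      exact ⟨w, hw, adj n u v w huv hw⟩
    left := fun n u v huv => by
      obtain ⟨w, hw⟩ := Lev.exists_left huv
      have := adj n w u v hw huv
      exact ⟨w, hw, this.2.1, this.1, this.2.2.2, this.2.2.1⟩
    nest := fun n u v huv => by
      have hn := (S (n + 1)).2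
      rw [hsucc] at huv hn
      obtain ⟨u', v', g, e1, e2, r1, r2⟩ := H3 _ _ (S n).2 hn u v huv
      have x1 := pX g
      have y1 := pY g
      have x2 := sub_nonneg.2 (h.mono'.monotone (hlt (n := n + 1) (by rwa [hsucc])) : X u ≤ X v)
      have y2 := sub_nonneg.2 (k.mono'.monotone (hlt (n := n + 1) (by rwa [hsucc])) : Y u ≤ Y v)
      exact ⟨u', v', g, e1, e2, r1.trans (mul_le_mul_of_nonneg_right c3 (by positivity)),
        r2.trans (mul_le_mul_of_nonneg_right c3 (by positivity))⟩
    shrink := fun n u v u' v' huv huv' => by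
      have a1 := ((S (n + 2)).2.width huv).2
      have a2 := ((S n).2.width huv').1
      have a3 := (S (n + 1)).2.short_lt
      have a4 : (S (n + 2)).1.long ρ = (S (n + 1)).1.short ρ := by
        rw [hsucc (n + 1), Lev.long_next]
      have a5 : (S (n + 1)).1.long ρ = (S n).1.short ρ := by rw [hsucc n, Lev.long_next]
      linarith }

/-- Quasisymmetry of the change of coordinates `Y ∘ X⁻¹`, up to a fixed scale. -/
theorem qs_small (h : Coord F c d ρ X) (k : Coord G c' d' ρ Y) : ∃ M ≥ 1, ∃ D₀ > 0,
    ∀ r s t, r < s → X s - X r = X t - X s → X s - X r ≤ D₀ →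
      Y s - Y r ≤ M * (Y t - Y s) ∧ Y t - Y s ≤ M * (Y s - Y r) := by
  obtain ⟨Gp, C, g⟩ := h.exists_grid k
  obtain ⟨K, hK, D₀, hD, H⟩ := g.local_qs
  refine ⟨K * K, one_le_mul_of_one_le_of_one_le hK hK, D₀, hD, fun r s t hrs he hle => ?_⟩
  obtain ⟨l, hl, H⟩ := H s (X s - X r) (sub_pos.2 (h.mono' hrs)) hle
  have h1 := H r s rfl (Or.inr rfl)
  have h2 := H s t he.symm (Or.inl rfl)
  have hK0 : 0 ≤ K := by linarith
  constructor
  · calc _ ≤ K * (l * (X s - X r)) := h1.2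
      _ ≤ K * (K * (Y t - Y s)) := mul_le_mul_of_nonneg_left h2.1 hK0
      _ = _ := by ring
  · calc _ ≤ K * (l * (X s - X r)) := h2.2
      _ ≤ K * (K * (Y s - Y r)) := mul_le_mul_of_nonneg_left h1.1 hK0
      _ = _ := by ring

theorem sub_lt_add_one (h : Coord F c d ρ X) (u v : ℝ) :
    X v - X u < v - u + 1 ∧ v - u - 1 < X v - X u := by
  have e1 := h.mono'.monotone (show u + (⌊v - u⌋ : ℝ) ≤ v by linarith [Int.floor_le (v - u)])
  have e2 := h.mono' (show v < u + ((⌊v - u⌋ + 1 : ℤ) : ℝ) by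
    push_cast; linarith [Int.lt_floor_add_one (v - u)])
  rw [h.add_int] at e1 e2
  push_cast at e2
  constructor <;> linarith [Int.floor_le (v - u), Int.lt_floor_add_one (v - u)]

theorem le_of_long {a b D η : ℝ} (hη : 0 < η) (hb : η ≤ b) (ha : a < D + 2) (hb' : D - 2 < b) :
    a ≤ (1 + 4 / η) * b := by
  have : 4 ≤ 4 / η * b := by
    rw [div_mul_eq_mul_div, le_div_iff₀ hη]; linarith
  linarith

/-- Quasisymmetry of the change of coordinates `Y ∘ X⁻¹`. -/
theorem qs (h : Coord F c d ρ X) (k : Coord G c' d' ρ Y) : ∃ M ≥ 1,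
    ∀ r s t, r < s → X s - X r = X t - X s →
      Y s - Y r ≤ M * (Y t - Y s) ∧ Y t - Y s ≤ M * (Y s - Y r) := by
  obtain ⟨M, hM, D₀, hD, H⟩ := h.qs_small k
  obtain ⟨δ, hδ, hun⟩ := h.exists_uniform hD
  obtain ⟨η, hη, hlow⟩ := k.exists_lower hδ
  refine ⟨max M (1 + 4 / η), hM.trans (le_max_left _ _), fun r s t hrs he => ?_⟩
  have hst : s < t := h.mono'.lt_iff_lt.1 (by linarith [h.mono' hrs])
  have p1 := sub_pos.2 (k.mono' hrs)
  have p2 := sub_pos.2 (k.mono' hst)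
  rcases le_or_gt (X s - X r) D₀ with hle | hgt
  · obtain ⟨h1, h2⟩ := H r s t hrs he hle
    exact ⟨h1.trans (mul_le_mul_of_nonneg_right (le_max_left _ _) p2.le),
      h2.trans (mul_le_mul_of_nonneg_right (le_max_left _ _) p1.le)⟩
  · have l1 : δ ≤ s - r := by
      by_contra hc
      have := hun (s - r) (not_le.1 hc) r
      rw [add_sub_cancel] at this
      linarith
    have l2 : δ ≤ t - s := by
      by_contra hc
      have := hun (t - s) (not_le.1 hc) s
      rw [add_sub_cancel] at this
      linarith
    have m1 := hlow _ l1 r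
    have m2 := hlow _ l2 s
    rw [add_sub_cancel] at m1 m2
    have x1 := h.sub_lt_add_one r s
    have x2 := h.sub_lt_add_one s t
    have y1 := k.sub_lt_add_one r s
    have y2 := k.sub_lt_add_one s t
    constructor
    · exact (le_of_long (D := X s - X r) hη m2 (by linarith) (by linarith)).trans
        (mul_le_mul_of_nonneg_right (le_max_right _ _) p2.le)
    · exact (le_of_long (D := X s - X r) hη m1 (by linarith) (by linarith)).trans
        (mul_le_mul_of_nonneg_right (le_max_right _ _) p1.le)

end Coord

/-- Signed displacement of `x` from the nearest point of `c + ℤ`. -/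
def critDisp (c x : ℝ) : ℝ := x - c - round (x - c)

theorem abs_critDisp_le (c x : ℝ) : |critDisp c x| ≤ 1 / 2 := abs_sub_round (x - c)

theorem abs_critDisp_le_abs_add (c x y : ℝ) : |critDisp c y| ≤ |critDisp c x| + |y - x| := by
  have h1 : |critDisp c y| ≤ |y - c - round (x - c)| := round_le (y - c) (round (x - c))
  have h2 : y - c - round (x - c) = critDisp c x + (y - x) := by unfold critDisp; ring
  rw [h2] at h1
  exact h1.trans (abs_add_le _ _)

namespace UC
variable {F : ℝ → ℝ} {c d : ℝ}

theorem deriv_power_near (h : UC F c d) : ∃ δ > 0, ∃ m > 0, ∃ M > 0, δ < 1 / 4 ∧ ∀ t, |t| ≤ δ →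
    deriv F (c + t) ≤ M * |t| ^ (d - 1) ∧ m * |t| ^ (d - 1) ≤ deriv F (c + t) := by
  obtain ⟨δ, hδ, hδ4, φ, W, hW, hsub, hφ, hpos, hφc, hF⟩ := h.normal_form
  have hd := h.one_lt
  have hdφ : ∀ y ∈ W, DifferentiableAt ℝ φ y := fun y hy =>
    (hφ.contDiffAt (hW.mem_nhds hy)).differentiableAt (by norm_num)
  have c1 : ContinuousOn (deriv φ) (Icc (c - δ) (c + δ)) :=
    (hφ.deriv_of_isOpen (m := 2) hW (by norm_num)).continuousOn.mono hsub
  obtain ⟨t0, ht0, hmin⟩ := isCompact_Icc.exists_isMinOn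
    (nonempty_Icc.2 (by linarith : c - δ ≤ c + δ)) c1
  obtain ⟨t1, ht1, hmax⟩ := isCompact_Icc.exists_isMaxOn
    (nonempty_Icc.2 (by linarith : c - δ ≤ c + δ)) c1
  set m := deriv φ t0
  set M := deriv φ t1
  have hm : 0 < m := hpos t0 ht0
  have hM : 0 < M := hpos t1 ht1
  have hcm : c ∈ Icc (c - δ) (c + δ) := ⟨by linarith, by linarith⟩
  have dwa : DifferentiableOn ℝ φ (interior (Icc (c - δ) (c + δ))) := fun t ht =>
    (hdφ t (hsub (interior_subset ht))).differentiableWithinAt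
  have low := fun x hx y hy hxy => (convex_Icc (c - δ) (c + δ)).mul_sub_le_image_sub_of_le_deriv
    (hφ.continuousOn.mono hsub) dwa (C := m) (fun t ht => hmin (interior_subset ht)) x hx y hy hxy
  have up := fun x hx y hy hxy => (convex_Icc (c - δ) (c + δ)).image_sub_le_mul_sub_of_deriv_le
    (hφ.continuousOn.mono hsub) dwa (C := M) (fun t ht => hmax (interior_subset ht)) x hx y hy hxy
  refine ⟨δ, hδ, d * m ^ (d - 1) * m, by positivity, d * M ^ (d - 1) * M, by positivity, hδ4,
    fun t ht => ?_⟩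
  have hmem : c + t ∈ Icc (c - δ) (c + δ) := by
    rw [abs_le] at ht; constructor <;> linarith
  have hder : deriv F (c + t) = d * |φ (c + t)| ^ (d - 1) * deriv φ (c + t) := by
    have h1 : HasDerivAt (fun y => F c + Pw d (φ y))
        (d * |φ (c + t)| ^ (d - 1) * deriv φ (c + t)) (c + t) :=
      ((hasDerivAt_Pw hd _).comp (c + t) (hdφ _ (hsub hmem)).hasDerivAt).const_add _
    refine (h1.congr_of_eventuallyEq ?_).deriv
    filter_upwards [hW.mem_nhds (hsub hmem)] with y hy using hF y hy
  have hb : m * |t| ≤ |φ (c + t)| ∧ |φ (c + t)| ≤ M * |t| := by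
    rcases le_total 0 t with h0 | h0
    · have a1 := low c hcm (c + t) hmem (by linarith)
      have a2 := up c hcm (c + t) hmem (by linarith)
      rw [hφc, add_sub_cancel_left, sub_zero] at a1 a2
      rw [abs_of_nonneg h0, abs_of_nonneg (le_trans (by positivity) a1)]
      exact ⟨a1, a2⟩
    · have a1 := low (c + t) hmem c hcm (by linarith)
      have a2 := up (c + t) hmem c hcm (by linarith)
      rw [hφc] at a1 a2
      have : 0 ≤ m * -t := mul_nonneg hm.le (by linarith)
      rw [abs_of_nonpos h0, abs_of_nonpos (by linarith)]
      constructor <;> linarith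
  have q1 := Real.rpow_le_rpow (by positivity) hb.1 (by linarith : 0 ≤ d - 1)
  have q2 := Real.rpow_le_rpow (by positivity) hb.2 (by linarith : 0 ≤ d - 1)
  rw [Real.mul_rpow (by positivity) (by positivity)] at q1 q2
  have e1 : m ≤ deriv φ (c + t) := hmin hmem
  have e2 : deriv φ (c + t) ≤ M := hmax hmem
  rw [hder]
  constructor
  · have e3 := hm.le.trans e1
    calc d * |φ (c + t)| ^ (d - 1) * deriv φ (c + t)
        ≤ d * (M ^ (d - 1) * |t| ^ (d - 1)) * M := by gcongr
      _ = _ := by ring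
  · calc d * m ^ (d - 1) * m * |t| ^ (d - 1) = d * (m ^ (d - 1) * |t| ^ (d - 1)) * m := by ring
      _ ≤ d * |φ (c + t)| ^ (d - 1) * deriv φ (c + t) := by gcongr

theorem deriv_power (h : UC F c d) : ∃ m > 0, ∃ M > 0, ∀ x,
    deriv F x ≤ M * |critDisp c x| ^ (d - 1) ∧ m * |critDisp c x| ^ (d - 1) ≤ deriv F x := by
  obtain ⟨δ, hδ, m, hm, M, hM, hδ4, hnear⟩ := h.deriv_power_near
  obtain ⟨M', hM', hup⟩ := h.deriv_bound
  have hd : 0 ≤ d - 1 := by linarith [h.one_lt]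
  have hcont : Continuous (deriv F) := h.smooth.continuous_deriv (by norm_num)
  have hcpt : IsCompact (Icc (c + δ) (c + (1 - δ))) := isCompact_Icc
  obtain ⟨p, hp, hmin⟩ := hcpt.exists_isMinOn (nonempty_Icc.2 (by linarith)) hcont.continuousOn
  have hp0 : 0 < deriv F p := by
    refine lt_of_le_of_ne (h.deriv_nonneg p) fun h0 => ?_
    obtain ⟨n, hn⟩ := (h.crit p).1 h0.symm
    have h1 : (0 : ℝ) < (n : ℝ) := by linarith [hp.1]
    have h2 : (n : ℝ) < 1 := by linarith [hp.2]
    have h3 : 0 < n := by exact_mod_cast h1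
    have h4 : n < 1 := by exact_mod_cast h2
    omega
  have hδd : 0 < δ ^ (d - 1) := Real.rpow_pos_of_pos hδ _
  refine ⟨min m (deriv F p), lt_min hm hp0, max M (M' / δ ^ (d - 1)), lt_max_of_lt_left hM,
    fun x => ?_⟩
  have hle := abs_critDisp_le c x
  have hx : deriv F x = deriv F (c + critDisp c x) := by
    rw [← h.deriv_per (c + critDisp c x) (round (x - c))]
    congr 1
    unfold critDisp
    ring
  have hnn : 0 ≤ |critDisp c x| ^ (d - 1) := by positivity
  rcases le_or_gt |critDisp c x| δ with hs | hs
  · rw [hx]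
    obtain ⟨h1, h2⟩ := hnear _ hs
    exact ⟨h1.trans (mul_le_mul_of_nonneg_right (le_max_left _ _) hnn),
      (mul_le_mul_of_nonneg_right (min_le_left _ _) hnn).trans h2⟩
  · constructor
    · calc deriv F x ≤ M' := hup x
        _ = M' / δ ^ (d - 1) * δ ^ (d - 1) := by field_simp
        _ ≤ max M (M' / δ ^ (d - 1)) * |critDisp c x| ^ (d - 1) :=
          mul_le_mul (le_max_right _ _) (Real.rpow_le_rpow hδ.le hs.le hd) hδd.le
            (by positivity)
    · have hone : |critDisp c x| ^ (d - 1) ≤ 1 :=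
        Real.rpow_le_one (abs_nonneg _) (by linarith) hd
      have hlow : deriv F p ≤ deriv F x := by
        rw [hx]
        rcases le_total 0 (critDisp c x) with h0 | h0
        · rw [abs_of_nonneg h0] at hs hle
          exact hmin ⟨by linarith, by linarith⟩
        · rw [abs_of_nonpos h0] at hs hle
          rw [← h.deriv_per (c + critDisp c x) 1]
          push_cast
          exact hmin ⟨by linarith, by linarith⟩
      calc _ ≤ deriv F p * 1 := mul_le_mul (min_le_right _ _) hone hnn hp0.le
        _ ≤ _ := by linarith

theorem le_sub_of_le_critDisp (h : UC F c d) {m s x y : ℝ} (hm : 0 < m) (hs : 0 ≤ s)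
    (hlow : ∀ x, m * |critDisp c x| ^ (d - 1) ≤ deriv F x) (hxy : x ≤ y)
    (hN : ∀ t ∈ Icc x y, s ≤ |critDisp c t|) : m * s ^ (d - 1) * (y - x) ≤ F y - F x := by
  refine (convex_Icc x y).mul_sub_le_image_sub_of_le_deriv h.continuous.continuousOn
    h.differentiable.differentiableOn (fun t ht => ?_) x ⟨le_rfl, hxy⟩ y ⟨hxy, le_rfl⟩ hxy
  refine le_trans ?_ (hlow t)
  have := hN t (interior_subset ht)
  have hd : 0 ≤ d - 1 := by linarith [h.one_lt]
  gcongr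

theorem sub_le_of_critDisp_le (h : UC F c d) {M s x y : ℝ} (hM : 0 < M)
    (hup : ∀ x, deriv F x ≤ M * |critDisp c x| ^ (d - 1)) (hxy : x ≤ y)
    (hN : ∀ t ∈ Icc x y, |critDisp c t| ≤ s) : F y - F x ≤ M * s ^ (d - 1) * (y - x) := by
  refine (convex_Icc x y).image_sub_le_mul_sub_of_deriv_le h.continuous.continuousOn
    h.differentiable.differentiableOn (fun t ht => ?_) x ⟨le_rfl, hxy⟩ y ⟨hxy, le_rfl⟩ hxy
  refine (hup t).trans ?_
  have := hN t (interior_subset ht)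
  have hd : 0 ≤ d - 1 := by linarith [h.one_lt]
  gcongr

theorem exists_quarter {c x y : ℝ} (hxy : x < y) (hl : y - x ≤ 1 / 2) :
    (∀ t ∈ Icc x (x + (y - x) / 4), (y - x) / 8 ≤ |critDisp c t|) ∨
      ∀ t ∈ Icc (y - (y - x) / 4) y, (y - x) / 8 ≤ |critDisp c t| := by
  by_contra hcon
  push Not at hcon
  obtain ⟨⟨t, ht, h1⟩, ⟨u, hu, h2⟩⟩ := hcon
  unfold critDisp at h1 h2
  rw [abs_lt] at h1 h2
  have e1 : (0 : ℝ) < ((round (u - c) - round (t - c) : ℤ) : ℝ) := by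
    push_cast; linarith [ht.2, hu.1]
  have e2 : ((round (u - c) - round (t - c) : ℤ) : ℝ) < 1 := by
    push_cast; linarith [ht.1, hu.2]
  have e3 : 0 < round (u - c) - round (t - c) := by exact_mod_cast e1
  have e4 : round (u - c) - round (t - c) < 1 := by exact_mod_cast e2
  omega

theorem lower_short (h : UC F c d) {m : ℝ} (hm : 0 < m)
    (hlow : ∀ x, m * |critDisp c x| ^ (d - 1) ≤ deriv F x) {x y : ℝ} (hxy : x < y)
    (hl : y - x ≤ 1 / 2) :
    m * ((|critDisp c y| + (y - x)) / 16) ^ (d - 1) * ((y - x) / 4) ≤ F y - F x := by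
  have hd : 0 ≤ d - 1 := by linarith [h.one_lt]
  have hp : 0 < y - x := sub_pos.2 hxy
  have hN := abs_nonneg (critDisp c y)
  rcases le_or_gt (y - x) |critDisp c y| with hb | hb
  · have := h.le_sub_of_le_critDisp (s := (|critDisp c y| + (y - x)) / 16) (x := y - (y - x) / 4)
      (y := y) hm (by positivity) hlow (by linarith) (fun t ht => by
        have := abs_critDisp_le_abs_add c t y
        rw [abs_of_nonneg (show 0 ≤ y - t by linarith [ht.2])] at this
        linarith [ht.1])
    rw [sub_sub_cancel] at this
    linarith [h.mono.monotone (show x ≤ y - (y - x) / 4 by linarith)]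
  · have hmono : m * ((|critDisp c y| + (y - x)) / 16) ^ (d - 1) * ((y - x) / 4) ≤
        m * ((y - x) / 8) ^ (d - 1) * ((y - x) / 4) := by
      have : (|critDisp c y| + (y - x)) / 16 ≤ (y - x) / 8 := by linarith
      gcongr
    refine hmono.trans ?_
    rcases exists_quarter (c := c) hxy hl with hq | hq
    · have := h.le_sub_of_le_critDisp hm (by positivity) hlow (by linarith) hq
      rw [add_sub_cancel_left] at this
      linarith [h.mono.monotone (show x + (y - x) / 4 ≤ y by linarith)]
    · have := h.le_sub_of_le_critDisp hm (by positivity) hlow (by linarith) hq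
      rw [sub_sub_cancel] at this
      linarith [h.mono.monotone (show x ≤ y - (y - x) / 4 by linarith)]

theorem sub_lt_add_one (h : UC F c d) (x y : ℝ) : F y - F x < y - x + 1 := by
  have e2 := h.mono (show y < x + ((⌊y - x⌋ + 1 : ℤ) : ℝ) by
    push_cast; linarith [Int.lt_floor_add_one (y - x)])
  rw [h.per_int] at e2
  push_cast at e2
  linarith [Int.floor_le (y - x)]

/-- Comparability of an interval with its left neighbour passes to the images under `F`. -/
theorem qs_right (h : UC F c d) {K : ℝ} (hK : 1 ≤ K) : ∃ K' ≥ 1, ∀ x y z, x < y → y ≤ z →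
    z - y ≤ K * (y - x) → F z - F y ≤ K' * (F y - F x) := by
  obtain ⟨m, hm, M, hM, hb⟩ := h.deriv_power
  obtain ⟨m', hm', hlong⟩ := h.lower_of_gap (δ := 1 / 2) (by norm_num) (by norm_num)
  have hd : 0 ≤ d - 1 := by linarith [h.one_lt]
  set K₁ := M / m * (4 * K) * (16 * K) ^ (d - 1) with hK₁
  set K₂ := (K + 2) / m' with hK₂
  refine ⟨max 1 (max K₁ K₂), le_max_left _ _, fun x y z hxy hyz hle => ?_⟩
  have hF := sub_pos.2 (h.mono hxy)
  have hp : 0 < y - x := sub_pos.2 hxy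
  rcases le_or_gt (y - x) (1 / 2) with hs | hs
  · refine le_trans ?_ (mul_le_mul_of_nonneg_right
      ((le_max_left K₁ K₂).trans (le_max_right _ _)) hF.le)
    have hN := abs_nonneg (critDisp c y)
    have h1 := h.lower_short hm (fun x => (hb x).2) hxy hs
    have h2 := h.sub_le_of_critDisp_le (s := K * (|critDisp c y| + (y - x))) hM
      (fun x => (hb x).1) hyz (fun t ht => by
        have := abs_critDisp_le_abs_add c y t
        rw [abs_of_nonneg (show 0 ≤ t - y by linarith [ht.1])] at this
        have : |critDisp c y| ≤ K * |critDisp c y| := le_mul_of_one_le_left hN hK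
        rw [mul_add]
        linarith [ht.2])
    set N := |critDisp c y| + (y - x) with hNdef
    have hN0 : 0 < N := by positivity
    have e : K * N = 16 * K * (N / 16) := by ring
    calc F z - F y ≤ M * (K * N) ^ (d - 1) * (z - y) := h2
      _ ≤ M * (K * N) ^ (d - 1) * (K * (y - x)) := by gcongr
      _ = K₁ * (m * (N / 16) ^ (d - 1) * ((y - x) / 4)) := by
        rw [e, Real.mul_rpow (by positivity) (by positivity), hK₁]
        field_simp
      _ ≤ K₁ * (F y - F x) := mul_le_mul_of_nonneg_left h1 (by positivity)
  · refine le_trans ?_ (mul_le_mul_of_nonneg_right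
      ((le_max_right K₁ K₂).trans (le_max_right _ _)) hF.le)
    have h1 := hlong x y hs.le
    have h2 := h.sub_lt_add_one y z
    calc F z - F y ≤ (K + 2) * (y - x) := by linarith
      _ = K₂ * (m' * (y - x)) := by rw [hK₂]; field_simp
      _ ≤ _ := mul_le_mul_of_nonneg_left h1 (by positivity)

theorem qs_left (h : UC F c d) {K : ℝ} (hK : 1 ≤ K) : ∃ K' ≥ 1, ∀ x y z, x ≤ y → y < z →
    y - x ≤ K * (z - y) → F y - F x ≤ K' * (F z - F y) := by
  obtain ⟨K', h1, H⟩ := h.reflect.qs_right hK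
  refine ⟨K', h1, fun x y z hxy hyz hle => ?_⟩
  have := H (-z) (-y) (-x) (by linarith) (by linarith) (by linarith)
  simp only [neg_neg] at this
  linarith

end UC

namespace Coord
variable {F G X Y : ℝ → ℝ} {c c' d d' ρ : ℝ}

/-- Quasisymmetry of the coordinate change with the second coordinate shifted along an orbit. -/
theorem qs_iterate (h : Coord F c d ρ X) (k : Coord G c' d' ρ Y) (n : ℕ) : ∃ M ≥ 1,
    ∀ r s t, r < s → X s - X r = X t - X s →
      Y (s + n * ρ) - Y (r + n * ρ) ≤ M * (Y (t + n * ρ) - Y (s + n * ρ)) ∧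
        Y (t + n * ρ) - Y (s + n * ρ) ≤ M * (Y (s + n * ρ) - Y (r + n * ρ)) := by
  induction n with
  | zero => simpa using h.qs k
  | succ n ih =>
    obtain ⟨M, hM, ih⟩ := ih
    obtain ⟨K, hK, h1⟩ := k.qs_right hM
    obtain ⟨L, hL, h2⟩ := k.qs_left hM
    refine ⟨max K L, hK.trans (le_max_left _ _), fun r s t hrs he => ?_⟩
    have hst : s < t := h.mono'.lt_iff_lt.1 (by linarith [h.mono' hrs])
    obtain ⟨a1, a2⟩ := ih r s t hrs he
    have e : ∀ u, Y (u + ((n + 1 : ℕ) : ℝ) * ρ) = G (Y (u + n * ρ)) := fun u => by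
      rw [k.conj]; congr 1; push_cast; ring
    have lt1 : Y (r + n * ρ) < Y (s + n * ρ) := k.mono' (by linarith)
    have lt2 : Y (s + n * ρ) < Y (t + n * ρ) := k.mono' (by linarith)
    rw [e, e, e]
    have p1 := sub_pos.2 (k.mono lt1)
    have p2 := sub_pos.2 (k.mono lt2)
    exact ⟨(h2 _ _ _ lt1.le lt2 a1).trans (mul_le_mul_of_nonneg_right (le_max_right _ _) p2.le),
      (h1 _ _ _ lt1 lt2.le a2).trans (mul_le_mul_of_nonneg_right (le_max_left _ _) p1.le)⟩

end Coord

/-! ### Lifts of circle maps -/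

theorem S1.coe_eq_coe_iff {x y : ℝ} : (x : S1) = (y : S1) ↔ ∃ m : ℤ, x = y + m := by
  rw [eq_comm, QuotientAddGroup.eq, AddSubgroup.mem_zmultiples_iff]
  constructor
  · rintro ⟨k, hk⟩
    exact ⟨k, by simp at hk; linarith⟩
  · rintro ⟨m, hm⟩
    exact ⟨m, by simp [hm]⟩

/-- Two continuous functions which agree modulo `1` differ by an integer constant. -/
theorem exists_int_of_coe_eq {P Q : ℝ → ℝ} (hP : Continuous P) (hQ : Continuous Q)
    (h : ∀ x, (P x : S1) = (Q x : S1)) : ∃ m : ℤ, ∀ x, P x = Q x + m := by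
  choose n hn using fun x => S1.coe_eq_coe_iff.1 (h x)
  have hc : Continuous n := by
    rw [Int.isClosedEmbedding_coe_real.continuous_iff]
    refine (hP.sub hQ).congr fun x => ?_
    have := hn x
    simp only [Pi.sub_apply, Function.comp]
    linarith
  exact ⟨n 0, fun x => by rw [hn x, PreconnectedSpace.constant inferInstance hc]⟩

/-- The circle map induced by a degree one map of the line. -/
def descend (H : ℝ → ℝ) (hH : ∀ x, H (x + 1) = H x + 1) : S1 → S1 :=
  Function.Periodic.lift (f := fun x : ℝ => (H x : S1)) (c := 1) fun x => by
    simp only [hH]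
    rw [S1.coe_eq_coe_iff]; exact ⟨1, by simp⟩

section
variable {H : ℝ → ℝ} (hH : ∀ x, H (x + 1) = H x + 1)

@[simp] theorem descend_coe (x : ℝ) : descend H hH (x : S1) = (H x : S1) := rfl

theorem continuous_descend (hc : Continuous H) : Continuous (descend H hH) :=
  continuous_coinduced_dom.2 ((AddCircle.continuous_mk' 1).comp hc)

theorem descend_injective (hm : StrictMono H) : Function.Injective (descend H hH) := by
  intro a b
  induction a using QuotientAddGroup.induction_on with | H x =>
  induction b using QuotientAddGroup.induction_on with | H y =>
  intro hab
  obtain ⟨m, hm'⟩ := S1.coe_eq_coe_iff.1 hab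
  have h2 := add_int_of_add_one hH y m
  exact S1.coe_eq_coe_iff.2 ⟨m, hm.injective (by rw [hm', h2, mul_one])⟩

theorem descend_surjective (hs : Function.Surjective H) :
    Function.Surjective (descend H hH) := by
  intro b
  induction b using QuotientAddGroup.induction_on with | H y =>
  obtain ⟨x, rfl⟩ := hs y
  exact ⟨x, rfl⟩

end

theorem IsLift.continuous {f : S1 → S1} {F : ℝ → ℝ} (h : IsLift f F) : Continuous F :=
  h.1.monotone.continuous_of_surjective h.2.1

theorem Irrational.denseRange_nsmul {ρ : ℝ} (hρ : Irrational ρ) :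
    DenseRange (fun n : ℕ => n • (ρ : S1)) := by
  rw [← denseRange_zsmul_iff_nsmul, AddCircle.denseRange_zsmul_coe_iff]
  simpa using hρ

theorem exists_coord_of_unicritical {f : S1 → S1} {cf : S1} {ρ : ℝ} (hf : Unicritical f cf 3)
    (hr : HasRotNum f ρ) (hρ : Irrational ρ) :
    ∃ (F X : ℝ → ℝ) (c d : ℝ), IsLift f F ∧ (c : S1) = cf ∧ Coord F c d ρ X := by
  obtain ⟨F₁, c, hl₁, hsm, hc, hcrit, d, hd, W, hW, hcW, φ, hφ, hinj, hder, hφc, hF₁⟩ := hf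
  obtain ⟨F, hl, hlim⟩ := hr
  obtain ⟨m, hm⟩ := exists_int_of_coe_eq hl.continuous hl₁.continuous fun x => by
    rw [← hl.2.2.2, hl₁.2.2.2]
  obtain rfl : F = fun x => F₁ x + m := funext hm
  have huc : UC (fun x => F₁ x + m) c d :=
    { mono := hl.1
      per := hl.2.2.1
      smooth := hsm.add contDiff_const
      crit := fun x => by
        rw [deriv_add_const]
        exact Set.ext_iff.1 hcrit x
      one_lt := hd
      nonflat := ⟨W, hW, hcW, φ, hφ, hinj, hder, hφc, fun y hy => by
        rw [hF₁ y hy, Pw]; ring⟩ }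
  let L : CircleDeg1Lift := ⟨⟨_, hl.1.monotone⟩, hl.2.2.1⟩
  have hτ : L.translationNumber = ρ := L.translationNumber_eq_of_tendsto₀ hlim
  obtain ⟨Φ, hΦ⟩ := CircleDeg1Lift.semiconj_of_isUnit_of_translationNumber_eq
    (f₁ := L) (f₂ := CircleDeg1Lift.translate (Multiplicative.ofAdd ρ))
    (CircleDeg1Lift.isUnit_iff_bijective.2 ⟨hl.1.injective, hl.2.1⟩) (Units.isUnit _)
    (by rw [hτ, CircleDeg1Lift.translationNumber_translate])
  have hcm : CM (fun x => F₁ x + m) c d ρ :=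
    { huc with
      irr := hρ
      semi := ⟨Φ, Φ.monotone, Φ.map_add_one, fun x => by
        have := hΦ x
        rw [CircleDeg1Lift.translate_apply] at this
        rw [add_comm _ ρ]
        exact this⟩ }
  obtain ⟨X, hX⟩ := hcm.exists_coord
  exact ⟨_, X, c, d, hl, hc, hX⟩

namespace Coord
variable {F X : ℝ → ℝ} {c d ρ : ℝ}

/-- The homeomorphism of the circle conjugating the rotation by `ρ` to the circle map. -/
def homeo (h : Coord F c d ρ X) : S1 ≃ₜ S1 :=
  Continuous.homeoOfEquivCompactToT2 (f := Equiv.ofBijective (descend X h.per')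
    ⟨descend_injective _ h.mono', descend_surjective _ h.surjective'⟩)
    (continuous_descend h.per' h.cont')

theorem homeo_coe (h : Coord F c d ρ X) (t : ℝ) : h.homeo (t : S1) = (X t : S1) := rfl

theorem homeo_add (h : Coord F c d ρ X) {f : S1 → S1} (hf : IsLift f F) (s : S1) :
    f (h.homeo s) = h.homeo (s + ρ) := by
  induction s using QuotientAddGroup.induction_on with | H t =>
  rw [h.homeo_coe, hf.2.2.2, h.conj]
  rfl

end Coord

namespace Coord
variable {F G X Y : ℝ → ℝ} {c c' d d' ρ : ℝ}

/-- The inverse of the coordinate `X`. -/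
def inv (h : Coord F c d ρ X) : ℝ ≃o ℝ := (h.mono'.orderIsoOfSurjective X h.surjective').symm

theorem inv_apply (h : Coord F c d ρ X) (t : ℝ) : h.inv (X t) = t :=
  (h.mono'.orderIsoOfSurjective X h.surjective').symm_apply_apply t

theorem apply_inv (h : Coord F c d ρ X) (x : ℝ) : X (h.inv x) = x :=
  (h.mono'.orderIsoOfSurjective X h.surjective').apply_symm_apply x

theorem inv_add_one (h : Coord F c d ρ X) (x : ℝ) : h.inv (x + 1) = h.inv x + 1 := by
  apply h.mono'.injective
  rw [h.per', h.apply_inv, h.apply_inv]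

/-- The conjugacy sending `X t` to `Y (t + n ρ)` is quasisymmetric. -/
theorem exists_quasiSymm (h : Coord F c d ρ X) (k : Coord G c' d' ρ Y) {f g : S1 → S1}
    (hf : IsLift f F) (hg : IsLift g G) (n : ℕ) :
    ∃ η : S1 → S1, QuasiSymm η ∧ η ∘ f = g ∘ η ∧ ∀ t : ℝ, η (X t : S1) = (Y (t + n * ρ) : S1) := by
  have hper : ∀ x, Y (h.inv (x + 1) + n * ρ) = Y (h.inv x + n * ρ) + 1 := fun x => by
    rw [h.inv_add_one, ← k.per']; congr 1; ring
  have hmono : StrictMono fun x => Y (h.inv x + n * ρ) := fun x y hxy =>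
    k.mono' (by linarith [h.inv.strictMono hxy])
  refine ⟨descend (fun x => Y (h.inv x + n * ρ)) hper, ⟨fun x => Y (h.inv x + n * ρ),
    ⟨hmono, fun y => ?_, hper, fun x => rfl⟩, ?_⟩, ?_, fun t => ?_⟩
  · obtain ⟨t, rfl⟩ := k.surjective' y
    exact ⟨X (t - n * ρ), by simp only [h.inv_apply]; congr 1; ring⟩
  · obtain ⟨M, hM, H⟩ := h.qs_iterate k n
    refine ⟨M + 1, by linarith, fun x t ht => ?_⟩
    obtain ⟨h1, h2⟩ := H (h.inv (x - t)) (h.inv x) (h.inv (x + t))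
      (h.inv.strictMono (by linarith)) (by simp only [h.apply_inv]; ring)
    have p1 := sub_pos.2 (hmono (show x - t < x by linarith))
    have p2 := sub_pos.2 (hmono (show x < x + t by linarith))
    simp only at p1 p2
    constructor
    · rw [div_le_div_iff₀ (by linarith) p1]; linarith
    · rw [div_le_iff₀ p1]; linarith
  · funext a
    induction a using QuotientAddGroup.induction_on with | H x =>
    have e : F x = X (h.inv x + ρ) := by rw [← h.conj, h.apply_inv]
    simp only [Function.comp]
    rw [hf.2.2.2, descend_coe, descend_coe, hg.2.2.2, k.conj, e, h.inv_apply]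
    congr 2; ring
  · rw [descend_coe, h.inv_apply]

theorem dense_quasiSymm (h : Coord F c d ρ X) (k : Coord G c' d' ρ Y) {f g : S1 → S1}
    (hf : IsLift f F) (hg : IsLift g G) :
    Dense {x : S1 | ∃ η : S1 → S1, QuasiSymm η ∧ η ∘ f = g ∘ η ∧ η x = (c' : S1)} := by
  have h1 : DenseRange fun n : ℕ => h.homeo (-(n • (ρ : S1))) :=
    (h.homeo.surjective.denseRange.comp (neg_surjective.denseRange.comp h.irr.denseRange_nsmul
      continuous_neg) h.homeo.continuous)
  refine Dense.mono ?_ h1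
  rintro _ ⟨n, rfl⟩
  obtain ⟨η, h2, h3, h4⟩ := h.exists_quasiSymm k hf hg n
  refine ⟨η, h2, h3, ?_⟩
  have e : -(n • (ρ : S1)) = ((-(n * ρ) : ℝ) : S1) := by
    rw [← nsmul_eq_mul]; rfl
  simp only [e]
  rw [h.homeo_coe, h4, neg_add_cancel, k.zero]

/-- Every conjugacy is a translation in the coordinates `X` and `Y`. -/
theorem exists_translation (h : Coord F c d ρ X) (k : Coord G c' d' ρ Y) {f g η : S1 → S1}
    {H : ℝ → ℝ} (hf : IsLift f F) (hg : IsLift g G) (hη : IsLift η H) (hc : η ∘ f = g ∘ η) :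
    ∃ (θ : ℝ) (m : ℤ), ∀ t, H (X t) = Y (t + θ) + m := by
  have hcont : Continuous η := by
    have e : η = descend H hη.2.2.1 := by
      funext a
      induction a using QuotientAddGroup.induction_on with | H x =>
      exact hη.2.2.2 x
    rw [e]
    exact continuous_descend _ hη.continuous
  set ζ : S1 → S1 := fun s => k.homeo.symm (η (h.homeo s)) with hζ
  have hζc : Continuous ζ := k.homeo.symm.continuous.comp (hcont.comp h.homeo.continuous)
  have hζρ : ∀ s, ζ (s + ρ) = ζ s + ρ := fun s => by
    apply k.homeo.injective
    rw [← k.homeo_add hg]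
    simp only [hζ, Homeomorph.apply_symm_apply]
    rw [← h.homeo_add hf]
    exact congrFun hc _
  have hζn : ∀ n : ℕ, ζ (n • (ρ : S1)) = n • (ρ : S1) + ζ 0 := fun n => by
    induction n with
    | zero => simp
    | succ n ih => rw [succ_nsmul, hζρ, ih]; abel
  have heq : ζ = fun s => s + ζ 0 :=
    h.irr.denseRange_nsmul.equalizer hζc (continuous_id.add continuous_const) (funext hζn)
  obtain ⟨θ, hθ⟩ := QuotientAddGroup.mk_surjective (ζ 0)
  obtain ⟨m, hm⟩ := exists_int_of_coe_eq (hη.continuous.comp h.cont')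
    (k.cont'.comp (continuous_id.add (continuous_const (y := θ)))) fun t => by
      have h1 := congrArg k.homeo (congrFun heq (t : S1))
      simp only [hζ, Homeomorph.apply_symm_apply] at h1
      rw [h.homeo_coe, hη.2.2.2] at h1
      simp only [Function.comp]
      rw [h1]
      change k.homeo ((t : S1) + ζ 0) = _
      rw [← hθ]
      rfl
  exact ⟨θ, m, hm⟩

theorem qs_multiple {H : ℝ → ℝ} {M : ℝ} (hH : StrictMono H)
    (hq : ∀ x t : ℝ, 0 < t → (H (x + t) - H x) / (H x - H (x - t)) ≤ M) (n : ℕ) :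
    ∃ K : ℝ, ∀ x t, 0 < t → H (x + n * t) - H x ≤ K * (H x - H (x - t)) := by
  suffices ∃ K : ℝ, 0 ≤ K ∧ ∃ L : ℝ, 0 ≤ L ∧ ∀ x t, 0 < t →
      H (x + n * t) - H x ≤ K * (H x - H (x - t)) ∧
      H (x + n * t) - H (x + n * t - t) ≤ L * (H x - H (x - t)) by
    obtain ⟨K, -, L, -, h⟩ := this
    exact ⟨K, fun x t ht => (h x t ht).1⟩
  have hq' : ∀ x t : ℝ, 0 < t → H (x + t) - H x ≤ M * (H x - H (x - t)) := fun x t ht => by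
    have := hq x t ht
    rwa [div_le_iff₀ (sub_pos.2 (hH (by linarith)))] at this
  have hM : 0 ≤ M := by
    have h1 := hq' 0 1 one_pos
    have h2 := hH (show (0 : ℝ) < 0 + 1 by norm_num)
    have h3 := hH (show (0 : ℝ) - 1 < 0 by norm_num)
    by_contra hc
    have := mul_nonpos_of_nonpos_of_nonneg (not_le.1 hc).le (sub_pos.2 h3).le
    linarith
  induction n with
  | zero => exact ⟨0, le_rfl, 1, zero_le_one, fun x t ht => by simp⟩
  | succ n ih =>
    obtain ⟨K, hK, L, hL, ih⟩ := ih
    refine ⟨K + M * L, by positivity, M * L, by positivity, fun x t ht => ?_⟩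
    obtain ⟨h1, h2⟩ := ih x t ht
    have h3 := hq' (x + n * t) t ht
    have h4 := mul_le_mul_of_nonneg_left h2 hM
    have e : x + ((n + 1 : ℕ) : ℝ) * t = x + n * t + t := by push_cast; ring
    rw [e, add_sub_cancel_right]
    constructor <;> linarith

/-- The points of the line over which a quasisymmetric conjugacy must not send the critical
point: the combinatorial neighbours are not comparable. -/
def badSet (ρ : ℝ) (Y : ℝ → ℝ) (K : ℕ) : Set ℝ :=
  {θ | ∃ qA pA qB pB, RState ρ qA pA qB pB ∧
    K * (Y θ - Y (θ - (pB - qB * ρ))) < Y (θ + (qA * ρ - pA)) - Y θ}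

theorem exists_not_mem_badSet (h : Coord F c d ρ X) (k : Coord G c' d' ρ Y) {f g η : S1 → S1}
    (hf : IsLift f F) (hg : IsLift g G) (hη : QuasiSymm η) (hc : η ∘ f = g ∘ η) {τ : ℝ}
    (hτ : η (X τ : S1) = (c' : S1)) : ∃ K : ℕ, -τ ∉ badSet ρ Y K := by
  obtain ⟨H, hl, M, hM, hq⟩ := hη
  obtain ⟨θ, m, hθ⟩ := h.exists_translation k hf hg hl hc
  obtain ⟨C, hC, hcr⟩ := h.rb_crit
  obtain ⟨K, hK⟩ := qs_multiple hl.1 (fun x t ht => (hq x t ht).2) ⌈C⌉₊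
  have hInt : ∃ l : ℤ, θ = -τ + l := by
    rw [hl.2.2.2, hθ, ← k.zero, S1.coe_eq_coe_iff] at hτ
    obtain ⟨l, hl'⟩ := hτ
    refine ⟨l - m, ?_⟩
    have : Y (τ + θ) = Y (0 + ((l - m : ℤ) : ℝ)) := by
      rw [k.add_int]; push_cast; linarith
    have := k.mono'.injective this
    linarith
  obtain ⟨l, rfl⟩ := hInt
  refine ⟨⌈K⌉₊, ?_⟩
  rintro ⟨qA, pA, qB, pB, s, hs⟩
  have h1 := hcr s 0 (by have := s.one_le; omega)
  simp only [Nat.cast_zero, zero_mul, zero_add, zero_sub] at h1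
  have hpos : 0 < X 0 - X (-(pB - qB * ρ)) := sub_pos.2 (h.mono' (by linarith [s.pos]))
  have h2 := hK (X 0) _ hpos
  have h3 : X (qA * ρ - pA) ≤ X 0 + ⌈C⌉₊ * (X 0 - X (-(pB - qB * ρ))) := by
    have := mul_le_mul_of_nonneg_right (Nat.le_ceil C) hpos.le
    linarith
  have h4 := hl.1.monotone h3
  rw [sub_sub_cancel] at h2
  have h5 := hθ (qA * ρ - pA)
  have h6 := hθ 0
  have h7 := hθ (-(pB - qB * ρ))
  rw [← add_assoc, k.add_int] at h5 h6 h7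
  rw [zero_add] at h6
  rw [show qA * ρ - pA + -τ = -τ + (qA * ρ - pA) by ring] at h5
  rw [show -(pB - qB * ρ) + -τ = -τ - (pB - qB * ρ) by ring] at h7
  have hpos' : 0 < Y (-τ) - Y (-τ - (pB - qB * ρ)) := sub_pos.2 (k.mono' (by linarith [s.pos]))
  have h8 := mul_le_mul_of_nonneg_right (Nat.le_ceil K) hpos'.le
  rw [h6, h7] at h2
  have e : Y (-τ) + l + m - (Y (-τ - (pB - qB * ρ)) + l + m) =
    Y (-τ) - Y (-τ - (pB - qB * ρ)) := by ring
  rw [e] at h2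
  linarith

theorem isOpen_badSet (k : Coord G c' d' ρ Y) (K : ℕ) : IsOpen (badSet ρ Y K) := by
  have : badSet ρ Y K = ⋃ (qA : ℕ) (pA : ℤ) (qB : ℕ) (pB : ℤ) (_ : RState ρ qA pA qB pB),
      {θ | K * (Y θ - Y (θ - (pB - qB * ρ))) < Y (θ + (qA * ρ - pA)) - Y θ} := by
    ext θ; simp [badSet]
  rw [this]
  have hc := k.cont'
  exact isOpen_iUnion fun qA => isOpen_iUnion fun pA => isOpen_iUnion fun qB =>
    isOpen_iUnion fun pB => isOpen_iUnion fun _ => isOpen_lt (by fun_prop) (by fun_prop)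

theorem badSet_add_int (k : Coord G c' d' ρ Y) (K : ℕ) (θ : ℝ) (m : ℤ) :
    θ + m ∈ badSet ρ Y K ↔ θ ∈ badSet ρ Y K := by
  have e : ∀ α β : ℝ, K * (Y (θ + m) - Y (θ + m - β)) < Y (θ + m + α) - Y (θ + m) ↔
      K * (Y θ - Y (θ - β)) < Y (θ + α) - Y θ := fun α β => by
    rw [show θ + m - β = θ - β + m by ring, show θ + m + α = θ + α + m by ring,
      k.add_int, k.add_int, k.add_int, add_sub_add_right_eq_sub, add_sub_add_right_eq_sub]
  simp only [badSet, mem_ofPred_eq, e]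

end Coord

/-- Porous sets are Lebesgue null. -/
theorem volume_eq_zero_of_porous {S : Set ℝ} {K : ℝ}
    (hS : ∀ x ∈ S, ∀ ε > 0, ∃ w r : ℝ, 0 < r ∧ r < ε ∧ |x - w| ≤ K * r ∧
      Disjoint S (Metric.closedBall w r)) : volume S = 0 := by
  have key := IsUnifLocDoublingMeasure.ae_tendsto_measure_inter_div (volume : Measure ℝ) S K
  rw [← Measure.restrict_apply_self]
  refine measure_mono_null (fun x hx => ?_) key
  intro hcon
  choose w r hr hrn hw hd using fun n : ℕ => hS x hx (1 / ((n : ℝ) + 1)) (by positivity)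
  have hlim : Tendsto r atTop (𝓝[>] 0) := by
    refine tendsto_nhdsWithin_iff.2 ⟨?_, Eventually.of_forall hr⟩
    exact squeeze_zero (fun n => (hr n).le) (fun n => (hrn n).le)
      tendsto_one_div_add_atTop_nhds_zero_nat
  have h1 := hcon w r hlim (Eventually.of_forall fun n => by
    rw [Metric.mem_closedBall, Real.dist_eq]; exact hw n)
  have h2 : (fun n => volume (S ∩ Metric.closedBall (w n) (r n)) /
      volume (Metric.closedBall (w n) (r n))) = fun _ => 0 := by
    funext n
    rw [(hd n).inter_eq, measure_empty, ENNReal.zero_div]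
  rw [h2] at h1
  exact zero_ne_one (tendsto_nhds_unique tendsto_const_nhds h1)

theorem bridgeWeight_le_of_le {a j : ℕ} {L : ℝ} (hL : 0 < L) (h1 : L ≤ j + 1) (h2 : L ≤ a - j) :
    bridgeWeight a j ≤ 1 / L ^ 2 := by
  have hja : j ≤ a := by
    have : (j : ℝ) ≤ a := by linarith
    exact_mod_cast this
  have : L ≤ ((min (j + 1) (a - j) : ℕ) : ℝ) := by
    rw [Nat.cast_min]
    refine le_min (by push_cast; exact h1) ?_
    rw [Nat.cast_sub hja]
    exact h2
  unfold bridgeWeight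
  gcongr

namespace Coord
variable {G Y : ℝ → ℝ} {c' d' ρ : ℝ}

set_option maxHeartbeats 1000000 in
/-- The middle part of a long bridge lies in the bad set. -/
theorem exists_middle_bad (k : Coord G c' d' ρ Y) (K : ℕ) : ∃ K' : ℝ, ∀ {qA qB : ℕ} {pA pB : ℤ},
    RState ρ qA pA qB pB → K' * (pB - qB * ρ) < qA * ρ - pA → ∀ i : ℕ, i < qB → ∀ m : ℤ, ∀ θ,
      i * ρ + m + (qA * ρ - pA) / 3 ≤ θ → θ ≤ i * ρ + m + 2 * (qA * ρ - pA) / 3 →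
      θ ∈ badSet ρ Y K := by
  obtain ⟨C, hC, hgap⟩ := k.bridge_gap
  set L : ℝ := 2 * K * C ^ 2 + 1 with hLdef
  have hL1 : 1 ≤ L := by rw [hLdef]; have : 0 ≤ 2 * (K : ℝ) * C ^ 2 := by positivity
                         linarith
  refine ⟨3 * (L + 10), fun {qA qB pA pB} s hK' i hi m θ h1 h2 => ?_⟩
  rw [← k.badSet_add_int K θ (-m)]
  push_cast
  set y := θ + -(m : ℝ) with hy
  obtain ⟨a, ha, s'⟩ := s.next k.irr
  have hb := s'.next_bounds
  have hβ := s.pos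
  have hgap := hgap s s'
  refine ⟨qA, pA, qB, pB, s, ?_⟩
  set α := qA * ρ - pA with hα
  set β := pB - qB * ρ with hβdef
  set w := (i : ℝ) * ρ with hw
  have y1 : w + α / 3 ≤ y := by rw [hy]; linarith
  have y2 : y ≤ w + 2 * α / 3 := by rw [hy]; linarith
  set j := ⌊(w + α - y) / β⌋₊ with hj
  have hq0 : 0 ≤ (w + α - y) / β := div_nonneg (by linarith [hβ.trans s.lt]) hβ.le
  have j1 : j * β ≤ w + α - y := by
    have := Nat.floor_le hq0
    rwa [le_div_iff₀ hβ] at this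
  have j2 : w + α - y < (j + 1) * β := by
    have := Nat.lt_floor_add_one ((w + α - y) / β)
    rwa [div_lt_iff₀ hβ] at this
  have hja : L + 10 < a - j + 1 := by
    have : (L + 10) * β < (a - j + 1) * β := by
      linarith [hb.2, (by ring : (a - j + 1) * β = a * β - j * β + β),
        (by ring : 3 * (L + 10) * β = 3 * ((L + 10) * β))]
    exact lt_of_mul_lt_mul_right this hβ.le
  have hj0 : L + 10 < j + 1 := by
    have : (L + 10) * β < (j + 1) * β := by
      linarith [(by ring : 3 * (L + 10) * β = 3 * ((L + 10) * β))]
    exact lt_of_mul_lt_mul_right this hβ.le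
  have hjlt : j + 1 < a := by
    have : (j : ℝ) + 1 < a := by linarith
    exact_mod_cast this
  have w1 := bridgeWeight_le_of_le (a := a) (j := j) (L := L) (by linarith) (by linarith)
    (by linarith)
  have w2 := bridgeWeight_le_of_le (a := a) (j := j + 1) (L := L) (by linarith)
    (by push_cast; linarith) (by push_cast; linarith)
  have g1 := (hgap j (by omega) i hi).1
  have g2 := (hgap (j + 1) hjlt i hi).1
  have g3 := (hgap 0 (by omega) i hi).2
  have hb0 : bridgeWeight a 0 = 1 := by
    unfold bridgeWeight
    rw [min_eq_left (by omega)]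
    norm_num
  rw [hb0] at g3
  push_cast at g2 g3
  rw [← hw] at g1 g2 g3
  rw [one_mul, zero_mul, sub_zero, zero_add, one_mul] at g3
  have hI : 0 < Y (w + α) - Y w := sub_pos.2 (k.mono' (by linarith [hβ.trans s.lt]))
  have m1 := k.mono'.monotone (show y ≤ w + α - j * β by linarith)
  have m2 := k.mono'.monotone (show w + α - (j + 1 + 1) * β ≤ y - β by linarith)
  have m3 := k.mono'.monotone (show y ≤ w + α - β by
    linarith [(by ring : 3 * (L + 10) * β = 30 * β + 3 * (L * β)), mul_nonneg (by linarith : 0 ≤ L) hβ.le])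
  have m4 := k.mono'.monotone (show w + α ≤ y + α by linarith [hβ.trans s.lt])
  set I := Y (w + α) - Y w with hIdef
  have u1 : Y y - Y (y - β) ≤ 2 * (C * (1 / L ^ 2 * I)) := by
    have e1 : C * (bridgeWeight a j * I) ≤ C * (1 / L ^ 2 * I) := by gcongr
    have e2 : C * (bridgeWeight a (j + 1) * I) ≤ C * (1 / L ^ 2 * I) := by gcongr
    linarith
  have u2 : I ≤ C * (Y (y + α) - Y y) := by
    refine g3.trans (mul_le_mul_of_nonneg_left (by linarith) (by linarith))
  have u3 : C * (K * (Y y - Y (y - β))) < C * (Y (y + α) - Y y) := by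
    refine lt_of_lt_of_le ?_ u2
    calc C * (K * (Y y - Y (y - β))) ≤ C * (K * (2 * (C * (1 / L ^ 2 * I)))) := by gcongr
      _ = (2 * K * C ^ 2) * I / L ^ 2 := by ring
      _ < I := by
        rw [div_lt_iff₀ (by positivity)]
        have : 2 * K * C ^ 2 < L ^ 2 := by
          calc 2 * K * C ^ 2 < L := by rw [hLdef]; linarith
            _ ≤ L ^ 2 := le_self_pow₀ hL1 two_ne_zero
        rw [mul_comm I]
        gcongr
  exact lt_of_mul_lt_mul_left u3 (by linarith)

/-- If `ρ` has arbitrarily lopsided states at small scales then the bad sets have full measure. -/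
theorem volume_compl_badSet (k : Coord G c' d' ρ Y)
    (hρ : ∀ K ε : ℝ, 0 < ε → ∃ qA pA qB pB, RState ρ qA pA qB pB ∧ qA * ρ - pA < ε ∧
      K * (pB - qB * ρ) < qA * ρ - pA) (K : ℕ) : volume (badSet ρ Y K)ᶜ = 0 := by
  obtain ⟨K', hK'⟩ := k.exists_middle_bad K
  refine volume_eq_zero_of_porous (K := 18) fun x _ ε hε => ?_
  obtain ⟨qA, pA, qB, pB, s, hs1, hs2⟩ := hρ K' ε hε
  have hα := s.pos.trans s.lt
  have hnear : ∃ i : ℕ, i < qB ∧ ∃ m : ℤ, |x - (i * ρ + m)| ≤ qA * ρ - pA := by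
    obtain ⟨u, v, ⟨m, ⟨i, h1, h2, h3⟩ | ⟨i, h1, h2, h3⟩⟩, hu, hv⟩ := RGap.cover s x
    · refine ⟨i, h1, m, ?_⟩
      rw [abs_le]
      constructor <;> linarith
    · refine ⟨i, h1.trans_le s.le, m, ?_⟩
      rw [abs_le]
      constructor <;> linarith [s.lt]
  obtain ⟨i, hi, m, hx⟩ := hnear
  refine ⟨i * ρ + m + (qA * ρ - pA) / 2, (qA * ρ - pA) / 6, by linarith, by linarith, ?_, ?_⟩
  · rw [abs_le] at hx ⊢
    constructor <;> linarith
  · rw [disjoint_compl_left_iff_subset]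
    intro θ hθ
    rw [Real.closedBall_eq_Icc] at hθ
    exact hK' s hs2 i hi m θ (by linarith [hθ.1]) (by linarith [hθ.2])

end Coord

/-- A finite measure on the circle invariant under an irrational rotation is absolutely continuous
with respect to Haar measure. -/
theorem Irrational.absolutelyContinuous_of_map_add {ρ : ℝ} (hρ : Irrational ρ) (ν : Measure S1)
    [IsFiniteMeasure ν] (hν : ν.map (fun s => s + (ρ : S1)) = ν) : ν ≪ volume := by
  have hInt : ∀ (φ : BoundedContinuousFunction S1 ℝ) (t : S1),
      ∫ s, φ (t + s) ∂ν = ∫ s, φ s ∂ν := by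
    intro φ
    have hcont : Continuous fun t : S1 => ∫ s, φ (t + s) ∂ν := by
      refine continuous_of_dominated (bound := fun _ => ‖φ‖) (fun t => ?_) (fun t => ?_)
        (integrable_const _) ?_
      · exact (φ.continuous.comp (continuous_const_add t)).aestronglyMeasurable
      · exact Eventually.of_forall fun s => φ.norm_coe_le_norm _
      · exact Eventually.of_forall fun s => φ.continuous.comp (continuous_add_const s)
    have hn : ∀ n : ℕ, ∫ s, φ (n • (ρ : S1) + s) ∂ν = ∫ s, φ s ∂ν := by
      intro n
      induction n with
      | zero => simp
      | succ n ih =>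
        rw [← ih]
        conv_rhs => rw [← hν]
        have hφ : Continuous fun s : S1 => φ (n • (ρ : S1) + s) :=
          φ.continuous.comp (continuous_const_add _)
        rw [integral_map (continuous_add_const (ρ : S1)).aemeasurable hφ.aestronglyMeasurable]
        refine integral_congr_ae (Eventually.of_forall fun s => ?_)
        simp only
        congr 1
        rw [succ_nsmul]; abel
    have := hρ.denseRange_nsmul.equalizer hcont continuous_const (funext hn)
    exact fun t => congrFun this t
  have : ν.IsAddLeftInvariant := by
    refine ⟨fun t => ?_⟩
    have : IsFiniteMeasure (ν.map (t + ·)) := by infer_instance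
    refine ext_of_forall_integral_eq_of_IsFiniteMeasure fun φ => ?_
    rw [integral_map (by fun_prop) φ.continuous.aestronglyMeasurable]
    exact hInt φ t
  exact Measure.absolutelyContinuous_isAddHaarMeasure ν volume

namespace Coord
variable {F X : ℝ → ℝ} {c d ρ : ℝ}

theorem mem_residual_and_measure (h : Coord F c d ρ X) {f : S1 → S1} (hf : IsLift f F)
    (hρ : Irrational ρ) {U : ℕ → Set ℝ} (hU : ∀ K, IsOpen (U K))
    (hper : ∀ K (θ : ℝ) (m : ℤ), θ + m ∈ U K ↔ θ ∈ U K) (hnull : ∀ K, volume (U K)ᶜ = 0)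
    {A : Set S1} (hA : ∀ τ : ℝ, (X τ : S1) ∈ A → ∃ K, -τ ∉ U K)
    (μ : Measure S1) [IsProbabilityMeasure μ] (hμ : μ.map f = μ) :
    Aᶜ ∈ residual S1 ∧ μ Aᶜ = 1 := by
  -- the parameters on the circle of the points avoiding the obstruction
  obtain ⟨V, hV⟩ : ∃ V : ℕ → Set S1, V = fun K => {s | ∀ t : ℝ, (t : S1) = s → -t ∈ U K} :=
    ⟨_, rfl⟩
  have hcoe : ∀ K (t : ℝ), (t : S1) ∈ V K ↔ -t ∈ U K := by
    intro K t
    rw [hV]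
    refine ⟨fun ht => ht t rfl, fun ht u hu => ?_⟩
    obtain ⟨m, rfl⟩ := S1.coe_eq_coe_iff.1 hu
    rw [neg_add, ← hper K _ m]
    simpa using ht
  have hpre : ∀ K, ((↑) : ℝ → S1) ⁻¹' V K = Neg.neg ⁻¹' U K := fun K => Set.ext (hcoe K)
  have hopen : ∀ K, IsOpen (V K) := by
    intro K
    have : IsOpen (((↑) : ℝ → S1) ⁻¹' V K) := by
      rw [hpre]; exact (hU K).preimage continuous_neg
    exact (QuotientAddGroup.isOpenQuotientMap_mk.isQuotientMap.isOpen_preimage).1 this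
  have hVnull : ∀ K, volume (V K)ᶜ = 0 := by
    intro K
    rw [AddCircle.add_projection_respects_measure 1 0 (hopen K).measurableSet.compl]
    refine measure_mono_null inter_subset_left ?_
    rw [preimage_compl]
    have : (QuotientAddGroup.mk ⁻¹' V K : Set ℝ) = Neg.neg ⁻¹' U K := hpre K
    rw [this, ← preimage_compl]
    exact (Measure.measurePreserving_neg (volume : Measure ℝ)).quasiMeasurePreserving.preimage_null
      (hnull K)
  have hdense : ∀ K, Dense (V K) := fun K =>
    (Measure.dense_of_ae (μ := (volume : Measure S1)) (hVnull K))
  have hsub : (⋂ K, h.homeo '' V K) ⊆ Aᶜ := by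
    intro x hx hxA
    obtain ⟨s, rfl⟩ := h.homeo.surjective x
    induction s using QuotientAddGroup.induction_on with | H τ =>
    obtain ⟨K, hK⟩ := hA τ hxA
    refine hK ((hcoe K τ).1 ?_)
    obtain ⟨s, hs, hs'⟩ := mem_iInter.1 hx K
    rwa [← h.homeo.injective hs']
  constructor
  · refine mem_of_superset (countable_iInter_mem.2 fun K => ?_) hsub
    exact residual_of_dense_open (h.homeo.isOpenMap _ (hopen K))
      (h.homeo.surjective.denseRange.dense_image h.homeo.continuous (hdense K))
  · have hsm : Measurable h.homeo.symm := h.homeo.symm.continuous.measurable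
    have hfm : Measurable f := by
      have : f = fun x => h.homeo (h.homeo.symm x + (ρ : S1)) := by
        funext x
        rw [← h.homeo_add hf, Homeomorph.apply_symm_apply]
      rw [this]
      exact (h.homeo.continuous.comp
        ((continuous_add_const _).comp h.homeo.symm.continuous)).measurable
    have hinv : (μ.map h.homeo.symm).map (fun s => s + (ρ : S1)) = μ.map h.homeo.symm := by
      conv_rhs => rw [← hμ]
      rw [Measure.map_map (by fun_prop) hsm, Measure.map_map hsm hfm]
      congr 1
      funext x
      have := h.homeo_add hf (h.homeo.symm x)
      rw [Homeomorph.apply_symm_apply] at this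
      simp [this]
    have hac := hρ.absolutelyContinuous_of_map_add (μ.map h.homeo.symm) hinv
    have hAnull : μ A = 0 := by
      refine measure_mono_null (t := ⋃ K, (h.homeo '' V K)ᶜ) ?_ (measure_iUnion_null fun K => ?_)
      · rw [← compl_iInter]
        exact subset_compl_comm.1 hsub
      · have := hac (hVnull K)
        rw [Measure.map_apply hsm (hopen K).measurableSet.compl] at this
        rw [← this, h.homeo.image_eq_preimage_symm, preimage_compl]
    rw [prob_compl_eq_one_iff₀ (NullMeasurableSet.of_null hAnull)]
    exact hAnull

end Coord

/-- `ρ` has arbitrarily lopsided pairs of closest returns at arbitrarily small scales. -/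
def Lopsided (ρ : ℝ) : Prop :=
  ∀ K ε : ℝ, 0 < ε → ∃ qA pA qB pB, RState ρ qA pA qB pB ∧ qA * ρ - pA < ε ∧
    K * (pB - qB * ρ) < qA * ρ - pA

theorem volume_irrational_not_lopsidedAt (K n : ℕ) :
    volume {ρ : ℝ | Irrational ρ ∧ ¬ ∃ qA pA qB pB, RState ρ qA pA qB pB ∧
      qA * ρ - pA < 1 / (n + 1 : ℝ) ∧ K * (pB - qB * ρ) < qA * ρ - pA} = 0 := by
  refine volume_eq_zero_of_porous (K := 12 * K + 14) fun ρ hρ ε hε => ?_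
  have hn : (0 : ℝ) < 1 / (n + 1 : ℝ) := by positivity
  obtain ⟨qA, pA, qB, pB, s, hα⟩ := RState.exists_small hρ.1 (half_pos (lt_min hε hn))
  have hdet : (qA : ℝ) * pB - qB * pA = 1 := by exact_mod_cast s.det
  have hA : (1 : ℝ) ≤ qA := by exact_mod_cast s.one_le
  have hAB : (qA : ℝ) ≤ qB := by exact_mod_cast s.le
  have hB : (0 : ℝ) < qB := by linarith
  have hβ := s.pos
  have hβα := s.lt
  have hsum : qB * (qA * ρ - pA) + qA * (pB - qB * ρ) = 1 := by linear_combination hdet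
  have hqB : 1 / (qB : ℝ) ≤ 2 * (qA * ρ - pA) := by
    rw [div_le_iff₀ hB]
    have : (qA : ℝ) * (pB - qB * ρ) ≤ qB * (qA * ρ - pA) :=
      mul_le_mul hAB hβα.le hβ.le hB.le
    linarith
  have hαB : qA * ρ - pA ≤ 1 / (qB : ℝ) := by
    rw [le_div_iff₀ hB]
    have : 0 ≤ (qA : ℝ) * (pB - qB * ρ) := by positivity
    linarith
  have hK : (0 : ℝ) ≤ K := K.cast_nonneg
  obtain ⟨r, hr⟩ : ∃ r : ℝ, r = 1 / (12 * (K + 1) * qB ^ 2) := ⟨_, rfl⟩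
  have hr0 : 0 < r := by rw [hr]; positivity
  have hrB : 12 * (K + 1) * (qB * r) = 1 / qB := by rw [hr]; field_simp
  have hgap : (pB : ℝ) / qB - ρ = (pB - qB * ρ) / qB := by field_simp
  have hgap' : (pB - qB * ρ) / qB ≤ 12 * (K + 1) * r := by
    rw [div_le_iff₀ hB]
    calc pB - qB * ρ ≤ 1 / qB := by linarith
      _ = 12 * (K + 1) * r * qB := by rw [← hrB]; ring
  have hgap0 : 0 < (pB - qB * ρ) / qB := by positivity
  have hrlt : r ≤ qB * r := by nlinarith
  have hrlt' : qB * r ≤ 1 / qB := by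
    rw [← hrB]
    nlinarith [mul_nonneg hK (mul_pos hB hr0).le, mul_pos hB hr0]
  have hmin := min_le_left ε (1 / (n + 1 : ℝ))
  have hmin' := min_le_right ε (1 / (n + 1 : ℝ))
  refine ⟨pB / qB - 2 * r, r, hr0, by linarith, ?_, ?_⟩
  · rw [abs_le]
    constructor <;> nlinarith
  · rw [Set.disjoint_left]
    rintro σ ⟨-, hσ⟩ hσr
    rw [Real.closedBall_eq_Icc] at hσr
    obtain ⟨δ, hδ⟩ : ∃ δ, δ = (pB : ℝ) / qB - σ := ⟨_, rfl⟩
    have hδ1 : r ≤ δ := by linarith [hσr.2]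
    have hδ2 : δ ≤ 3 * r := by linarith [hσr.1]
    have hβ' : pB - qB * σ = qB * δ := by rw [hδ]; field_simp
    have hBδ : qB * δ ≤ 3 * (qB * r) := by nlinarith
    have hBδ0 : 0 < qB * δ := mul_pos hB (hr0.trans_le hδ1)
    have hα' : qA * σ - pA = 1 / qB - qA * δ := by
      rw [hδ]; field_simp; linear_combination hdet
    have hAδ : qA * δ ≤ qB * δ := mul_le_mul_of_nonneg_right hAB (hr0.le.trans hδ1)
    have hAδ0 : 0 < qA * δ := mul_pos (by linarith) (hr0.trans_le hδ1)
    have hKβ : K * (qB * δ) ≤ K * (3 * (qB * r)) := mul_le_mul_of_nonneg_left hBδ hK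
    have hr1 : 0 < qB * r := mul_pos hB hr0
    have hKr : 0 ≤ K * (qB * r) := mul_nonneg hK hr1.le
    refine hσ ⟨qA, pA, qB, pB, ⟨s.one_le, s.le, s.det, ?_, ?_⟩, ?_, ?_⟩
    · rwa [hβ']
    · rw [hβ', hα', ← hrB]; linarith
    · rw [hα']; linarith
    · rw [hβ', hα', ← hrB]; linarith

theorem volume_not_lopsided : volume {ρ : ℝ | ¬ (Irrational ρ ∧ Lopsided ρ)} = 0 := by
  have h1 : volume {ρ : ℝ | ¬ Irrational ρ} = 0 := by
    have : {ρ : ℝ | ¬ Irrational ρ} = Set.range ((↑) : ℚ → ℝ) := by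
      ext; simp [Irrational]
    rw [this]
    exact (Set.countable_range _).measure_zero _
  refine measure_mono_null ?_ (measure_union_null h1 (measure_iUnion_null fun K : ℕ =>
    measure_iUnion_null fun n : ℕ => volume_irrational_not_lopsidedAt K n))
  intro ρ hρ
  by_cases hi : Irrational ρ
  · right
    by_contra hcon
    refine hρ ⟨hi, fun K ε hε => ?_⟩
    obtain ⟨N, hN⟩ := exists_nat_ge K
    obtain ⟨n, hn⟩ := exists_nat_one_div_lt hε
    obtain ⟨qA, pA, qB, pB, s, h1, h2⟩ := not_not.1 fun hne => hcon (mem_iUnion₂.2 ⟨N, n, hi, hne⟩)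
    exact ⟨qA, pA, qB, pB, s, h1.trans hn,
      (mul_le_mul_of_nonneg_right hN s.pos.le).trans_lt h2⟩
  · exact Or.inl hi

/-- **Theorem A (Coexistence).** There is a full-measure set `R_A ⊆ [0,1]` of irrational numbers
such that for any two `C³` unicritical circle maps `f, g` with the same rotation number in `R_A`,
the set `𝒜` of points `x` for which the conjugacy sending `x` to the critical point of `g` is
quasisymmetric is dense, while its complement `ℬ` contains a residual set and has full
`μ_f`-measure. -/
theorem thmA :
    ∃ RA : Set ℝ, RA ⊆ Icc (0 : ℝ) 1 ∧ (∀ ρ ∈ RA, Irrational ρ) ∧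
      volume (Icc (0 : ℝ) 1 \ RA) = 0 ∧
      ∀ (f g : S1 → S1) (cf cg : S1) (ρ : ℝ), ρ ∈ RA →
        Unicritical f cf 3 → Unicritical g cg 3 →
        HasRotNum f ρ → HasRotNum g ρ →
        ∀ μf : Measure S1, IsProbabilityMeasure μf → μf.map f = μf →
          Dense {x : S1 | ∃ h : S1 → S1, QuasiSymm h ∧ h ∘ f = g ∘ h ∧ h x = cg} ∧
          {x : S1 | ∃ h : S1 → S1, QuasiSymm h ∧ h ∘ f = g ∘ h ∧ h x = cg}ᶜ ∈ residual S1 ∧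
          μf {x : S1 | ∃ h : S1 → S1, QuasiSymm h ∧ h ∘ f = g ∘ h ∧ h x = cg}ᶜ = 1 := by
  refine ⟨{ρ | ρ ∈ Icc (0 : ℝ) 1 ∧ Irrational ρ ∧ Lopsided ρ}, fun ρ hρ => hρ.1,
    fun ρ hρ => hρ.2.1, measure_mono_null (fun ρ hρ h => hρ.2 ⟨hρ.1, h⟩) volume_not_lopsided, ?_⟩
  rintro f g cf cg ρ ⟨-, hρ, hlop⟩ hf hg hrf hrg μ _ hμ
  obtain ⟨F, X, c, d, hF, -, h⟩ := exists_coord_of_unicritical hf hrf hρ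
  obtain ⟨G, Y, c', d', hG, rfl, k⟩ := exists_coord_of_unicritical hg hrg hρ
  refine ⟨h.dense_quasiSymm k hF hG, h.mem_residual_and_measure hF hρ k.isOpen_badSet
    k.badSet_add_int (k.volume_compl_badSet hlop)
    (fun τ hA => ?_) μ hμ⟩
  obtain ⟨η, hη, hc, hτ⟩ := hA
  exact h.exists_not_mem_badSet k hF hG hη hc hτ
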